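/- arXiv:1705.07068 — 2 statements merged into one kernel-verified Lean document; each statement's English description precedes it below -/
import Mathlib

section
/- There exists a constant C > 0 such that for all (ℓ,m) ∈ ℕ×ℤ with |m| ≤ ℓ and all x ∈ [−1,1], |Ỹ_{ℓ,m}(x)| ≤ C ((1+|m|)(1+ℓ)^{−2} + |x² − a_{ℓ,m}²|)^{−1/4}. -/
open MeasureTheory Set
open scoped ENNReal NNReal

noncomputable section

/-- The Legendre polynomial `P_ℓ(x) = (2^ℓ ℓ!)⁻¹ (d/dx)^ℓ (x²−1)^ℓ`. -/
def legendreP (n : ℕ) (x : ℝ) : ℝ :=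
  ((2:ℝ)^n * (Nat.factorial n : ℝ))⁻¹ * iteratedDeriv n (fun y => (y^2 - 1)^n) x

/-- The associated Legendre function `P_ℓ^m` for `0 ≤ m ≤ ℓ`
(on `[-1,1]`, where `√(1-x²)^m = (1-x²)^{m/2}`). -/
def assocP (n m : ℕ) (x : ℝ) : ℝ :=
  (-1:ℝ)^m * Real.sqrt (1 - x^2) ^ m * iteratedDeriv m (legendreP n) x

/-- The associated Legendre function `P_ℓ^m` for integer `m` with `|m| ≤ ℓ`. -/
def assocPZ (n : ℕ) (m : ℤ) (x : ℝ) : ℝ :=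
  if 0 ≤ m then assocP n m.toNat x
  else (-1:ℝ)^m.natAbs *
    ((Nat.factorial (n - m.natAbs) : ℝ) / (Nat.factorial (n + m.natAbs) : ℝ)) *
    assocP n m.natAbs x

/-- `Ỹ_{ℓ,m}(x) = ((2ℓ+1)/(4π) · (ℓ−m)!/(ℓ+m)!)^{1/2} P_ℓ^m(x)`. -/
def tY (n : ℕ) (m : ℤ) (x : ℝ) : ℝ :=
  Real.sqrt (((2*(n:ℝ)+1) / (4*Real.pi)) *
    ((Nat.factorial ((n : ℤ) - m).toNat : ℝ) / (Nat.factorial ((n : ℤ) + m).toNat : ℝ))) *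
  assocPZ n m x

/-- `b_{ℓ,m} = |m|/(ℓ+1/2)`. -/
def blm (n : ℕ) (m : ℤ) : ℝ := |(m : ℝ)| / ((n : ℝ) + 1/2)

/-- `a_{ℓ,m} = (1 − b_{ℓ,m}²)^{1/2}`. -/
def alm (n : ℕ) (m : ℤ) : ℝ := Real.sqrt (1 - blm n m ^ 2)

/-- The quadratic quantities `A = u²`, `B = u · Du`, `E = (Du)²`, with `D = (1 - x²) d/dx`, attached
to an even or odd solution of the associated Legendre equation
`D²u + (L (1 - x²) - m²) u = 0` which is regular at `x = 1` and suitably normalised. -/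
structure LegendreSystem (L m : ℝ) (A B E : ℝ → ℝ) : Prop where
  contA : Continuous A
  contB : Continuous B
  contE : Continuous E
  derivA : ∀ x ∈ Ioo (0:ℝ) 1, HasDerivAt A (2 * B x / (1 - x ^ 2)) x
  derivB : ∀ x ∈ Ioo (0:ℝ) 1,
    HasDerivAt B ((E x - (L * (1 - x ^ 2) - m ^ 2) * A x) / (1 - x ^ 2)) x
  derivE : ∀ x ∈ Ioo (0:ℝ) 1,
    HasDerivAt E (-2 * (L * (1 - x ^ 2) - m ^ 2) * B x / (1 - x ^ 2)) x
  A_nonneg : ∀ x ∈ Icc (0:ℝ) 1, 0 ≤ A x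
  E_nonneg : ∀ x ∈ Icc (0:ℝ) 1, 0 ≤ E x
  sq_eq : ∀ x, B x ^ 2 = A x * E x
  B_zero : B 0 = 0
  B_one : B 1 = 0
  E_one : E 1 = 0
  A_one : m = 0 ∨ A 1 = 0
  mass : ∫ x in (0:ℝ)..1, A x ≤ 1

namespace LegendreSystem

variable {L m : ℝ} {A B E : ℝ → ℝ}

lemma one_sub_sq_pos {x : ℝ} (hx : x ∈ Ioo (0:ℝ) 1) : 0 < 1 - x ^ 2 := by
  nlinarith [hx.1, hx.2]

lemma monotoneOn_of_hasDerivAt {f f' : ℝ → ℝ} {a b : ℝ} (hf : ContinuousOn f (Icc a b))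
    (hd : ∀ x ∈ Ioo a b, HasDerivAt f (f' x) x) (h0 : ∀ x ∈ Ioo a b, 0 ≤ f' x) :
    MonotoneOn f (Icc a b) := by
  apply monotoneOn_of_deriv_nonneg (convex_Icc a b) hf
  · rw [interior_Icc]
    exact fun x hx => (hd x hx).differentiableAt.differentiableWithinAt
  · rw [interior_Icc]
    intro x hx
    rw [(hd x hx).deriv]
    exact h0 x hx

lemma le_of_hasDerivAt {f f' : ℝ → ℝ} {a b : ℝ} (hab : a ≤ b) (hf : ContinuousOn f (Icc a b))
    (hd : ∀ x ∈ Ioo a b, HasDerivAt f (f' x) x) (h0 : ∀ x ∈ Ioo a b, 0 ≤ f' x) :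
    f a ≤ f b :=
  monotoneOn_of_hasDerivAt hf hd h0 (left_mem_Icc.2 hab) (right_mem_Icc.2 hab) hab

lemma hasDerivAt_energy (h : LegendreSystem L m A B E) {x : ℝ} (hx : x ∈ Ioo (0:ℝ) 1) :
    HasDerivAt (fun y => E y + (L * (1 - y ^ 2) - m ^ 2) * A y) (-2 * L * x * A x) x := by
  have hp := one_sub_sq_pos hx
  have h1 : HasDerivAt (fun y : ℝ => L * (1 - y ^ 2) - m ^ 2) (L * (-(2 * x))) x := by
    have := (((hasDerivAt_pow 2 x).const_sub 1).const_mul L).sub_const (m ^ 2)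
    simpa using this
  refine ((h.derivE x hx).add (h1.mul (h.derivA x hx))).congr_deriv ?_
  field_simp
  ring

lemma energy_one (h : LegendreSystem L m A B E) :
    E 1 + (L * (1 - (1:ℝ) ^ 2) - m ^ 2) * A 1 = 0 := by
  rw [h.E_one]
  rcases h.A_one with h0 | h0 <;> simp [h0]

lemma continuous_energy (h : LegendreSystem L m A B E) :
    Continuous (fun y => E y + (L * (1 - y ^ 2) - m ^ 2) * A y) := by
  have := h.contA
  have := h.contE
  fun_prop

lemma energy_nonneg (h : LegendreSystem L m A B E) (hL : 0 ≤ L) {x : ℝ} (hx : x ∈ Icc (0:ℝ) 1) :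
    0 ≤ E x + (L * (1 - x ^ 2) - m ^ 2) * A x := by
  have := le_of_hasDerivAt (f := fun y => -(E y + (L * (1 - y ^ 2) - m ^ 2) * A y)) hx.2
    h.continuous_energy.neg.continuousOn
    (fun y hy => (h.hasDerivAt_energy ⟨hx.1.trans_lt hy.1, hy.2⟩).neg)
    (fun y hy => by
      have hy0 : 0 ≤ y := hx.1.trans hy.1.le
      have := h.A_nonneg y ⟨hy0, hy.2.le⟩
      have : 0 ≤ L * y * A y := by positivity
      linarith)
  have h1 := h.energy_one
  linarith

/-- The total energy at `0` is controlled by the first moment of the density. -/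
lemma energy_zero_eq (h : LegendreSystem L m A B E) :
    E 0 + (L - m ^ 2) * A 0 = 2 * L * ∫ x in (0:ℝ)..1, x * A x := by
  have hc := h.contA
  have := intervalIntegral.integral_eq_sub_of_hasDerivAt_of_le (zero_le_one' ℝ)
    h.continuous_energy.continuousOn (fun x hx => h.hasDerivAt_energy hx)
    (Continuous.intervalIntegrable (by fun_prop) _ _)
  rw [h.energy_one] at this
  have e : (∫ y in (0:ℝ)..1, -2 * L * y * A y) = -2 * L * ∫ x in (0:ℝ)..1, x * A x := by
    rw [← intervalIntegral.integral_const_mul]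
    congr 1
    ext y
    ring
  rw [e] at this
  norm_num at this
  linarith

/-- A virial type inequality. -/
lemma virial (h : LegendreSystem L m A B E) :
    m ^ 2 * ∫ x in (0:ℝ)..1, x ^ 2 * A x ≤ (L - m ^ 2) * ∫ x in (0:ℝ)..1, A x := by
  have hc := h.contA
  have hB := h.contB
  have hg : Continuous (fun y => (L - m ^ 2 * (1 + y ^ 2)) * A y) := by fun_prop
  have := le_of_hasDerivAt
    (f := fun x => B x + ∫ y in (0:ℝ)..x, (L - m ^ 2 * (1 + y ^ 2)) * A y) (zero_le_one' ℝ)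
    ((hB.add (intervalIntegral.continuous_primitive (fun a b => hg.intervalIntegrable a b)
      0)).continuousOn)
    (fun x hx => (h.derivB x hx).add (hg.integral_hasStrictDerivAt 0 x).hasDerivAt)
    (fun x hx => by
      have hp := one_sub_sq_pos hx
      have hA := h.A_nonneg x ⟨hx.1.le, hx.2.le⟩
      have hE := h.E_nonneg x ⟨hx.1.le, hx.2.le⟩
      have : (E x - (L * (1 - x ^ 2) - m ^ 2) * A x) / (1 - x ^ 2)
          + (L - m ^ 2 * (1 + x ^ 2)) * A x = (E x + m ^ 2 * x ^ 4 * A x) / (1 - x ^ 2) := by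
        field_simp
        ring
      rw [this]
      positivity)
  simp only [h.B_zero, h.B_one, intervalIntegral.integral_same, zero_add] at this
  have e : (∫ y in (0:ℝ)..1, (L - m ^ 2 * (1 + y ^ 2)) * A y)
      = (L - m ^ 2) * (∫ x in (0:ℝ)..1, A x) - m ^ 2 * ∫ x in (0:ℝ)..1, x ^ 2 * A x := by
    rw [← intervalIntegral.integral_const_mul, ← intervalIntegral.integral_const_mul,
      ← intervalIntegral.integral_sub (Continuous.intervalIntegrable (by fun_prop) _ _)
        (Continuous.intervalIntegrable (by fun_prop) _ _)]
    congr 1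
    ext y
    ring
  rw [e] at this
  linarith

lemma first_moment_le (h : LegendreSystem L m A B E) (hL : 0 < L) {a : ℝ} (ha : 0 < a)
    (haL : a ^ 2 * L = L - m ^ 2) : ∫ x in (0:ℝ)..1, x * A x ≤ 2 * a := by
  have hc := h.contA
  have hI := h.mass
  have hI0 : 0 ≤ ∫ x in (0:ℝ)..1, A x :=
    intervalIntegral.integral_nonneg zero_le_one h.A_nonneg
  by_cases hm : L / 2 ≤ m ^ 2
  · have hv := h.virial
    rw [← haL] at hv
    have hJ0 : 0 ≤ ∫ x in (0:ℝ)..1, x ^ 2 * A x :=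
      intervalIntegral.integral_nonneg zero_le_one
        (fun x hx => mul_nonneg (sq_nonneg _) (h.A_nonneg x hx))
    have hJ : ∫ x in (0:ℝ)..1, x ^ 2 * A x ≤ 2 * a ^ 2 := by
      have h1 : L / 2 * ∫ x in (0:ℝ)..1, x ^ 2 * A x ≤ a ^ 2 * L :=
        calc _ ≤ _ := mul_le_mul_of_nonneg_right hm hJ0
          _ ≤ _ := hv
          _ ≤ a ^ 2 * L * 1 := mul_le_mul_of_nonneg_left hI (by positivity)
          _ = _ := mul_one _
      have h2 : L * ((∫ x in (0:ℝ)..1, x ^ 2 * A x) - 2 * a ^ 2) ≤ 0 := by linarith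
      nlinarith [h2]
    have hle : ∫ x in (0:ℝ)..1, x * A x
        ≤ ∫ x in (0:ℝ)..1, (1 / (2 * a) * (x ^ 2 * A x) + a / 2 * A x) := by
      apply intervalIntegral.integral_mono_on zero_le_one
        (Continuous.intervalIntegrable (by fun_prop) _ _)
        (Continuous.intervalIntegrable (by fun_prop) _ _)
      intro x hx
      have hA := h.A_nonneg x hx
      have : 1 / (2 * a) * (x ^ 2 * A x) + a / 2 * A x - x * A x
          = (x - a) ^ 2 * A x / (2 * a) := by
        field_simp
        ring
      have : 0 ≤ (x - a) ^ 2 * A x / (2 * a) := by positivity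
      linarith
    rw [intervalIntegral.integral_add (Continuous.intervalIntegrable (by fun_prop) _ _)
        (Continuous.intervalIntegrable (by fun_prop) _ _),
      intervalIntegral.integral_const_mul, intervalIntegral.integral_const_mul] at hle
    have h3 : 1 / (2 * a) * ∫ x in (0:ℝ)..1, x ^ 2 * A x ≤ 1 / (2 * a) * (2 * a ^ 2) := by
      gcongr
    have h4 : 1 / (2 * a) * (2 * a ^ 2) = a := by field_simp
    have h5 : a / 2 * ∫ x in (0:ℝ)..1, A x ≤ a / 2 * 1 := by gcongr
    linarith
  · push Not at hm
    have ha2 : 1 / 2 < a ^ 2 := by nlinarith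
    have ha1 : 1 / 2 < a := by nlinarith
    have hle : ∫ x in (0:ℝ)..1, x * A x ≤ ∫ x in (0:ℝ)..1, A x := by
      apply intervalIntegral.integral_mono_on zero_le_one
        (Continuous.intervalIntegrable (by fun_prop) _ _)
        (Continuous.intervalIntegrable (by fun_prop) _ _)
      intro x hx
      exact mul_le_of_le_one_left (h.A_nonneg x hx) hx.2
    linarith

lemma energy_zero_le (h : LegendreSystem L m A B E) (hL : 0 < L) {a : ℝ} (ha : 0 < a)
    (haL : a ^ 2 * L = L - m ^ 2) : E 0 + (L - m ^ 2) * A 0 ≤ 4 * L * a := by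
  rw [h.energy_zero_eq]
  nlinarith [h.first_moment_le hL ha haL]


lemma hasDerivAt_one_sub_sq (L : ℝ) (x : ℝ) :
    HasDerivAt (fun y : ℝ => L * (1 - y ^ 2)) (-2 * L * x) x := by
  refine (((hasDerivAt_pow 2 x).const_sub 1).const_mul L).congr_deriv ?_
  norm_num
  ring

/-- The adiabatically corrected energy `g (Du)² - (Dg) u (Du) + (g Q + D²g / 2) u²` with
`Q = L (1 - x²) - m²` and `g = (Q + c) ^ (-1/2)`. -/
def corrected (L m c : ℝ) (A B E : ℝ → ℝ) (x : ℝ) : ℝ :=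
  (E x - x * (L * (1 - x ^ 2)) / (L * (1 - x ^ 2) - m ^ 2 + c) * B x
    + (L * (1 - x ^ 2) - m ^ 2
      - (3 * x ^ 2 - 1) * (L * (1 - x ^ 2)) / (2 * (L * (1 - x ^ 2) - m ^ 2 + c))
      + 3 / 2 * (x * (L * (1 - x ^ 2)) / (L * (1 - x ^ 2) - m ^ 2 + c)) ^ 2) * A x)
  / √(L * (1 - x ^ 2) - m ^ 2 + c)

lemma hasDerivAt_corrected (h : LegendreSystem L m A B E) {c x : ℝ} (hx : x ∈ Ioo (0:ℝ) 1)
    (hW : 0 < L * (1 - x ^ 2) - m ^ 2 + c) :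
    HasDerivAt (corrected L m c A B E)
      (-(L * x * A x * (4 * c * (L * (1 - x ^ 2) - m ^ 2 + c) ^ 2
        - ((12 * x ^ 2 - 8) * (L * (1 - x ^ 2) - m ^ 2 + c) ^ 2
          + (9 - 27 * x ^ 2) * (L * (1 - x ^ 2)) * (L * (1 - x ^ 2) - m ^ 2 + c)
          + 15 * x ^ 2 * (L * (1 - x ^ 2)) ^ 2))
        / (2 * (L * (1 - x ^ 2) - m ^ 2 + c) ^ 3 * √(L * (1 - x ^ 2) - m ^ 2 + c)))) x := by
  have hp := one_sub_sq_pos hx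
  have hR := hasDerivAt_one_sub_sq L x
  have hQ := hR.sub_const (m ^ 2)
  have hWd := hQ.add_const c
  have hs := hWd.sqrt hW.ne'
  have hq := ((hasDerivAt_id x).mul hR).div hWd hW.ne'
  have hr := (((((hasDerivAt_pow 2 x).const_mul 3).sub_const 1).mul hR).div
    (hWd.const_mul 2) (by positivity))
  have hs0 : 0 < √(L * (1 - x ^ 2) - m ^ 2 + c) := Real.sqrt_pos.2 hW
  have hmain := ((((h.derivE x hx).sub (hq.mul (h.derivB x hx))).add
    (((hQ.sub hr).add ((hq.pow 2).const_mul (3 / 2))).mul (h.derivA x hx))).div hs hs0.ne')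
  refine HasDerivAt.congr_deriv (f := corrected L m c A B E) hmain ?_
  simp only [Pi.mul_apply, Pi.div_apply, Pi.sub_apply, Pi.add_apply, Pi.pow_apply, id, Nat.add_one_sub_one,
    pow_one]
  have hss := Real.sq_sqrt hW.le
  clear hmain hr hq hs hWd hQ hR
  generalize √(L * (1 - x ^ 2) - m ^ 2 + c) = s at *
  generalize hWe : L * (1 - x ^ 2) - m ^ 2 + c = W at *
  rw [hss]
  have hc : c = W - L * (1 - x ^ 2) + m ^ 2 := by rw [← hWe]; ring
  have hWs : W ≠ 0 := hW.ne'
  rw [hc]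
  clear hc hWe
  field_simp
  rw [hss]
  field_simp
  ring

lemma corrected_le_zero (h : LegendreSystem L m A B E) {d x : ℝ} (hL : 0 < L) (hm : 0 ≤ m)
    (hd : 1 ≤ d) (hmd : m ≤ d) (hd3 : 2 * (L - m ^ 2) * m ^ 4 ≤ d ^ 3 * L)
    (hx : x ∈ Ico (0:ℝ) 1)
    (hQ : 0 ≤ L * (1 - x ^ 2) - m ^ 2) :
    corrected L m (22 * d) A B E x ≤ corrected L m (22 * d) A B E 0 := by
  have hQ' : ∀ y ∈ Icc 0 x, 0 ≤ L * (1 - y ^ 2) - m ^ 2 := by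
    intro y hy
    have : y ^ 2 ≤ x ^ 2 := pow_le_pow_left₀ hy.1 hy.2 2
    nlinarith
  have hcont : ContinuousOn (corrected L m (22 * d) A B E) (Icc 0 x) := by
    have h1 := h.contA
    have h2 := h.contB
    have h3 := h.contE
    have hW : ∀ y ∈ Icc 0 x, L * (1 - y ^ 2) - m ^ 2 + 22 * d ≠ 0 := fun y hy => by
      linarith [hQ' y hy]
    have hs : ∀ y ∈ Icc 0 x, √(L * (1 - y ^ 2) - m ^ 2 + 22 * d) ≠ 0 := fun y hy =>
      (Real.sqrt_pos.2 (by linarith [hQ' y hy])).ne'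
    have hW2 : ∀ y ∈ Icc 0 x, 2 * (L * (1 - y ^ 2) - m ^ 2 + 22 * d) ≠ 0 := fun y hy => by
      linarith [hQ' y hy]
    unfold corrected
    refine ContinuousOn.div ?_ (by fun_prop) hs
    have c1 : ContinuousOn
        (fun y => y * (L * (1 - y ^ 2)) / (L * (1 - y ^ 2) - m ^ 2 + 22 * d)) (Icc 0 x) :=
      ContinuousOn.div (by fun_prop) (by fun_prop) hW
    have c2 : ContinuousOn (fun y => (3 * y ^ 2 - 1) * (L * (1 - y ^ 2))
        / (2 * (L * (1 - y ^ 2) - m ^ 2 + 22 * d))) (Icc 0 x) :=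
      ContinuousOn.div (by fun_prop) (by fun_prop) hW2
    fun_prop
  have := le_of_hasDerivAt (f := fun y => -corrected L m (22 * d) A B E y) hx.1 hcont.neg
    (fun y hy => (h.hasDerivAt_corrected ⟨hy.1, hy.2.trans hx.2⟩
      (by linarith [hQ' y ⟨hy.1.le, hy.2.le⟩])).neg)
    (fun y hy => ?_)
  · linarith
  have hy1 : y < 1 := hy.2.trans hx.2
  have hA := h.A_nonneg y ⟨hy.1.le, hy1.le⟩
  have hq := hQ' y ⟨hy.1.le, hy.2.le⟩
  have hy0 := hy.1
  rw [neg_neg]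
  have hR0 : 0 ≤ L * (1 - y ^ 2) := by nlinarith [sq_nonneg m]
  obtain ⟨q, hqe⟩ : ∃ q, q = L * (1 - y ^ 2) - m ^ 2 := ⟨_, rfl⟩
  have hRe : L * (1 - y ^ 2) = q + m ^ 2 := by rw [hqe]; ring
  rw [hRe] at hq hR0 ⊢
  have hW : 0 < q + m ^ 2 - m ^ 2 + 22 * d := by linarith
  refine div_nonneg (mul_nonneg (by positivity) ?_) (by positivity)
  have hw : q + m ^ 2 - m ^ 2 + 22 * d = q + 22 * d := by ring
  rw [hw]
  have hq0 : 0 ≤ q := by linarith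
  have hturn : 2 * y ^ 2 * m ^ 4 ≤ d ^ 3 := by
    have h1 : L * y ^ 2 ≤ L - m ^ 2 := by linarith
    have h2 : L * (2 * y ^ 2 * m ^ 4) ≤ L * d ^ 3 := by
      have := mul_le_mul_of_nonneg_right h1 (by positivity : 0 ≤ 2 * m ^ 4)
      linarith
    exact le_of_mul_le_mul_left h2 hL
  have hyy : y ^ 2 ≤ 1 := by nlinarith
  have hm2 : m ^ 2 ≤ d ^ 2 := pow_le_pow_left₀ hm hmd 2
  set w := q + 22 * d with hwdef
  have e1 : (12 * y ^ 2 - 8) * w ^ 2 ≤ 4 * w ^ 2 := by nlinarith [sq_nonneg w]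
  have e2 : (9 - 27 * y ^ 2) * (q + m ^ 2) * w ≤ 9 * w ^ 2 + 9 * d * w ^ 2 := by
    have a1 : (9 - 27 * y ^ 2) * ((q + m ^ 2) * w) ≤ 9 * ((q + m ^ 2) * w) := by
      have : 0 ≤ (q + m ^ 2) * w := by positivity
      nlinarith
    have a2 : q + m ^ 2 ≤ w + d * w := by nlinarith
    nlinarith
  have e3 : 15 * y ^ 2 * (q + m ^ 2) ^ 2 ≤ 30 * w ^ 2 + d * w ^ 2 := by
    have a1 : (q + m ^ 2) ^ 2 ≤ 2 * q ^ 2 + 2 * m ^ 4 := by nlinarith [sq_nonneg (q - m ^ 2)]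
    have a2 : 15 * y ^ 2 * (q + m ^ 2) ^ 2 ≤ 15 * y ^ 2 * (2 * q ^ 2 + 2 * m ^ 4) := by
      gcongr
    have a3 : y ^ 2 * q ^ 2 ≤ w ^ 2 := by
      have : q ^ 2 ≤ w ^ 2 := by gcongr; linarith
      nlinarith [sq_nonneg q]
    have a4 : 484 * d ^ 2 ≤ w ^ 2 := by
      have : (22 * d) ^ 2 ≤ w ^ 2 := by gcongr; linarith
      linarith
    have a5 : 484 * d ^ 3 ≤ d * w ^ 2 := by nlinarith
    have : 0 ≤ d ^ 3 := by positivity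
    nlinarith
  have e4 : w ^ 2 ≤ d * w ^ 2 := by nlinarith [sq_nonneg w]
  nlinarith

/-- The corrected energy at the equator. -/
lemma corrected_zero_le (h : LegendreSystem L m A B E) {d : ℝ} (hL : 0 < L) (hm : 0 ≤ m)
    (hy : 0 < L - m ^ 2) (hLm : m ≤ L - m ^ 2) (hd : 1 ≤ d) (hmd : m ≤ d) :
    corrected L m (22 * d) A B E 0 ≤ 8 * √L := by
  have ha2 : 0 < (L - m ^ 2) / L := by apply div_pos <;> linarith
  have haL : √((L - m ^ 2) / L) ^ 2 * L = L - m ^ 2 := by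
    rw [Real.sq_sqrt ha2.le]
    field_simp
  have he := h.energy_zero_le hL (Real.sqrt_pos.2 ha2) haL
  have hA := h.A_nonneg 0 (by simp)
  have hE := h.E_nonneg 0 (by simp)
  unfold corrected
  have hW : 0 < L - m ^ 2 + 22 * d := by linarith
  norm_num
  rw [div_le_iff₀ (Real.sqrt_pos.2 hW)]
  have h1 : L / (2 * (L - m ^ 2 + 22 * d)) ≤ L - m ^ 2 := by
    rw [div_le_iff₀ (by positivity)]
    have hm2 : m ^ 2 ≤ (L - m ^ 2) * d := by nlinarith
    nlinarith
  have h2 : √L * √((L - m ^ 2) / L) ≤ √(L - m ^ 2 + 22 * d) := by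
    rw [← Real.sqrt_mul hL.le]
    apply Real.sqrt_le_sqrt
    field_simp
    linarith
  have h3 : L * √((L - m ^ 2) / L) ≤ √L * √(L - m ^ 2 + 22 * d) := by
    calc _ = √L * (√L * √((L - m ^ 2) / L)) := by rw [← mul_assoc, Real.mul_self_sqrt hL.le]
      _ ≤ _ := by gcongr
  have h4 : (L - m ^ 2 + L / (2 * (L - m ^ 2 + 22 * d))) * A 0 ≤ 2 * ((L - m ^ 2) * A 0) := by
    nlinarith
  rw [neg_div, sub_neg_eq_add]
  linarith

lemma le_corrected (h : LegendreSystem L m A B E) {d x : ℝ} (hm : 0 ≤ m)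
    (hd : 1 ≤ d) (hmd : m ≤ d) (hx : x ∈ Icc (0:ℝ) 1)
    (hQ : 0 < L * (1 - x ^ 2) - m ^ 2)
    (hQd : m = 0 ∨ d / 4 ≤ L * (1 - x ^ 2) - m ^ 2) :
    (L * (1 - x ^ 2) - m ^ 2) * A x / (2 * √(L * (1 - x ^ 2) - m ^ 2 + 22 * d))
      ≤ corrected L m (22 * d) A B E x := by
  have hA := h.A_nonneg x hx
  have hE := h.E_nonneg x hx
  have hsq := h.sq_eq x
  obtain ⟨q, hqe⟩ : ∃ q, q = L * (1 - x ^ 2) - m ^ 2 := ⟨_, rfl⟩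
  have hRe : L * (1 - x ^ 2) = q + m ^ 2 := by rw [hqe]; ring
  unfold corrected
  rw [← hqe] at hQ hQd ⊢
  rw [hRe]
  have hw : 0 < q + 22 * d := by linarith
  rw [mul_comm 2 (√_), ← div_div, div_right_comm]
  refine div_le_div_of_nonneg_right ?_ (Real.sqrt_nonneg _)
  obtain ⟨t, ht⟩ : ∃ t, t = x * (q + m ^ 2) / (q + 22 * d) := ⟨_, rfl⟩
  rw [← ht]
  have h1 : (3 * x ^ 2 - 1) * (q + m ^ 2) / (2 * (q + 22 * d)) ≤ q / 2 := by
    rw [div_le_iff₀ (by positivity)]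
    have hxx : x ^ 2 ≤ 1 := by nlinarith [hx.1, hx.2]
    have a1 : (3 * x ^ 2 - 1) * (q + m ^ 2) ≤ 2 * (q + m ^ 2) := by
      have : 0 ≤ q + m ^ 2 := by positivity
      nlinarith
    have a2 : m ^ 2 ≤ 4 * (q * d) := by
      rcases hQd with h0 | h0
      · rw [h0, zero_pow two_ne_zero]; positivity
      · nlinarith
    nlinarith
  have h2 : 0 ≤ E x - t * B x + t ^ 2 / 4 * A x := by
    rcases hA.eq_or_lt with h0 | h0
    · rw [← h0, zero_mul] at hsq
      have : B x = 0 := by simpa using hsq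
      rw [this, ← h0]
      simpa using hE
    · have : 0 ≤ A x * (E x - t * B x + t ^ 2 / 4 * A x) := by
        nlinarith [sq_nonneg (B x - t / 2 * A x)]
      exact nonneg_of_mul_nonneg_right this h0
  nlinarith [mul_nonneg (sq_nonneg t) hA, mul_le_mul_of_nonneg_right h1 hA]

lemma bulk_bound (h : LegendreSystem L m A B E) {d x : ℝ} (hL : 0 < L) (hm : 0 ≤ m)
    (hy : 0 < L - m ^ 2) (hLm : m ≤ L - m ^ 2) (hd : 1 ≤ d) (hmd : m ≤ d)
    (hd3 : 2 * (L - m ^ 2) * m ^ 4 ≤ d ^ 3 * L) (hx : x ∈ Icc (0:ℝ) 1)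
    (hQd : d / 4 ≤ L * (1 - x ^ 2) - m ^ 2) :
    (L * (1 - x ^ 2) - m ^ 2) * A x ^ 2 ≤ 22784 * L := by
  have hQ : 0 < L * (1 - x ^ 2) - m ^ 2 := by linarith
  have hx1 : x < 1 := by
    refine lt_of_le_of_ne hx.2 fun h0 => ?_
    rw [h0] at hQ
    nlinarith [sq_nonneg m]
  have hA := h.A_nonneg x hx
  have h1 := (h.le_corrected hm hd hmd hx hQ (Or.inr hQd)).trans
    ((h.corrected_le_zero hL hm hd hmd hd3 ⟨hx.1, hx1⟩ hQ.le).trans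
      (h.corrected_zero_le hL hm hy hLm hd hmd))
  obtain ⟨q, hqe⟩ : ∃ q, q = L * (1 - x ^ 2) - m ^ 2 := ⟨_, rfl⟩
  rw [← hqe] at h1 hQ hQd ⊢
  have hw : 0 < q + 22 * d := by linarith
  rw [div_le_iff₀ (by positivity)] at h1
  have h2 : (q * A x) ^ 2 ≤ (8 * √L * (2 * √(q + 22 * d))) ^ 2 := by
    gcongr
  have h3 : (8 * √L * (2 * √(q + 22 * d))) ^ 2 = 256 * L * (q + 22 * d) := by
    rw [mul_pow, mul_pow, mul_pow, Real.sq_sqrt hL.le, Real.sq_sqrt hw.le]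
    ring
  rw [h3] at h2
  have h4 : L * (q + 22 * d) ≤ L * (89 * q) := by gcongr; linarith
  have h5 : q * (q * A x ^ 2) ≤ q * (22784 * L) := by nlinarith
  exact le_of_mul_le_mul_left h5 hQ

/-- Critical points of the density stay away from the turning point. -/
lemma critical_point (h : LegendreSystem L m A B E) {d x : ℝ} (hm : 1 ≤ m)
    (hLm : m ^ 2 + m ≤ L) (hd : 0 < d) (hd3 : d ^ 3 * L = 2 * (L - m ^ 2) * m ^ 4)
    (hx : x ∈ Ico (0:ℝ) 1) (hB : B x = 0) (hA : 0 < A x) :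
    d / 4 ≤ L * (1 - x ^ 2) - m ^ 2 := by
  by_contra! hlt
  have hL : 0 < L := by nlinarith
  have hEx : E x = 0 := by
    have := h.sq_eq x
    rw [hB] at this
    have : A x * E x = 0 := by linarith
    exact (mul_eq_zero.1 this).resolve_left hA.ne'
  have hx0 := hx.1
  obtain ⟨s, hs, hsq⟩ : ∃ s : ℝ, 0 < s ∧ s ^ 2 = d / 4 :=
    ⟨√(d / 4), Real.sqrt_pos.2 (by positivity), Real.sq_sqrt (by positivity)⟩
  have hA' := h.contA
  have hB' := h.contB
  have hF' := h.continuous_energy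
  have key := le_of_hasDerivAt
    (f := fun y => x * m ^ 2 * A y + x * (m ^ 2 / s + 2 * s) * B y
      - s * (E y + (L * (1 - y ^ 2) - m ^ 2) * A y)) hx.2.le
    (Continuous.continuousOn (by fun_prop))
    (fun y hy => by
      have hy' : y ∈ Ioo (0:ℝ) 1 := ⟨hx.1.trans_lt hy.1, hy.2⟩
      exact (((h.derivA y hy').const_mul (x * m ^ 2)).add
        ((h.derivB y hy').const_mul (x * (m ^ 2 / s + 2 * s)))).sub
        ((h.hasDerivAt_energy hy').const_mul s))
    (fun y hy => by
      have hy' : y ∈ Ioo (0:ℝ) 1 := ⟨hx.1.trans_lt hy.1, hy.2⟩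
      have hp := one_sub_sq_pos hy'
      have hAy := h.A_nonneg y ⟨hy'.1.le, hy'.2.le⟩
      have hEy := h.E_nonneg y ⟨hy'.1.le, hy'.2.le⟩
      have hAE : 0 ≤ s ^ 2 * A y + 2 * s * B y + E y := by
        have hq := h.sq_eq y
        rcases hAy.eq_or_lt with h0 | h0
        · rw [← h0, zero_mul] at hq
          have : B y = 0 := by simpa using hq
          rw [this, ← h0]
          simpa using hEy
        · have : 0 ≤ A y * (s ^ 2 * A y + 2 * s * B y + E y) := by
            nlinarith [sq_nonneg (B y + s * A y)]
          exact nonneg_of_mul_nonneg_right this h0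
      have hQy : L * (1 - y ^ 2) - m ^ 2 ≤ s ^ 2 := by
        have : x ^ 2 ≤ y ^ 2 := pow_le_pow_left₀ hx0 hy.1.le 2
        nlinarith
      have e : x * m ^ 2 * (2 * B y / (1 - y ^ 2)) + x * (m ^ 2 / s + 2 * s)
            * ((E y - (L * (1 - y ^ 2) - m ^ 2) * A y) / (1 - y ^ 2)) - s * (-2 * L * y * A y)
          = (x * m ^ 2 / s * (s ^ 2 * A y + 2 * s * B y + E y) + 2 * s * x * E y
            + x * m ^ 2 / s * A y * (s ^ 2 - (L * (1 - y ^ 2) - m ^ 2))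
            + 2 * s * L * (1 - y ^ 2) * A y * (y - x)) / (1 - y ^ 2) := by
        field_simp
        ring
      rw [e]
      have h1 : 0 ≤ x * m ^ 2 / s * A y * (s ^ 2 - (L * (1 - y ^ 2) - m ^ 2)) :=
        mul_nonneg (by positivity) (by linarith)
      have h2 : 0 ≤ 2 * s * L * (1 - y ^ 2) * A y * (y - x) :=
        mul_nonneg (by positivity) (by linarith [hy.1])
      positivity)
  have hA1 : A 1 = 0 := h.A_one.resolve_left (by linarith)
  simp only [h.E_one, hA1, h.B_one, hB, hEx] at key
  have key2 : A x * (x * m ^ 2) ≤ A x * (s * (L * (1 - x ^ 2) - m ^ 2)) := by linarith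
  have key3 := le_of_mul_le_mul_left key2 hA
  have key4 : x * m ^ 2 ≤ s * s ^ 2 := by
    refine key3.trans ?_
    rw [hsq]
    gcongr
  have key5 : (x * m ^ 2) ^ 2 ≤ (s * s ^ 2) ^ 2 := by gcongr
  have key6 : x ^ 2 * m ^ 4 ≤ d ^ 3 / 64 := by
    have : (s * s ^ 2) ^ 2 = (s ^ 2) ^ 3 := by ring
    rw [this, hsq] at key5
    linarith
  have hd0 : 0 < d ^ 3 := by positivity
  by_cases hc : L - m ^ 2 ≤ 4 * x ^ 2 * L
  · have h1 : (L - m ^ 2) * m ^ 4 ≤ 4 * x ^ 2 * L * m ^ 4 := by gcongr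
    have h2 : L * d ^ 3 ≤ L * (d ^ 3 / 8) := by nlinarith
    have := le_of_mul_le_mul_left h2 hL
    linarith
  · push Not at hc
    have hy : 0 < L - m ^ 2 := by linarith
    have h1 : 3 * (L - m ^ 2) ≤ d := by linarith
    have h2 : (3 * (L - m ^ 2)) ^ 3 ≤ d ^ 3 := by gcongr
    have h3 : m ^ 4 ≤ L * (L - m ^ 2) ^ 2 := by
      have a1 : m ^ 2 ≤ (L - m ^ 2) ^ 2 := by
        have : m ≤ L - m ^ 2 := by linarith
        gcongr
      calc m ^ 4 = m ^ 2 * m ^ 2 := by ring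
        _ ≤ L * (L - m ^ 2) ^ 2 := by gcongr; linarith
    have h4 : L * d ^ 3 ≤ L * (2 * (L - m ^ 2) ^ 3) := by
      have := mul_le_mul_of_nonneg_left h3 hy.le
      linarith
    have := le_of_mul_le_mul_left h4 hL
    have : 0 < (L - m ^ 2) ^ 3 := by positivity
    linarith

lemma sup_bound (h : LegendreSystem L m A B E) {d : ℝ} (hm : 1 ≤ m)
    (hLm : m ^ 2 + m ≤ L) (hd : 1 ≤ d) (hmd : m ≤ d)
    (hd3 : d ^ 3 * L = 2 * (L - m ^ 2) * m ^ 4) {x : ℝ} (hx : x ∈ Icc (0:ℝ) 1) :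
    d * A x ^ 2 ≤ 91136 * L := by
  have hL : 0 < L := by nlinarith
  obtain ⟨z, hz, hmax⟩ := isCompact_Icc.exists_isMaxOn (nonempty_Icc.2 (zero_le_one' ℝ))
    h.contA.continuousOn
  have hAx := h.A_nonneg x hx
  have hxz : A x ≤ A z := hmax hx
  have hA1 : A 1 = 0 := h.A_one.resolve_left (by linarith)
  rcases (hAx.trans hxz).eq_or_lt with h0 | h0
  · have : A x = 0 := by linarith
    rw [this]
    simpa using hL.le
  have hz1 : z < 1 := lt_of_le_of_ne hz.2 (by rintro rfl; linarith)
  have hB : B z = 0 := by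
    rcases hz.1.eq_or_lt with h1 | h1
    · rw [← h1, h.B_zero]
    · have hloc : IsLocalMax A z := hmax.isLocalMax (Icc_mem_nhds h1 hz1)
      have := hloc.hasDerivAt_eq_zero (h.derivA z ⟨h1, hz1⟩)
      have hp := one_sub_sq_pos ⟨h1, hz1⟩
      field_simp at this
      simpa using this
  have hQ := h.critical_point hm hLm (by linarith) hd3 ⟨hz.1, hz1⟩ hB h0
  have hb := h.bulk_bound hL (by linarith) (by linarith) (by linarith) hd hmd hd3.ge hz hQ
  have h2 : d / 4 * A z ^ 2 ≤ (L * (1 - z ^ 2) - m ^ 2) * A z ^ 2 := by gcongr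
  have h3 : d * A x ^ 2 ≤ d * A z ^ 2 := by gcongr
  linarith

lemma sup_bound_zero (h : LegendreSystem L 0 A B E) (hL : 1 ≤ L) {x : ℝ}
    (hx : x ∈ Icc (0:ℝ) 1) : A x ^ 2 ≤ 364544 * L := by
  have hL0 : 0 < L := by linarith
  obtain ⟨z, hz, hmax⟩ := isCompact_Icc.exists_isMaxOn (nonempty_Icc.2 (zero_le_one' ℝ))
    h.contA.continuousOn
  have hAx := h.A_nonneg x hx
  have hxz : A x ≤ A z := hmax hx
  have h3 : A x ^ 2 ≤ A z ^ 2 := by gcongr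
  have bulk : ∀ y ∈ Icc (0:ℝ) 1, 1 / 4 ≤ L * (1 - y ^ 2) → A y ^ 2 ≤ 91136 * L := by
    intro y hy hQ
    have hb := h.bulk_bound (d := 1) hL0 le_rfl (by linarith) (by linarith) le_rfl zero_le_one
      (by simpa using hL0.le) hy (by linarith)
    nlinarith [sq_nonneg (A y)]
  by_cases hQ : 1 / 4 ≤ L * (1 - z ^ 2)
  · linarith [bulk z hz hQ]
  push Not at hQ
  have hAz : 0 ≤ A z := hAx.trans hxz
  have hw0 : 0 ≤ 1 - 1 / (4 * L) := by
    rw [sub_nonneg, div_le_one (by positivity)]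
    linarith
  have hw2 := Real.sq_sqrt hw0
  set w := √(1 - 1 / (4 * L)) with hw
  have hwL : L * (1 - w ^ 2) = 1 / 4 := by
    rw [hw2]
    field_simp
    ring
  have hwnn : 0 ≤ w := Real.sqrt_nonneg _
  have hwz : w ≤ z := by
    refine le_of_lt (lt_of_pow_lt_pow_left₀ 2 hz.1 ?_)
    nlinarith
  have hbw := bulk w ⟨hwnn, hwz.trans hz.2⟩ hwL.ge
  have hBle : ∀ y ∈ Ioo (0:ℝ) 1, B y ≤ L * A z * (1 - y) := by
    intro y hy
    have := le_of_hasDerivAt (f := fun t => B t + L * A z * t) hy.2.le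
      (h.contB.add (by fun_prop)).continuousOn
      (fun t ht => (h.derivB t ⟨hy.1.trans ht.1, ht.2⟩).add
        ((hasDerivAt_id t).const_mul (L * A z)))
      (fun t ht => by
        have ht' : t ∈ Ioo (0:ℝ) 1 := ⟨hy.1.trans ht.1, ht.2⟩
        have hp := one_sub_sq_pos ht'
        have hEt := h.E_nonneg t ⟨ht'.1.le, ht'.2.le⟩
        have hAt : A t ≤ A z := hmax ⟨ht'.1.le, ht'.2.le⟩
        have e : (E t - (L * (1 - t ^ 2) - 0 ^ 2) * A t) / (1 - t ^ 2) + L * A z * 1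
            = E t / (1 - t ^ 2) + L * (A z - A t) := by
          field_simp
          ring
        rw [e]
        have : 0 ≤ A z - A t := by linarith
        positivity)
    simp only [h.B_one] at this
    linarith
  have hdiff := le_of_hasDerivAt (f := fun t => 2 * L * A z * t - A t) hwz
    (Continuous.sub (by fun_prop) h.contA).continuousOn
    (fun t ht => ((hasDerivAt_id t).const_mul (2 * L * A z)).sub
      (h.derivA t ⟨hwnn.trans_lt ht.1, ht.2.trans_le hz.2⟩))
    (fun t ht => by
      have ht' : t ∈ Ioo (0:ℝ) 1 := ⟨hwnn.trans_lt ht.1, ht.2.trans_le hz.2⟩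
      have hp := one_sub_sq_pos ht'
      rw [sub_nonneg, div_le_iff₀ hp]
      have := hBle t ht'
      have h4 : 0 ≤ L * A z * (1 - t) * t :=
        mul_nonneg (mul_nonneg (by positivity) (by linarith [ht'.2])) ht'.1.le
      linarith)
  have hzw : z - w ≤ 1 - w ^ 2 := by nlinarith [hz.1, hz.2]
  have h5 : A z ≤ 2 * A w := by
    have : L * A z * (z - w) ≤ A z * (1 / 4) := by
      rw [← hwL]
      have := mul_le_mul_of_nonneg_left hzw (mul_nonneg hL0.le hAz)
      linarith
    linarith
  have h6 : A z ^ 2 ≤ (2 * A w) ^ 2 := by gcongr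
  linarith

lemma forbidden_bound (h : LegendreSystem L m A B E) {d : ℝ} (hm : 1 ≤ m)
    (hLm : m ^ 2 + m ≤ L) (hd : 1 ≤ d) (hmd : m ≤ d)
    (hd3 : d ^ 3 * L = 2 * (L - m ^ 2) * m ^ 4) {x : ℝ} (hx : x ∈ Icc (0:ℝ) 1)
    (hQ : L * (1 - x ^ 2) - m ^ 2 ≤ -d) :
    (m ^ 2 - L * (1 - x ^ 2)) * A x ^ 2 ≤ 91136 * L := by
  have hL : 0 < L := by nlinarith
  have hcont : ContinuousOn (fun y : ℝ => L * (1 - y ^ 2) - m ^ 2) (Icc 0 x) :=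
    Continuous.continuousOn (by fun_prop)
  obtain ⟨w, hw, hwd⟩ := intermediate_value_Icc' hx.1 hcont
    (show -d ∈ Icc _ _ from ⟨hQ, by norm_num; linarith⟩)
  simp only at hwd
  have hw1 : w ≤ 1 := hw.2.trans hx.2
  have hP : ∀ y ∈ Icc w 1, d ≤ m ^ 2 - L * (1 - y ^ 2) := by
    intro y hy
    have : w ^ 2 ≤ y ^ 2 := pow_le_pow_left₀ hw.1 hy.1 2
    nlinarith
  have hB : ∀ y ∈ Icc w 1, B y ≤ 0 := by
    intro y hy
    have := le_of_hasDerivAt (f := B) hy.2 h.contB.continuousOn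
      (fun t ht => h.derivB t ⟨(hw.1.trans hy.1).trans_lt ht.1, ht.2⟩)
      (fun t ht => by
        have ht' : t ∈ Ioo (0:ℝ) 1 := ⟨(hw.1.trans hy.1).trans_lt ht.1, ht.2⟩
        have hp := one_sub_sq_pos ht'
        have hEt := h.E_nonneg t ⟨ht'.1.le, ht'.2.le⟩
        have hAt := h.A_nonneg t ⟨ht'.1.le, ht'.2.le⟩
        have := hP t ⟨hy.1.trans ht.1.le, ht.2.le⟩
        have : 0 ≤ (m ^ 2 - L * (1 - t ^ 2)) * A t := mul_nonneg (by linarith) hAt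
        exact div_nonneg (by linarith) hp.le)
    rwa [h.B_one] at this
  have hA' := h.contA
  have key := le_of_hasDerivAt (f := fun y => (L * (1 - y ^ 2) - m ^ 2) * A y ^ 2) hw.2
    (Continuous.continuousOn (by fun_prop))
    (fun y hy => ((hasDerivAt_one_sub_sq L y).sub_const (m ^ 2)).mul
      ((h.derivA y ⟨hw.1.trans_lt hy.1, hy.2.trans_le hx.2⟩).pow 2))
    (fun y hy => by
      have hy' : y ∈ Ioo (0:ℝ) 1 := ⟨hw.1.trans_lt hy.1, hy.2.trans_le hx.2⟩
      have hp := one_sub_sq_pos hy'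
      have hAy := h.A_nonneg y ⟨hy'.1.le, hy'.2.le⟩
      have hPy := hP y ⟨hy.1.le, hy'.2.le⟩
      have hBy := hB y ⟨hy.1.le, hy'.2.le⟩
      have hF := h.energy_nonneg hL.le ⟨hy'.1.le, hy'.2.le⟩
      have hsq := h.sq_eq y
      have hy0 := hy'.1
      obtain ⟨P, hPe⟩ : ∃ P, P = m ^ 2 - L * (1 - y ^ 2) := ⟨_, rfl⟩
      have hR : L * (1 - y ^ 2) = m ^ 2 - P := by rw [hPe]; ring
      rw [← hPe] at hPy
      have hP0 : 0 < P := by linarith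
      have hR0 : 0 ≤ m ^ 2 - P := by rw [← hR]; positivity
      have hdP : d ^ 3 ≤ P ^ 3 := by gcongr
      have hturn : y ^ 2 * m ^ 4 ≤ 4 * P ^ 3 := by
        by_cases hc : y ^ 2 * L ≤ 4 * (L - m ^ 2)
        · have h1 := mul_le_mul_of_nonneg_right hc (by positivity : 0 ≤ m ^ 4)
          have h2 : L * (y ^ 2 * m ^ 4) ≤ L * (2 * d ^ 3) := by linarith
          have := le_of_mul_le_mul_left h2 hL
          have : 0 < d ^ 3 := by positivity
          linarith
        · push Not at hc
          have h1 : 3 / 4 * (m ^ 2 * y ^ 2) ≤ P := by nlinarith [sq_nonneg y]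
          have h2 : m ^ 2 ≤ P ^ 2 := by
            have : m ≤ P := by linarith
            gcongr
          have h3 : m ^ 2 * y ^ 2 * m ^ 2 ≤ 4 / 3 * P * P ^ 2 := by
            have h4 : m ^ 2 * y ^ 2 ≤ 4 / 3 * P := by linarith
            exact mul_le_mul h4 h2 (sq_nonneg m) (by positivity)
          have : 0 < P ^ 3 := by positivity
          linarith
      have hmain : y * (m ^ 2 - P) * A y ≤ -(2 * P * B y) := by
        refine le_of_sq_le_sq ?_ (by nlinarith)
        have hEP : P * A y ≤ E y := by rw [hPe]; linarith
        have a1 : (m ^ 2 - P) ^ 2 ≤ (m ^ 2) ^ 2 := by gcongr; linarith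
        calc (y * (m ^ 2 - P) * A y) ^ 2 = (m ^ 2 - P) ^ 2 * (y ^ 2 * A y ^ 2) := by ring
          _ ≤ (m ^ 2) ^ 2 * (y ^ 2 * A y ^ 2) := by gcongr
          _ = (y ^ 2 * m ^ 4) * A y ^ 2 := by ring
          _ ≤ (4 * P ^ 3) * A y ^ 2 := by gcongr
          _ = 4 * P ^ 2 * (A y * (P * A y)) := by ring
          _ ≤ 4 * P ^ 2 * (A y * E y) := by gcongr
          _ = (-(2 * P * B y)) ^ 2 := by rw [← hsq]; ring
      have e : -2 * L * y * A y ^ 2 + (L * (1 - y ^ 2) - m ^ 2)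
            * ((2 : ℕ) * A y ^ (2 - 1) * (2 * B y / (1 - y ^ 2)))
          = 2 * A y * (-(2 * P * B y) - y * (m ^ 2 - P) * A y) / (1 - y ^ 2) := by
        rw [← hR, hPe]
        norm_num
        field_simp
        ring
      simp only [Pi.pow_apply]
      rw [e]
      exact div_nonneg (mul_nonneg (by positivity) (by linarith)) hp.le)
  have hwI : w ∈ Icc (0:ℝ) 1 := ⟨hw.1, hw1⟩
  have hs := h.sup_bound hm hLm hd hmd hd3 hwI
  simp only [hwd] at key
  linarith

/-- The uniform bound on the density of a regular solution. -/
lemma density_bound (h : LegendreSystem L m A B E) {d : ℝ} (hm : 1 ≤ m)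
    (hLm : m ^ 2 + m ≤ L) (hd : 1 ≤ d) (hmd : m ≤ d)
    (hd3 : d ^ 3 * L = 2 * (L - m ^ 2) * m ^ 4) {x : ℝ} (hx : x ∈ Icc (0:ℝ) 1) :
    (d + |L * (1 - x ^ 2) - m ^ 2|) * A x ^ 2 ≤ 182272 * L := by
  have hL : 0 < L := by nlinarith
  have hs := h.sup_bound hm hLm hd hmd hd3 hx
  have h2 : |L * (1 - x ^ 2) - m ^ 2| * A x ^ 2 ≤ 91136 * L := by
    rcases le_total |L * (1 - x ^ 2) - m ^ 2| d with h1 | h1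
    · exact (mul_le_mul_of_nonneg_right h1 (sq_nonneg _)).trans hs
    · rcases le_abs'.1 h1 with h3 | h3
      · rw [abs_of_nonpos (by linarith)]
        have := h.forbidden_bound hm hLm hd hmd hd3 hx h3
        linarith
      · rw [abs_of_nonneg (by linarith)]
        have := h.bulk_bound hL (by linarith) (by linarith) (by linarith) hd hmd hd3.ge hx
          (by linarith)
        linarith
  linarith

lemma density_bound_zero (h : LegendreSystem L 0 A B E) (hL : 1 ≤ L) {x : ℝ}
    (hx : x ∈ Icc (0:ℝ) 1) : (1 + L * (1 - x ^ 2)) * A x ^ 2 ≤ 729088 * L := by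
  have hL0 : 0 < L := by linarith
  have hs := h.sup_bound_zero hL hx
  have h2 : L * (1 - x ^ 2) * A x ^ 2 ≤ 364544 * L := by
    rcases le_total (L * (1 - x ^ 2)) 1 with h1 | h1
    · exact (mul_le_mul_of_nonneg_right h1 (sq_nonneg _)).trans (by linarith)
    · have := h.bulk_bound (d := 1) hL0 le_rfl (by linarith) (by linarith) le_rfl zero_le_one
        (by simpa using hL0.le) hx (by linarith)
      linarith
  linarith

lemma density_bound_all (h : LegendreSystem L m A B E) (hm : m = 0 ∨ 1 ≤ m) (hL : 1 ≤ L)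
    (hLm : m ^ 2 + m ≤ L) {x : ℝ} (hx : x ∈ Icc (0:ℝ) 1) :
    (1 + m + |L * (1 - x ^ 2) - m ^ 2|) * A x ^ 2 ≤ 729088 * L := by
  rcases hm with rfl | hm
  · have := h.density_bound_zero hL hx
    have hp : 0 ≤ 1 - x ^ 2 := by nlinarith [hx.1, hx.2]
    rw [abs_of_nonneg (by nlinarith)]
    linarith
  · have hL0 : 0 < L := by linarith
    have hy : 0 < L - m ^ 2 := by linarith
    obtain ⟨d, hd0, hd⟩ : ∃ d : ℝ, 0 ≤ d ∧ d ^ 3 = 2 * (L - m ^ 2) * m ^ 4 / L := by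
      refine ⟨(2 * (L - m ^ 2) * m ^ 4 / L) ^ ((1:ℝ) / 3), by positivity, ?_⟩
      rw [← Real.rpow_natCast, ← Real.rpow_mul (by positivity)]
      norm_num
    have hd3 : d ^ 3 * L = 2 * (L - m ^ 2) * m ^ 4 := by
      rw [hd]
      field_simp
    have hmd : m ≤ d := by
      refine le_of_pow_le_pow_left₀ three_ne_zero hd0 ?_
      rw [hd, le_div_iff₀ hL0]
      have h1 : L ≤ 2 * (L - m ^ 2) * m := by nlinarith
      calc m ^ 3 * L ≤ m ^ 3 * (2 * (L - m ^ 2) * m) := by gcongr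
        _ = _ := by ring
    have hb := h.density_bound hm hLm (hm.trans hmd) hmd hd3 hx
    have h2 : (1 + m + |L * (1 - x ^ 2) - m ^ 2|) * A x ^ 2
        ≤ 2 * ((d + |L * (1 - x ^ 2) - m ^ 2|) * A x ^ 2) := by
      rw [← mul_assoc]
      gcongr
      have := abs_nonneg (L * (1 - x ^ 2) - m ^ 2)
      linarith
    linarith

end LegendreSystem

section Polynomials

open Polynomial

/-- The `k`-th derivative of `(X² - 1)^n`. -/
def rodrigues (n k : ℕ) : ℝ[X] := derivative^[k] ((X ^ 2 - 1) ^ n)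

lemma derivative_rodrigues (n k : ℕ) : derivative (rodrigues n k) = rodrigues n (k + 1) := by
  rw [rodrigues, rodrigues, Function.iterate_succ_apply']

lemma iteratedDeriv_eval (p : ℝ[X]) (k : ℕ) :
    iteratedDeriv k (fun x => p.eval x) = fun x => (derivative^[k] p).eval x := by
  induction k with
  | zero => simp
  | succ k ih =>
    rw [iteratedDeriv_succ, ih, Function.iterate_succ_apply']
    ext x
    simp

lemma rodrigues_base (n : ℕ) :
    (X ^ 2 - 1) * rodrigues n 1 = 2 * (n : ℝ[X]) * X * rodrigues n 0 := by
  cases n with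
  | zero => simp [rodrigues]
  | succ n =>
    simp only [rodrigues, Function.iterate_one, Function.iterate_zero, id, derivative_pow,
      Nat.add_sub_cancel]
    simp
    ring

/-- The differential equation of the derivatives of `(X² - 1)^n`. -/
lemma rodrigues_ode (n k : ℕ) :
    (X ^ 2 - 1) * rodrigues n (k + 2) + (2 * (k : ℝ[X]) + 2 - 2 * (n : ℝ[X])) * X
      * rodrigues n (k + 1)
      + ((k : ℝ[X]) + 1) * ((k : ℝ[X]) - 2 * (n : ℝ[X])) * rodrigues n k = 0 := by
  induction k with
  | zero =>
    have h := congrArg derivative (rodrigues_base n)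
    simp only [derivative_mul, derivative_rodrigues] at h
    simp at h
    simp
    linear_combination h
  | succ k ih =>
    have h := congrArg derivative ih
    simp only [derivative_mul, derivative_add, derivative_sub, derivative_rodrigues] at h
    simp at h
    push_cast
    linear_combination h

lemma rodrigues_eval_neg (n k : ℕ) (x : ℝ) :
    (rodrigues n k).eval (-x) = (-1) ^ k * (rodrigues n k).eval x := by
  have h : (rodrigues n k).comp (-X) = (-1) ^ k * rodrigues n k := by
    induction k with
    | zero => simp [rodrigues]
    | succ k ih =>
      have h := congrArg derivative ih
      rw [derivative_comp, derivative_rodrigues] at h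
      have e : derivative ((-1 : ℝ[X]) ^ k * rodrigues n k) = (-1) ^ k * rodrigues n (k + 1) := by
        rw [derivative_mul, derivative_rodrigues]
        have : derivative ((-1 : ℝ[X]) ^ k) = 0 := by
          rcases neg_one_pow_eq_or ℝ[X] k with h | h <;> simp [h]
        rw [this]
        ring
      rw [e] at h
      simp at h
      rw [pow_succ]
      linear_combination -h
  have := congrArg (eval x) h
  simpa [eval_comp] using this

lemma natDegree_X_sq_sub_one_pow (n : ℕ) : ((X ^ 2 - 1 : ℝ[X]) ^ n).natDegree = 2 * n := by
  rw [natDegree_pow, ← C_1, natDegree_X_pow_sub_C, mul_comm]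

lemma rodrigues_top (n : ℕ) : rodrigues n (n + n) = C (((2 * n).factorial : ℝ)) := by
  have hmon : ((X ^ 2 - 1 : ℝ[X]) ^ n).Monic := by
    rw [← C_1]
    exact (monic_X_pow_sub_C 1 two_ne_zero).pow n
  have hdeg : (rodrigues n (n + n)).natDegree = 0 := by
    have := natDegree_iterate_derivative ((X ^ 2 - 1 : ℝ[X]) ^ n) (n + n)
    rw [natDegree_X_sq_sub_one_pow] at this
    rw [rodrigues]
    omega
  rw [eq_C_of_natDegree_eq_zero hdeg, rodrigues, coeff_iterate_derivative]
  have : ((X ^ 2 - 1 : ℝ[X]) ^ n).coeff (0 + (n + n)) = 1 := by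
    have := hmon.coeff_natDegree
    rw [natDegree_X_sq_sub_one_pow] at this
    rw [← this]
    congr 1
    ring
  rw [this, zero_add, Nat.descFactorial_self, ← two_mul]
  simp

/-- The weighted square integrals of the derivatives of `(X² - 1)^n`. -/
def rodriguesMass (n k : ℕ) : ℝ :=
  ∫ x in (-1:ℝ)..1, (1 - x ^ 2) ^ k * (rodrigues n (n + k)).eval x ^ 2

lemma hasDerivAt_one_sub_sq_pow (k : ℕ) (x : ℝ) :
    HasDerivAt (fun y : ℝ => (1 - y ^ 2) ^ (k + 1)) (-2 * (k + 1) * x * (1 - x ^ 2) ^ k) x := by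
  refine (((hasDerivAt_pow 2 x).const_sub 1).pow (k + 1)).congr_deriv ?_
  push_cast
  simp
  ring

lemma rodrigues_hasDerivAt (n k : ℕ) (x : ℝ) :
    HasDerivAt (fun y => (rodrigues n k).eval y) ((rodrigues n (k + 1)).eval x) x := by
  rw [← derivative_rodrigues]
  exact (rodrigues n k).hasDerivAt x

lemma rodrigues_ode_eval (n k : ℕ) (x : ℝ) :
    (1 - x ^ 2) * (rodrigues n (n + k + 2)).eval x
      = 2 * (k + 1) * x * (rodrigues n (n + k + 1)).eval x
        - ((n:ℝ) * (n + 1) - k ^ 2 - k) * (rodrigues n (n + k)).eval x := by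
  have h := congrArg (eval x) (rodrigues_ode n (n + k))
  simp at h
  linear_combination -h

lemma rodriguesMass_succ (n k : ℕ) :
    rodriguesMass n (k + 1) = ((n:ℝ) - k) * (n + k + 1) * rodriguesMass n k := by
  have hd : ∀ x : ℝ, HasDerivAt
      (fun y => (1 - y ^ 2) ^ (k + 1) * (rodrigues n (n + k + 1)).eval y
        * (rodrigues n (n + k)).eval y)
      ((1 - x ^ 2) ^ (k + 1) * (rodrigues n (n + (k + 1))).eval x ^ 2
        - ((n:ℝ) - k) * (n + k + 1) * ((1 - x ^ 2) ^ k * (rodrigues n (n + k)).eval x ^ 2)) x := by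
    intro x
    refine (((hasDerivAt_one_sub_sq_pow k x).mul (rodrigues_hasDerivAt n (n + k + 1) x)).mul
      (rodrigues_hasDerivAt n (n + k) x)).congr_deriv ?_
    have h := rodrigues_ode_eval n k x
    simp only [Pi.mul_apply]
    rw [← add_assoc]
    linear_combination (1 - x ^ 2) ^ k * (rodrigues n (n + k)).eval x * h
  have hc : ∀ j, Continuous fun x => (rodrigues n j).eval x := fun j => (rodrigues n j).continuous
  have := hc (n + k)
  have := hc (n + (k + 1))
  have h := intervalIntegral.integral_eq_sub_of_hasDerivAt (a := -1) (b := 1)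
    (fun x _ => hd x) (Continuous.intervalIntegrable (by fun_prop) _ _)
  rw [intervalIntegral.integral_sub (Continuous.intervalIntegrable (by fun_prop) _ _)
    (Continuous.intervalIntegrable (by fun_prop) _ _), intervalIntegral.integral_const_mul] at h
  norm_num at h
  unfold rodriguesMass
  linarith

lemma integral_one_sub_sq_pow (n : ℕ) :
    (∫ x in (-1:ℝ)..1, (1 - x ^ 2) ^ n) * (2 * n + 1).factorial
      = 2 ^ (2 * n + 1) * (n.factorial : ℝ) ^ 2 := by
  induction n with
  | zero => norm_num
  | succ n ih =>
    have hd : ∀ x : ℝ, HasDerivAt (fun y => y * (1 - y ^ 2) ^ (n + 1))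
        ((2 * n + 3) * (1 - x ^ 2) ^ (n + 1) - 2 * (n + 1) * (1 - x ^ 2) ^ n) x := by
      intro x
      refine ((hasDerivAt_id x).mul (hasDerivAt_one_sub_sq_pow n x)).congr_deriv ?_
      simp only [id]
      ring
    have h := intervalIntegral.integral_eq_sub_of_hasDerivAt (a := -1) (b := 1)
      (fun x _ => hd x) (Continuous.intervalIntegrable (by fun_prop) _ _)
    rw [intervalIntegral.integral_sub (Continuous.intervalIntegrable (by fun_prop) _ _)
      (Continuous.intervalIntegrable (by fun_prop) _ _), intervalIntegral.integral_const_mul,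
      intervalIntegral.integral_const_mul] at h
    norm_num at h
    have e : 2 * (n + 1) + 1 = (2 * n + 1) + 1 + 1 := by ring
    rw [e, Nat.factorial_succ, Nat.factorial_succ, Nat.factorial_succ n]
    push_cast
    have h' : (2 * (n:ℝ) + 3) * (∫ x in (-1:ℝ)..1, (1 - x ^ 2) ^ (n + 1))
      = 2 * (n + 1) * ∫ x in (-1:ℝ)..1, (1 - x ^ 2) ^ n := by linarith
    linear_combination (2 * (n:ℝ) + 2) * (2 * n + 1).factorial * h'
      + 4 * ((n:ℝ) + 1) ^ 2 * ih

lemma rodriguesMass_eq (n k : ℕ) (hk : k ≤ n) :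
    rodriguesMass n k * (n - k).factorial = rodriguesMass n 0 * (n + k).factorial := by
  induction k with
  | zero => simp
  | succ k ih =>
    have h := ih (by omega)
    obtain ⟨j, rfl⟩ : ∃ j, n = k + 1 + j := ⟨n - (k + 1), by omega⟩
    have e1 : k + 1 + j - (k + 1) = j := by omega
    have e2 : k + 1 + j - k = j + 1 := by omega
    have e3 : k + 1 + j + (k + 1) = (k + 1 + j + k) + 1 := by omega
    rw [e2, Nat.factorial_succ] at h
    rw [rodriguesMass_succ, e1, e3, Nat.factorial_succ]
    push_cast at h ⊢
    linear_combination ((k:ℝ) + 1 + j + k + 1) * h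

lemma rodriguesMass_norm (n k : ℕ) (hk : k ≤ n) :
    (2 * n + 1) * ((n - k).factorial / (n + k).factorial : ℝ) * rodriguesMass n k
      = 2 * (2 ^ n * n.factorial : ℝ) ^ 2 := by
  have h1 := rodriguesMass_eq n k hk
  have h2 := rodriguesMass_eq n n le_rfl
  have h3 : rodriguesMass n n = (∫ x in (-1:ℝ)..1, (1 - x ^ 2) ^ n) * (2 * n).factorial ^ 2 := by
    rw [rodriguesMass, rodrigues_top, ← intervalIntegral.integral_mul_const]
    simp
  have h4 := integral_one_sub_sq_pow n
  rw [Nat.factorial_succ] at h4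
  rw [h3, ← two_mul] at h2
  simp only [Nat.sub_self, Nat.factorial_zero] at h2
  have hf : ((2 * n).factorial : ℝ) ≠ 0 := by positivity
  have h5 : rodriguesMass n 0 * (2 * n + 1) = 2 * (2 ^ n * n.factorial : ℝ) ^ 2 := by
    apply mul_right_cancel₀ hf
    push_cast at h4 h2
    rw [pow_succ, pow_mul'] at h4
    linear_combination -(2 * (n:ℝ) + 1) * h2 + (2 * n).factorial * h4
  field_simp
  linear_combination (2 * (n:ℝ) + 1) * h1 + (n + k).factorial * h5

end Polynomials

section Harmonics

lemma continuous_rodrigues (n k : ℕ) : Continuous fun x => (rodrigues n k).eval x :=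
  (rodrigues n k).continuous

/-- `(1 - x²) T' - k x T`, where `T` is the `(n + k)`-th derivative of `(x² - 1)^n`. -/
def rodriguesFlux (n k : ℕ) (x : ℝ) : ℝ :=
  (1 - x ^ 2) * (rodrigues n (n + k + 1)).eval x - k * x * (rodrigues n (n + k)).eval x

lemma continuous_rodriguesFlux (n k : ℕ) : Continuous (rodriguesFlux n k) := by
  have := continuous_rodrigues n (n + k)
  have := continuous_rodrigues n (n + k + 1)
  unfold rodriguesFlux
  fun_prop

lemma rodrigues_hasDerivAt_flux (n k : ℕ) {x : ℝ} (hx : 1 - x ^ 2 ≠ 0) :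
    HasDerivAt (fun y => (rodrigues n (n + k)).eval y)
      ((rodriguesFlux n k x + k * x * (rodrigues n (n + k)).eval x) / (1 - x ^ 2)) x := by
  refine (rodrigues_hasDerivAt n (n + k) x).congr_deriv ?_
  rw [eq_div_iff hx, rodriguesFlux]
  ring

lemma rodriguesFlux_hasDerivAt (n k : ℕ) {x : ℝ} (hx : 1 - x ^ 2 ≠ 0) :
    HasDerivAt (rodriguesFlux n k)
      ((k * x * rodriguesFlux n k x
        - ((n:ℝ) * (n + 1) * (1 - x ^ 2) - k ^ 2) * (rodrigues n (n + k)).eval x)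
        / (1 - x ^ 2)) x := by
  have h1 : HasDerivAt (fun y : ℝ => 1 - y ^ 2) (-(2 * x)) x := by
    simpa using (hasDerivAt_pow 2 x).const_sub 1
  have h2 : HasDerivAt (fun y : ℝ => (k:ℝ) * y) k x := by
    simpa using (hasDerivAt_id x).const_mul (k:ℝ)
  refine ((h1.mul (rodrigues_hasDerivAt n (n + k + 1) x)).sub
    (h2.mul (rodrigues_hasDerivAt n (n + k) x))).congr_deriv ?_
  rw [eq_div_iff hx, rodriguesFlux]
  linear_combination (1 - x ^ 2) * rodrigues_ode_eval n k x

lemma hasDerivAt_one_sub_sq_pow_div (k : ℕ) {x : ℝ} (hx : 1 - x ^ 2 ≠ 0) :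
    HasDerivAt (fun y : ℝ => (1 - y ^ 2) ^ k) (-2 * k * x * (1 - x ^ 2) ^ k / (1 - x ^ 2)) x := by
  cases k with
  | zero => simpa using hasDerivAt_const x (1:ℝ)
  | succ k =>
    refine (hasDerivAt_one_sub_sq_pow k x).congr_deriv ?_
    rw [eq_div_iff hx]
    push_cast
    ring

/-- The normalising factor of the squared spherical harmonics. -/
def harmonicFactor (n k : ℕ) : ℝ :=
  (2 * n + 1) / (4 * Real.pi) * ((n - k).factorial / (n + k).factorial : ℝ)
    / (2 ^ n * n.factorial : ℝ) ^ 2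

lemma harmonicFactor_nonneg (n k : ℕ) : 0 ≤ harmonicFactor n k := by
  unfold harmonicFactor
  positivity

/-- The squared spherical harmonic `Ỹ_{n,k}²`. -/
def harmonicDensity (n k : ℕ) (x : ℝ) : ℝ :=
  harmonicFactor n k * (1 - x ^ 2) ^ k * (rodrigues n (n + k)).eval x ^ 2

lemma harmonicDensity_neg (n k : ℕ) (x : ℝ) : harmonicDensity n k (-x) = harmonicDensity n k x := by
  rw [harmonicDensity, harmonicDensity, rodrigues_eval_neg, mul_pow, ← pow_mul, pow_mul',
    neg_one_sq, one_pow, neg_sq, one_mul]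

lemma continuous_harmonicDensity (n k : ℕ) : Continuous (harmonicDensity n k) := by
  have := continuous_rodrigues n (n + k)
  unfold harmonicDensity
  fun_prop

lemma harmonicDensity_nonneg (n k : ℕ) {x : ℝ} (hx : x ∈ Icc (-1:ℝ) 1) :
    0 ≤ harmonicDensity n k x := by
  have h : 0 ≤ 1 - x ^ 2 := by nlinarith [hx.1, hx.2]
  have := harmonicFactor_nonneg n k
  unfold harmonicDensity
  positivity

lemma integral_harmonicDensity (n k : ℕ) (hk : k ≤ n) :
    ∫ x in (-1:ℝ)..1, harmonicDensity n k x = 1 / (2 * Real.pi) := by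
  have h := rodriguesMass_norm n k hk
  have e : ∫ x in (-1:ℝ)..1, harmonicDensity n k x = harmonicFactor n k * rodriguesMass n k := by
    rw [rodriguesMass, ← intervalIntegral.integral_const_mul]
    simp only [harmonicDensity, mul_assoc]
  have hpos : (2 ^ n * n.factorial : ℝ) ≠ 0 := by positivity
  have hpi := Real.pi_ne_zero
  rw [e, harmonicFactor]
  calc _ = (2 * n + 1) * ((n - k).factorial / (n + k).factorial : ℝ) * rodriguesMass n k
        / (4 * Real.pi * (2 ^ n * n.factorial : ℝ) ^ 2) := by
        simp only [div_eq_mul_inv, mul_inv]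
        ring
    _ = _ := by
        rw [h]
        field_simp
        norm_num

lemma integral_harmonicDensity_le (n k : ℕ) (hk : k ≤ n) :
    ∫ x in (0:ℝ)..1, harmonicDensity n k x ≤ 1 := by
  have hi : ∀ a b, IntervalIntegrable (harmonicDensity n k) volume a b := fun a b =>
    (continuous_harmonicDensity n k).intervalIntegrable a b
  have h1 := intervalIntegral.integral_add_adjacent_intervals (hi (-1) 0) (hi 0 1)
  have h2 : 0 ≤ ∫ x in (-1:ℝ)..0, harmonicDensity n k x :=
    intervalIntegral.integral_nonneg (by norm_num) fun x hx =>
      harmonicDensity_nonneg n k ⟨hx.1, hx.2.trans zero_le_one⟩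
  rw [integral_harmonicDensity n k hk] at h1
  have h3 : 1 / (2 * Real.pi) ≤ 1 := by
    rw [div_le_one (by positivity)]
    linarith [Real.pi_gt_three]
  linarith

lemma rodrigues_parity (n j : ℕ) :
    (rodrigues n (j + 1)).eval 0 * (rodrigues n j).eval 0 = 0 := by
  have h1 := rodrigues_eval_neg n j 0
  have h2 := rodrigues_eval_neg n (j + 1) 0
  rw [neg_zero] at h1 h2
  rcases neg_one_pow_eq_or ℝ j with h | h
  · rw [pow_succ, h] at h2
    have : (rodrigues n (j + 1)).eval 0 = 0 := by linarith
    rw [this, zero_mul]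
  · rw [h] at h1
    have : (rodrigues n j).eval 0 = 0 := by linarith
    rw [this, mul_zero]

lemma legendreSystem_harmonicDensity (n k : ℕ) (hk : k ≤ n) :
    LegendreSystem ((n:ℝ) * (n + 1)) k (harmonicDensity n k)
      (fun x => harmonicFactor n k * (1 - x ^ 2) ^ k *
        ((rodrigues n (n + k)).eval x * rodriguesFlux n k x))
      (fun x => harmonicFactor n k * (1 - x ^ 2) ^ k * rodriguesFlux n k x ^ 2) := by
  have hT := continuous_rodrigues n (n + k)
  have hS := continuous_rodriguesFlux n k
  have hp : ∀ x ∈ Ioo (0:ℝ) 1, 1 - x ^ 2 ≠ 0 := fun x hx =>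
    (LegendreSystem.one_sub_sq_pos hx).ne'
  have hw : ∀ x ∈ Ioo (0:ℝ) 1, HasDerivAt (fun y => harmonicFactor n k * (1 - y ^ 2) ^ k)
      (harmonicFactor n k * (-2 * k * x * (1 - x ^ 2) ^ k / (1 - x ^ 2))) x := fun x hx =>
    (hasDerivAt_one_sub_sq_pow_div k (hp x hx)).const_mul _
  have h1 : rodriguesFlux n k 1 = -(k * (rodrigues n (n + k)).eval 1) := by
    simp [rodriguesFlux]
  have hk0 : (k:ℝ) = 0 ∨ (1 - (1:ℝ) ^ 2) ^ k = 0 := by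
    rcases Nat.eq_zero_or_pos k with rfl | h
    · simp
    · right
      norm_num
      omega
  refine ⟨continuous_harmonicDensity n k, by fun_prop, by fun_prop, ?_, ?_, ?_, ?_, ?_, ?_, ?_,
    ?_, ?_, ?_, integral_harmonicDensity_le n k hk⟩
  · intro x hx
    have h0 := hp x hx
    refine ((hw x hx).mul ((rodrigues_hasDerivAt_flux n k h0).pow 2)).congr_deriv ?_
    simp only [Pi.pow_apply]
    field_simp
    push_cast
    ring
  · intro x hx
    have h0 := hp x hx
    refine ((hw x hx).mul ((rodrigues_hasDerivAt_flux n k h0).mul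
      (rodriguesFlux_hasDerivAt n k h0))).congr_deriv ?_
    simp only [Pi.mul_apply, harmonicDensity]
    field_simp
    ring
  · intro x hx
    have h0 := hp x hx
    refine ((hw x hx).mul ((rodriguesFlux_hasDerivAt n k h0).pow 2)).congr_deriv ?_
    simp only [Pi.pow_apply]
    field_simp
    push_cast
    ring
  · exact fun x hx => harmonicDensity_nonneg n k ⟨by linarith [hx.1], hx.2⟩
  · intro x hx
    have h : 0 ≤ 1 - x ^ 2 := by nlinarith [hx.1, hx.2]
    have := harmonicFactor_nonneg n k
    positivity
  · intro x
    simp only [harmonicDensity]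
    ring
  · have := rodrigues_parity n (n + k)
    simp only [rodriguesFlux]
    linear_combination harmonicFactor n k * this
  · simp only [h1]
    rcases hk0 with h | h <;> simp only [h] <;> ring
  · simp only [h1]
    rcases hk0 with h | h <;> simp only [h] <;> ring
  · refine hk0.imp_right fun h => ?_
    simp only [harmonicDensity, h]
    ring

lemma legendreP_eq (n : ℕ) :
    legendreP n = fun x => (Polynomial.C ((2 ^ n * n.factorial : ℝ)⁻¹) * rodrigues n n).eval x := by
  ext x
  have h := congrFun (iteratedDeriv_eval ((Polynomial.X ^ 2 - 1) ^ n) n) x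
  simp only [Polynomial.eval_pow, Polynomial.eval_sub, Polynomial.eval_X, Polynomial.eval_one] at h
  rw [legendreP, h, Polynomial.eval_mul, Polynomial.eval_C, rodrigues]

lemma assocP_sq (n k : ℕ) {x : ℝ} (hx : x ∈ Icc (-1:ℝ) 1) :
    assocP n k x ^ 2
      = (1 - x ^ 2) ^ k * (rodrigues n (n + k)).eval x ^ 2 / (2 ^ n * n.factorial : ℝ) ^ 2 := by
  have h : 0 ≤ 1 - x ^ 2 := by nlinarith [hx.1, hx.2]
  have e : Polynomial.derivative^[k] (rodrigues n n) = rodrigues n (n + k) := by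
    rw [rodrigues, rodrigues, ← Function.iterate_add_apply, add_comm]
  rw [assocP, legendreP_eq, iteratedDeriv_eval, Polynomial.iterate_derivative_C_mul, e]
  simp only [Polynomial.eval_mul, Polynomial.eval_C]
  rw [mul_pow, mul_pow, ← pow_mul, pow_mul', neg_one_sq,
    one_pow, ← pow_mul, pow_mul', Real.sq_sqrt h, mul_pow, inv_pow]
  ring

lemma tY_sq (n : ℕ) (m : ℤ) (hm : m.natAbs ≤ n) {x : ℝ} (hx : x ∈ Icc (-1:ℝ) 1) :
    tY n m x ^ 2 = harmonicDensity n m.natAbs x := by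
  have hpi := Real.pi_ne_zero
  rw [tY, mul_pow, Real.sq_sqrt (by positivity), assocPZ]
  split_ifs with h
  · obtain ⟨k, rfl⟩ := Int.eq_ofNat_of_zero_le h
    simp only [Int.natAbs_natCast] at hm ⊢
    have e1 : ((n:ℤ) - k).toNat = n - k := by omega
    have e2 : ((n:ℤ) + k).toNat = n + k := by omega
    rw [e1, e2, Int.toNat_natCast, assocP_sq n k hx, harmonicDensity, harmonicFactor]
    ring
  · obtain ⟨k, rfl⟩ : ∃ k : ℕ, m = -k := ⟨m.natAbs, by omega⟩
    simp only [Int.natAbs_neg, Int.natAbs_natCast] at hm ⊢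
    have e1 : ((n:ℤ) - -k).toNat = n + k := by omega
    have e2 : ((n:ℤ) + -k).toNat = n - k := by omega
    rw [e1, e2, mul_pow, assocP_sq n k hx, harmonicDensity, harmonicFactor, mul_pow, ← pow_mul,
      pow_mul', neg_one_sq, one_pow]
    have : ((n - k).factorial : ℝ) ≠ 0 := by positivity
    have : ((n + k).factorial : ℝ) ≠ 0 := by positivity
    field_simp

lemma harmonicDensity_bound (n k : ℕ) (hk : k ≤ n) (hn : 1 ≤ n) {x : ℝ}
    (hx : x ∈ Icc (-1:ℝ) 1) :
    (1 + k + |(n:ℝ) * (n + 1) * (1 - x ^ 2) - k ^ 2|) * harmonicDensity n k x ^ 2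
      ≤ 729088 * ((n:ℝ) * (n + 1)) := by
  have hn' : (1:ℝ) ≤ n := by exact_mod_cast hn
  have hk' : (k:ℝ) ≤ n := by exact_mod_cast hk
  have hm : (k:ℝ) = 0 ∨ (1:ℝ) ≤ k := by
    rcases Nat.eq_zero_or_pos k with rfl | h
    · simp
    · exact Or.inr (by exact_mod_cast h)
  have key : ∀ y ∈ Icc (0:ℝ) 1,
      (1 + k + |(n:ℝ) * (n + 1) * (1 - y ^ 2) - k ^ 2|) * harmonicDensity n k y ^ 2
        ≤ 729088 * ((n:ℝ) * (n + 1)) := fun y hy =>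
    (legendreSystem_harmonicDensity n k hk).density_bound_all hm (by nlinarith)
      (by nlinarith [Nat.cast_nonneg (α := ℝ) k]) hy
  rcases le_total 0 x with h | h
  · exact key x ⟨h, hx.2⟩
  · have := key (-x) ⟨by linarith, by linarith [hx.1]⟩
    rwa [neg_sq, harmonicDensity_neg] at this

lemma alm_sq (n : ℕ) (m : ℤ) (hm : m.natAbs ≤ n) :
    alm n m ^ 2 = 1 - (m.natAbs : ℝ) ^ 2 / ((n:ℝ) + 1 / 2) ^ 2 := by
  have hm' : (m.natAbs : ℝ) ≤ n := by exact_mod_cast hm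
  have h : blm n m = (m.natAbs : ℝ) / ((n:ℝ) + 1 / 2) := by rw [blm, Nat.cast_natAbs, Int.cast_abs]
  have h1 : blm n m ≤ 1 := by
    rw [h, div_le_one (by positivity)]
    linarith
  have h0 : 0 ≤ blm n m := by
    rw [h]
    positivity
  rw [alm, Real.sq_sqrt (by nlinarith), h, div_pow]

lemma envelope_le (n : ℕ) (m : ℤ) (hm : m.natAbs ≤ n) {x : ℝ} (hx : x ∈ Icc (-1:ℝ) 1) :
    ((n:ℝ) + 1 / 2) ^ 2 * ((1 + |(m:ℝ)|) / (1 + (n:ℝ)) ^ 2 + |x ^ 2 - alm n m ^ 2|)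
      ≤ 2 * (1 + m.natAbs + |(n:ℝ) * (n + 1) * (1 - x ^ 2) - (m.natAbs : ℝ) ^ 2|) := by
  have hx0 : 0 ≤ 1 - x ^ 2 := by nlinarith [hx.1, hx.2]
  have e : |(m:ℝ)| = m.natAbs := by rw [Nat.cast_natAbs, Int.cast_abs]
  set k : ℝ := (m.natAbs : ℝ)
  have hk : 0 ≤ k := Nat.cast_nonneg _
  set l : ℝ := (n:ℝ) + 1 / 2 with hl
  have hl0 : 0 < l := by positivity
  have e1 : l ^ 2 * |x ^ 2 - alm n m ^ 2|
      = |(n:ℝ) * (n + 1) * (1 - x ^ 2) - k ^ 2 + (1 - x ^ 2) / 4| := by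
    rw [alm_sq n m hm, abs_sub_comm, ← abs_of_pos (pow_pos hl0 2), ← abs_mul,
      abs_of_pos (pow_pos hl0 2)]
    congr 1
    change l ^ 2 * (1 - k ^ 2 / l ^ 2 - x ^ 2) = _
    field_simp
    rw [hl]
    ring
  have e2 := abs_add_le ((n:ℝ) * (n + 1) * (1 - x ^ 2) - k ^ 2) ((1 - x ^ 2) / 4)
  rw [abs_of_nonneg (by positivity : 0 ≤ (1 - x ^ 2) / 4)] at e2
  have e3 : l ^ 2 * ((1 + k) / (1 + (n:ℝ)) ^ 2) ≤ 1 + k := by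
    rw [mul_div_assoc', div_le_iff₀ (by positivity), mul_comm]
    refine mul_le_mul_of_nonneg_left (pow_le_pow_left₀ hl0.le ?_ 2) (by positivity)
    linarith
  rw [e, mul_add, e1]
  have := abs_nonneg ((n:ℝ) * (n + 1) * (1 - x ^ 2) - k ^ 2)
  nlinarith [sq_nonneg x]

lemma tY_pow_four_mul_le (n : ℕ) (m : ℤ) (hm : m.natAbs ≤ n) {x : ℝ} (hx : x ∈ Icc (-1:ℝ) 1) :
    tY n m x ^ 4 * ((1 + |(m:ℝ)|) / (1 + (n:ℝ)) ^ 2 + |x ^ 2 - alm n m ^ 2|) ≤ 40 ^ 4 := by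
  have e := envelope_le n m hm hx
  set Y := (1 + |(m:ℝ)|) / (1 + (n:ℝ)) ^ 2 + |x ^ 2 - alm n m ^ 2|
  have h4 : tY n m x ^ 4 = harmonicDensity n m.natAbs x ^ 2 := by
    rw [← tY_sq n m hm hx]
    ring
  rw [h4]
  rcases Nat.eq_zero_or_pos n with rfl | hn
  · obtain rfl : m = 0 := by omega
    have h1 : harmonicDensity 0 0 x ≤ 1 := by
      simp only [harmonicDensity, harmonicFactor, rodrigues]
      norm_num
      rw [inv_mul_le_iff₀ Real.pi_pos]
      linarith [Real.pi_gt_three]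
    have h0 := harmonicDensity_nonneg 0 0 hx
    norm_num at e h1 h0 ⊢
    nlinarith
  · have hb := harmonicDensity_bound n m.natAbs hm hn hx
    have hl : (0:ℝ) < ((n:ℝ) + 1 / 2) ^ 2 := by positivity
    refine le_of_mul_le_mul_left ?_ hl
    have h1 := mul_le_mul_of_nonneg_right e (sq_nonneg (harmonicDensity n m.natAbs x))
    nlinarith

end Harmonics

lemma abs_le_mul_rpow_neg_quarter {y X c : ℝ} (hX : 0 < X) (hc : 0 ≤ c)
    (h : y ^ 4 * X ≤ c ^ 4) : |y| ≤ c * X ^ (-(1:ℝ) / 4) := by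
  have hr : 0 < X ^ (-(1:ℝ) / 4) := Real.rpow_pos_of_pos hX _
  have h4 : (X ^ (-(1:ℝ) / 4)) ^ 4 * X = 1 := by
    rw [← Real.rpow_natCast, ← Real.rpow_mul hX.le]
    norm_num
    rw [Real.rpow_neg_one, inv_mul_cancel₀ hX.ne']
  refine le_of_pow_le_pow_left₀ four_ne_zero (by positivity) ?_
  rw [mul_pow, Even.pow_abs ⟨2, rfl⟩]
  refine le_of_mul_le_mul_right ?_ hX
  rw [mul_assoc, h4, mul_one]
  exact h

/-- the combined bound
`|Ỹ_{ℓ,m}(x)| ≤ C ((1+|m|)(1+ℓ)^{−2} + |x² − a_{ℓ,m}²|)^{−1/4}`. -/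
theorem statement14 :
    ∃ C : ℝ, 0 < C ∧
      ∀ (n : ℕ) (m : ℤ), m.natAbs ≤ n → ∀ x : ℝ, x ∈ Set.Icc (-1 : ℝ) 1 →
        |tY n m x| ≤
          C * ((1 + |(m:ℝ)|) / (1 + (n:ℝ))^2 + |x^2 - alm n m ^ 2|) ^ (-(1:ℝ)/4) := by
  refine ⟨40, by norm_num, fun n m hm x hx => ?_⟩
  exact abs_le_mul_rpow_neg_quarter (by positivity) (by norm_num) (tY_pow_four_mul_le n m hm hx)
end
end

section
/- Let ε ∈ (0,1) and α ∈ [0,1/2). There exists C_{ε,α} > 0 such that for every integer i ≥ 1 and every x ∈ [−1,1], (1/i) · max{1/i, |x|}^{1−2α} · ∑ λ_{ℓ,m}^{α} |m|^{−2α} |Ỹ_{ℓ,m}(x)|² ≤ C_{ε,α}, where the sum is over all (ℓ,m) ∈ ℕ×ℤ with |m| ≤ ℓ, |m| ≥ ε(ℓ+1/2) and λ_{ℓ,m} ∈ [i², (i+1)²]. -/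
open MeasureTheory Set
open scoped ENNReal NNReal

noncomputable section

/-- The eigenvalue `λ_{ℓ,m} = ℓ(ℓ+1) − m²`. -/
def eigenL (n : ℕ) (m : ℤ) : ℝ := (n : ℝ) * ((n : ℝ) + 1) - (m : ℝ)^2

theorem antitoneOn_Icc_of_hasDerivAt {f f' : ℝ → ℝ} {a c : ℝ} (hf : ContinuousOn f (Icc a c))
    (hd : ∀ x ∈ Ioo a c, HasDerivAt f (f' x) x) (hn : ∀ x ∈ Ioo a c, f' x ≤ 0) :
    AntitoneOn f (Icc a c) := by
  refine antitoneOn_of_deriv_nonpos (convex_Icc a c) hf ?_ ?_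
  · intro x hx
    rw [interior_Icc] at hx
    exact (hd x hx).differentiableAt.differentiableWithinAt
  · intro x hx
    rw [interior_Icc] at hx
    rw [(hd x hx).deriv]
    exact hn x hx

/-- A normalized solution, vanishing at `1`, of the associated Legendre equation
`(1-x²) ((1-x²) y')' + L (b² - x²) y = 0`, with `v = (1-x²) y'`. -/
structure IsLegendreSolution (L b : ℝ) (y v : ℝ → ℝ) : Prop where
  continuous_fst : Continuous y
  continuous_snd : Continuous v
  hasDerivAt_fst : ∀ x ∈ Ico (0:ℝ) 1, HasDerivAt y (v x / (1 - x^2)) x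
  hasDerivAt_snd : ∀ x ∈ Ico (0:ℝ) 1, HasDerivAt v (-(L * (b^2 - x^2)) * y x / (1 - x^2)) x
  fst_one : y 1 = 0
  snd_one : v 1 = 0
  mul_at_zero : y 0 * v 0 = 0
  mass_le : ∫ x in (0:ℝ)..1, y x ^ 2 ≤ 1

namespace IsLegendreSolution

variable {L b ε : ℝ} {y v : ℝ → ℝ}

theorem energy_antitoneOn (h : IsLegendreSolution L b y v) (hL : 0 < L) :
    AntitoneOn (fun x => v x ^ 2 + L * (b^2 - x^2) * y x ^ 2) (Icc 0 1) := by
  have hy := h.continuous_fst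
  have hv := h.continuous_snd
  refine antitoneOn_Icc_of_hasDerivAt (f' := fun x => -(2 * L * x * y x ^ 2))
    (by fun_prop) ?_ ?_
  · intro x hx
    have hx' : x ∈ Ico (0:ℝ) 1 := ⟨hx.1.le, hx.2⟩
    have h1 : (1 - x^2) ≠ 0 := by nlinarith [hx.1, hx.2]
    refine ((((h.hasDerivAt_snd x hx').pow 2)).add ((((hasDerivAt_id x).pow 2).const_sub
      (b^2)).const_mul L |>.mul ((h.hasDerivAt_fst x hx').pow 2))).congr_deriv ?_
    simp
    field_simp
    ring
  · intro x hx
    have := mul_nonneg (mul_nonneg hL.le hx.1.le) (sq_nonneg (y x))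
    linarith

theorem energy_nonneg (h : IsLegendreSolution L b y v) (hL : 0 < L) {x : ℝ}
    (hx : x ∈ Icc (0:ℝ) 1) : 0 ≤ v x ^ 2 + L * (b^2 - x^2) * y x ^ 2 := by
  have := h.energy_antitoneOn hL hx (right_mem_Icc.2 zero_le_one) hx.2
  simpa [h.fst_one, h.snd_one] using this

theorem energy_le (h : IsLegendreSolution L b y v) (hL : 0 < L) {x : ℝ}
    (hx : x ∈ Icc (0:ℝ) 1) :
    v x ^ 2 + L * (b^2 - x^2) * y x ^ 2 ≤ v 0 ^ 2 + L * b^2 * y 0 ^ 2 := by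
  have := h.energy_antitoneOn hL (left_mem_Icc.2 zero_le_one) hx hx.1
  simpa using this

theorem hasDerivAt_mul (h : IsLegendreSolution L b y v) {x : ℝ} (hx : x ∈ Ico (0:ℝ) 1) :
    HasDerivAt (fun x => y x * v x) ((v x ^ 2 - L * (b^2 - x^2) * y x ^ 2) / (1 - x^2)) x := by
  refine ((h.hasDerivAt_fst x hx).mul (h.hasDerivAt_snd x hx)).congr_deriv ?_
  ring

theorem mul_nonpos (h : IsLegendreSolution L b y v) (hL : 0 < L) (hb : 0 < b) {x : ℝ}
    (hx : x ∈ Icc b 1) : y x * v x ≤ 0 := by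
  have hy := h.continuous_fst
  have hv := h.continuous_snd
  have key : AntitoneOn (fun x => -(y x * v x)) (Icc b 1) := by
    refine antitoneOn_Icc_of_hasDerivAt (by fun_prop)
      (fun x hx => (h.hasDerivAt_mul ⟨hb.le.trans hx.1.le, hx.2⟩).neg) ?_
    intro x hx
    have h1 : 0 < 1 - x^2 := by nlinarith [hx.1, hx.2]
    have h2 : 0 ≤ x^2 - b^2 := by nlinarith [hx.1, hx.2]
    have := mul_nonneg (mul_nonneg hL.le h2) (sq_nonneg (y x))
    rw [neg_nonpos]
    exact div_nonneg (by nlinarith [sq_nonneg (v x)]) h1.le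
  have := key hx (right_mem_Icc.2 (hx.1.trans hx.2)) hx.2
  simp only [h.fst_one] at this
  linarith

/-- A virial identity bounds the energy at the equator by the mass. -/
theorem energy_zero_le (h : IsLegendreSolution L b y v) (hL : 0 < L) (hb : 0 < b) (hε : 0 < ε)
    (hbε : b^2 + ε^2 ≤ 1) :
    v 0 ^ 2 + L * b^2 * y 0 ^ 2 ≤ 4 / ε^2 * (L * b) := by
  have hy := h.continuous_fst
  have hv := h.continuous_snd
  have hy2 : Continuous fun x => y x ^ 2 := by fun_prop
  have hb1 : b ≤ 1 := by nlinarith [sq_nonneg ε]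
  have hε1 : ε^2 ≤ 1 := by nlinarith [sq_nonneg b]
  have hε2 : 0 < ε^2 := by positivity
  set c : ℝ := 4 / ε^2 * (L * b^2) with hc
  have hprim : ∀ x, HasDerivAt (fun u => ∫ s in (0:ℝ)..u, y s ^ 2) (y x ^ 2) x := fun x =>
    intervalIntegral.integral_hasDerivAt_right (hy2.intervalIntegrable _ _)
      (hy2.stronglyMeasurableAtFilter _ _) hy2.continuousAt
  have hprimc : Continuous (fun u => ∫ s in (0:ℝ)..u, y s ^ 2) :=
    continuous_iff_continuousAt.2 fun x => (hprim x).continuousAt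
  have key : AntitoneOn (fun x => -((b - x) * (v x ^ 2 + L * (b^2 - x^2) * y x ^ 2) + y x * v x
      + c * ∫ s in (0:ℝ)..x, y s ^ 2)) (Icc 0 b) := by
    refine antitoneOn_Icc_of_hasDerivAt (f' := fun x =>
      -(-(v x ^ 2 + L * (b^2 - x^2) * y x ^ 2) - (b - x) * (2 * L * x * y x ^ 2)
        + (v x ^ 2 - L * (b^2 - x^2) * y x ^ 2) / (1 - x^2) + c * y x ^ 2)) (by fun_prop) ?_ ?_
    · intro x hx
      have hx' : x ∈ Ico (0:ℝ) 1 := ⟨hx.1.le, hx.2.trans_le hb1⟩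
      have h1 : (1 - x^2) ≠ 0 := by nlinarith [hx.1, hx'.2]
      have hE := ((((h.hasDerivAt_snd x hx').pow 2)).add ((((hasDerivAt_id x).pow 2).const_sub
        (b^2)).const_mul L |>.mul ((h.hasDerivAt_fst x hx').pow 2)))
      refine ((((((hasDerivAt_id x).const_sub b).mul hE).add (h.hasDerivAt_mul hx')).add
        ((hprim x).const_mul c)).neg).congr_deriv ?_
      simp
      field_simp
      ring
    · intro x hx
      have hx1 : x^2 ≤ b^2 := by nlinarith [hx.1, hx.2]
      have h1 : ε^2 ≤ 1 - x^2 := by linarith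
      have h1' : 0 < 1 - x^2 := by linarith
      have hV : v x ^ 2 ≤ v x ^ 2 / (1 - x^2) := by
        rw [le_div_iff₀ h1']; nlinarith [sq_nonneg (v x), sq_nonneg x]
      have hq : L * (b^2 - x^2) * y x ^ 2 ≤ L * b^2 * y x ^ 2 := by
        have := mul_nonneg (mul_nonneg hL.le (sq_nonneg x)) (sq_nonneg (y x))
        nlinarith
      have hQ : L * (b^2 - x^2) * y x ^ 2 / (1 - x^2) ≤ 1 / ε^2 * (L * b^2 * y x ^ 2) := by
        rw [div_le_iff₀ h1']
        have hpos : 0 ≤ 1 / ε^2 * (L * b^2 * y x ^ 2) := by positivity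
        have : 1 / ε^2 * (L * b^2 * y x ^ 2) * ε^2 = L * b^2 * y x ^ 2 := by
          field_simp
        nlinarith
      have hX : (b - x) * (2 * L * x * y x ^ 2) ≤ 2 * (L * b^2 * y x ^ 2) := by
        have h3 : (b - x) * x ≤ b^2 := by nlinarith [hx.1, hx.2]
        have := mul_le_mul_of_nonneg_right h3 (by positivity : 0 ≤ 2 * L * y x ^ 2)
        nlinarith
      have hone : L * b^2 * y x ^ 2 ≤ 1 / ε^2 * (L * b^2 * y x ^ 2) := by
        have : 1 ≤ 1 / ε^2 := by rw [le_div_iff₀ hε2]; linarith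
        have h0 : 0 ≤ L * b^2 * y x ^ 2 := by positivity
        nlinarith
      have hcy : c * y x ^ 2 = 4 * (1 / ε^2 * (L * b^2 * y x ^ 2)) := by
        rw [hc]; ring
      rw [hcy, sub_div]
      linarith
  have h0 := key (left_mem_Icc.2 hb.le) (right_mem_Icc.2 hb.le) hb.le
  have hm := h.mul_nonpos hL hb (left_mem_Icc.2 hb1)
  have hint : ∫ s in (0:ℝ)..b, y s ^ 2 ≤ 1 := by
    refine le_trans ?_ h.mass_le
    exact intervalIntegral.integral_mono_interval le_rfl hb.le hb1
      (Filter.Eventually.of_forall fun x => sq_nonneg _) (hy2.intervalIntegrable _ _)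
  have h00 := h.mul_at_zero
  simp only [intervalIntegral.integral_same, h00] at h0
  have hcpos : 0 ≤ c := by positivity
  have h2 : b * (v 0 ^ 2 + L * b^2 * y 0 ^ 2) ≤ c := by
    have := mul_le_mul_of_nonneg_left hint hcpos
    simp only [sub_self, zero_mul, sub_zero, ne_eq, OfNat.ofNat_ne_zero, not_false_eq_true,
      zero_pow, mul_zero, add_zero, zero_add] at h0
    linarith
  have h3 : c = b * (4 / ε^2 * (L * b)) := by rw [hc]; ring
  rw [h3] at h2
  exact le_of_mul_le_mul_left h2 hb

end IsLegendreSolution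

/-- The potential of the Liouville normal form of the associated Legendre equation. -/
def liouvillePotential (L b x : ℝ) : ℝ :=
  L + (1 - x^2) / (2 * (b^2 - x^2)^2) * (1 - 3 * x^2 + 5 / 2 * x^2 * ((1 - x^2) / (b^2 - x^2)))

theorem liouvillePotential_pos {L b x : ℝ} (hL : 0 < L) (hb1 : b ≤ 1) (hx : x ∈ Ico 0 b) :
    0 < liouvillePotential L b x := by
  have hx1 : x < 1 := hx.2.trans_le hb1
  have hp : 0 < b^2 - x^2 := by nlinarith [hx.1, hx.2]
  have h1 : 0 < 1 - x^2 := by nlinarith [hx.1, hx.2]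
  have hr : 1 ≤ (1 - x^2) / (b^2 - x^2) := by
    rw [le_div_iff₀ hp]; nlinarith [hx.1, hx.2]
  have h2 : 0 ≤ 1 - 3 * x^2 + 5 / 2 * x^2 * ((1 - x^2) / (b^2 - x^2)) := by
    nlinarith [mul_le_mul_of_nonneg_left hr (sq_nonneg x)]
  unfold liouvillePotential
  positivity

theorem exists_hasDerivAt_liouvillePotential {L b x : ℝ} (hb : 0 < b) (hb1 : b ≤ 1)
    (hx : x ∈ Ico 0 b) :
    ∃ d, 0 ≤ d ∧ HasDerivAt (liouvillePotential L b) d x := by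
  have hx1 : x < 1 := hx.2.trans_le hb1
  have hp : 0 < b^2 - x^2 := by nlinarith [hx.1, hx.2]
  have h1 : 0 < 1 - x^2 := by nlinarith [hx.1, hx.2]
  have hbb : b^2 ≤ 1 := by nlinarith
  have hr : 1 ≤ (1 - x^2) / (b^2 - x^2) := by
    rw [le_div_iff₀ hp]; linarith
  have h2 : 0 ≤ 1 - 3 * x^2 + 5 / 2 * x^2 * ((1 - x^2) / (b^2 - x^2)) := by
    nlinarith [mul_le_mul_of_nonneg_left hr (sq_nonneg x)]
  have h3 : 0 ≤ 5 / 2 * b^2 * (1 - x^2)^2 - 2 * (b^2 - x^2)^2 := by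
    have e1 : b^2 - x^2 ≤ b^2 * (1 - x^2) := by nlinarith [sq_nonneg x]
    have e2 : b^2 - x^2 ≤ 1 - x^2 := by linarith
    have e3 := mul_le_mul e1 e2 hp.le (by positivity)
    nlinarith [sq_nonneg (b^2 - x^2)]
  refine ⟨x * (2 * (1 - b^2) / (b^2 - x^2)^3 *
      (1 - 3 * x^2 + 5 / 2 * x^2 * ((1 - x^2) / (b^2 - x^2)))
      + (5 / 2 * b^2 * (1 - x^2)^2 - 2 * (b^2 - x^2)^2) / (b^2 - x^2)^4), ?_, ?_⟩
  · have hbb' : 0 ≤ 1 - b^2 := by linarith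
    have := hx.1
    positivity
  · have d2 : HasDerivAt (fun x : ℝ => x^2) (2 * x) x := by simpa using hasDerivAt_pow 2 x
    have dp := d2.const_sub (b^2)
    have d1 := d2.const_sub 1
    have := ((d1.div ((dp.pow 2).const_mul 2) (mul_pos two_pos (pow_pos hp 2)).ne').mul
      (((d2.const_mul 3).const_sub 1).add ((d2.const_mul (5/2)).mul
        (d1.div dp hp.ne')))).const_add L
    refine this.congr_deriv ?_
    simp
    field_simp
    ring

namespace IsLegendreSolution

variable {L b ε : ℝ} {y v : ℝ → ℝ}

/-- Sonin's monotonicity for the Liouville normal form. -/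
theorem sqrt_mul_sq_le (h : IsLegendreSolution L b y v) (hL : 0 < L) (hb : 0 < b) (hε : 0 < ε)
    (hbε : b^2 + ε^2 ≤ 1) {X : ℝ} (hX : X ∈ Ico 0 b) :
    Real.sqrt (b^2 - X^2) * y X ^ 2 ≤ 4 / ε^2 := by
  have hb1 : b ≤ 1 := by nlinarith [sq_nonneg ε]
  set a : ℝ → ℝ := fun x => v x - x * (1 - x^2) / 2 * (y x / (b^2 - x^2)) with ha
  set Φ := liouvillePotential L b with hΦ
  have hmem : ∀ x ∈ Icc 0 X, x ∈ Ico 0 b ∧ x ∈ Ico (0:ℝ) 1 ∧ 0 < b^2 - x^2 ∧ 0 < 1 - x^2 := by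
    intro x hx
    have hxb : x < b := hx.2.trans_lt hX.2
    have hx1 : x < 1 := hxb.trans_le hb1
    exact ⟨⟨hx.1, hxb⟩, ⟨hx.1, hx1⟩, by nlinarith [hx.1], by nlinarith [hx.1]⟩
  have hΦpos : ∀ x ∈ Icc 0 X, 0 < Φ x := fun x hx =>
    liouvillePotential_pos hL hb1 (hmem x hx).1
  have hda : ∀ x ∈ Icc 0 X, HasDerivAt a
      (-(Φ x * (b^2 - x^2) * y x) / (1 - x^2) - x / (2 * (b^2 - x^2)) * a x) x := by
    intro x hx
    obtain ⟨-, hx1, hp, h1⟩ := hmem x hx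
    have d2 : HasDerivAt (fun x : ℝ => x^2) (2 * x) x := by simpa using hasDerivAt_pow 2 x
    have dp := d2.const_sub (b^2)
    have d1 := d2.const_sub 1
    refine ((h.hasDerivAt_snd x hx1).sub ((((hasDerivAt_id x).mul d1).div_const 2).mul
      ((h.hasDerivAt_fst x hx1).div dp hp.ne'))).congr_deriv ?_
    simp only [ha, hΦ, liouvillePotential, id]
    simp
    field_simp
    ring
  have hder : ∀ x ∈ Icc 0 X, ∃ d, d ≤ 0 ∧ HasDerivAt
      (fun x => Real.sqrt (b^2 - x^2) * y x ^ 2 + a x ^ 2 / (Real.sqrt (b^2 - x^2) * Φ x)) d x := by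
    intro x hx
    obtain ⟨hxb, hx1, hp, h1⟩ := hmem x hx
    obtain ⟨d, hd0, hd⟩ := exists_hasDerivAt_liouvillePotential (L := L) hb hb1 hxb
    have hF := hΦpos x hx
    have d2 : HasDerivAt (fun x : ℝ => x^2) (2 * x) x := by simpa using hasDerivAt_pow 2 x
    have dp := d2.const_sub (b^2)
    have dr := dp.sqrt hp.ne'
    have hr : 0 < Real.sqrt (b^2 - x^2) := Real.sqrt_pos.2 hp
    have hrr : Real.sqrt (b^2 - x^2) ^ 2 = b^2 - x^2 := Real.sq_sqrt hp.le
    refine ⟨-(a x ^ 2 * d / (Real.sqrt (b^2 - x^2) * Φ x ^ 2)), ?_, ?_⟩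
    · rw [neg_nonpos]; positivity
    · refine ((dr.mul ((h.hasDerivAt_fst x hx1).pow 2)).add (((hda x hx).pow 2).div
        (dr.mul hd) (mul_pos hr hF).ne')).congr_deriv ?_
      have hvx : v x = a x + x * (1 - x^2) / 2 * (y x / (b^2 - x^2)) := by simp [ha]
      rw [hvx]
      simp only [Pi.mul_apply, Pi.pow_apply, ← hΦ]
      generalize a x = A
      generalize Φ x = F at *
      generalize Real.sqrt (b^2 - x^2) = r at *
      rw [← hrr]
      push_cast
      field_simp
      ring
  choose! d hd0 hd using hder
  have key := antitoneOn_Icc_of_hasDerivAt (a := 0) (c := X)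
    (fun x hx => (hd x hx).continuousAt.continuousWithinAt)
    (fun x hx => hd x (Ioo_subset_Icc_self hx)) (fun x hx => hd0 x (Ioo_subset_Icc_self hx))
  have hXX : X ∈ Icc 0 X := ⟨hX.1, le_rfl⟩
  have h0 := key (left_mem_Icc.2 hX.1) hXX hX.1
  have hpos : 0 ≤ a X ^ 2 / (Real.sqrt (b^2 - X^2) * Φ X) := by
    have := hΦpos X hXX
    positivity
  have hE := h.energy_zero_le hL hb hε hbε
  have hs : Real.sqrt (b^2 - 0^2) = b := by simp [hb.le]
  have ha0 : a 0 = v 0 := by simp [ha]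
  have hΦ0 : L ≤ Φ 0 := by
    simp only [hΦ, liouvillePotential]
    have : 0 ≤ (1 - (0:ℝ)^2) / (2 * (b^2 - 0^2)^2) * (1 - 3 * 0^2 +
      5 / 2 * 0^2 * ((1 - 0^2) / (b^2 - 0^2))) := by
      norm_num
      positivity
    linarith
  simp only [hs, ha0] at h0
  have hfin : b * y 0 ^ 2 + v 0 ^ 2 / (b * Φ 0) ≤ 4 / ε^2 := by
    have e1 : v 0 ^ 2 / (b * Φ 0) ≤ v 0 ^ 2 / (b * L) := by gcongr
    have e2 : b * y 0 ^ 2 + v 0 ^ 2 / (b * L) = (v 0 ^ 2 + L * b^2 * y 0 ^ 2) / (b * L) := by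
      field_simp; ring
    have e3 : (v 0 ^ 2 + L * b^2 * y 0 ^ 2) / (b * L) ≤ 4 / ε^2 := by
      rw [div_le_iff₀ (by positivity)]
      linarith
    linarith
  linarith

theorem sq_antitoneOn (h : IsLegendreSolution L b y v) (hL : 0 < L) (hb : 0 < b) :
    AntitoneOn (fun x => y x ^ 2) (Icc b 1) := by
  have hy := h.continuous_fst
  refine antitoneOn_Icc_of_hasDerivAt (f' := fun x => 2 * (y x * v x) / (1 - x^2))
    (by fun_prop) ?_ ?_
  · intro x hx
    refine ((h.hasDerivAt_fst x ⟨hb.le.trans hx.1.le, hx.2⟩).pow 2).congr_deriv ?_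
    simp
    ring
  · intro x hx
    have h1 : 0 < 1 - x^2 := by nlinarith [hx.1, hx.2]
    have := h.mul_nonpos hL hb (Ioo_subset_Icc_self hx)
    exact div_nonpos_of_nonpos_of_nonneg (by linarith) h1.le

theorem snd_sq_antitoneOn (h : IsLegendreSolution L b y v) (hL : 0 < L) (hb : 0 < b) :
    AntitoneOn (fun x => v x ^ 2) (Icc b 1) := by
  have hv := h.continuous_snd
  refine antitoneOn_Icc_of_hasDerivAt
    (f' := fun x => 2 * L * (x^2 - b^2) * (y x * v x) / (1 - x^2)) (by fun_prop) ?_ ?_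
  · intro x hx
    refine ((h.hasDerivAt_snd x ⟨hb.le.trans hx.1.le, hx.2⟩).pow 2).congr_deriv ?_
    simp
    ring
  · intro x hx
    have h1 : 0 < 1 - x^2 := by nlinarith [hx.1, hx.2]
    have h2 : 0 < x^2 - b^2 := by nlinarith [hx.1, hx.2]
    have := h.mul_nonpos hL hb (Ioo_subset_Icc_self hx)
    exact div_nonpos_of_nonpos_of_nonneg
      (mul_nonpos_of_nonneg_of_nonpos (by positivity) this) h1.le

/-- Decay far beyond the turning point. -/
theorem sq_mul_le (h : IsLegendreSolution L b y v) (hL : 0 < L) (hb : 0 < b) (hε : 0 < ε)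
    (hbε : b^2 + ε^2 ≤ 1) {x : ℝ} (hx : x ∈ Icc b 1) :
    (x^2 - b^2) * y x ^ 2 ≤ 4 / ε^2 * b := by
  have h0 : x ∈ Icc (0:ℝ) 1 := ⟨hb.le.trans hx.1, hx.2⟩
  have hb1 : b ≤ 1 := hx.1.trans hx.2
  have e1 := h.energy_nonneg hL h0
  have e2 := h.snd_sq_antitoneOn hL hb (left_mem_Icc.2 hb1) hx hx.1
  have e3 := h.energy_le hL (x := b) ⟨hb.le, hb1⟩
  have e4 := h.energy_zero_le hL hb hε hbε
  simp only [sub_self, mul_zero, zero_mul, add_zero] at e2 e3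
  refine le_of_mul_le_mul_left ?_ hL
  nlinarith

/-- Comparison with the exponentially decaying WKB solution just beyond the turning point. -/
theorem sq_mul_sqrt_le (h : IsLegendreSolution L b y v) (hL : 0 < L) (hb : 0 < b)
    {X : ℝ} (hX : X ∈ Icc b 1) :
    y X ^ 2 * (2 * Real.sqrt L * Real.sqrt (X^2 - b^2) ^ 3 / (3 * X)) ≤ y b ^ 2 := by
  have hy := h.continuous_fst
  have hX0 : 0 < X := hb.trans_le hX.1
  have key : AntitoneOn (fun u => y u ^ 2 +
      2 * Real.sqrt L * y X ^ 2 / (3 * X) * Real.sqrt (u^2 - b^2) ^ 3) (Icc b X) := by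
    refine antitoneOn_Icc_of_hasDerivAt (f' := fun u => 2 * (y u * v u) / (1 - u^2) +
      2 * Real.sqrt L * y X ^ 2 / X * (u * Real.sqrt (u^2 - b^2))) (by fun_prop) ?_ ?_
    · intro u hu
      have hp : 0 < u^2 - b^2 := by nlinarith [hu.1]
      have d2 : HasDerivAt (fun x : ℝ => x^2) (2 * u) u := by simpa using hasDerivAt_pow 2 u
      have hr : 0 < Real.sqrt (u^2 - b^2) := Real.sqrt_pos.2 hp
      refine (((h.hasDerivAt_fst u ⟨hb.le.trans hu.1.le, hu.2.trans_le hX.2⟩).pow 2).add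
        ((((d2.sub_const (b^2)).sqrt hp.ne').pow 3).const_mul _)).congr_deriv ?_
      simp
      field_simp
    · intro u hu
      have hu1 : u < 1 := hu.2.trans_le hX.2
      have hu0 : 0 < u := hb.trans hu.1
      have hub : u ∈ Icc b 1 := ⟨hu.1.le, hu1.le⟩
      have h1 : 0 < 1 - u^2 := by nlinarith
      have hp : 0 < u^2 - b^2 := by nlinarith [hu.1]
      have hE := h.energy_nonneg hL (x := u) ⟨hu0.le, hu1.le⟩
      have hm := h.mul_nonpos hL hb hub
      have hyX : y X ^ 2 ≤ y u ^ 2 := h.sq_antitoneOn hL hb hub hX hu.2.le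
      have hw : Real.sqrt L * Real.sqrt (u^2 - b^2) * y u ^ 2 ≤ -(y u * v u) := by
        refine le_of_sq_le_sq ?_ (by linarith)
        have e1 : (Real.sqrt L * Real.sqrt (u^2 - b^2) * y u ^ 2) ^ 2 =
            y u ^ 2 * (L * (u^2 - b^2) * y u ^ 2) := by
          rw [mul_pow, mul_pow, Real.sq_sqrt hL.le, Real.sq_sqrt hp.le]; ring
        rw [e1]
        have : y u ^ 2 * (L * (u^2 - b^2) * y u ^ 2) ≤ y u ^ 2 * v u ^ 2 :=
          mul_le_mul_of_nonneg_left (by linarith) (sq_nonneg _)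
        linarith
      have e2 : -(y u * v u) ≤ -(y u * v u) / (1 - u^2) := by
        rw [le_div_iff₀ h1]; nlinarith [sq_nonneg u]
      have e3 : 2 * Real.sqrt L * y X ^ 2 / X * (u * Real.sqrt (u^2 - b^2)) ≤
          2 * (Real.sqrt L * Real.sqrt (u^2 - b^2) * y u ^ 2) := by
        have hr : 0 ≤ Real.sqrt L * Real.sqrt (u^2 - b^2) := by positivity
        have e4 : u / X ≤ 1 := by rw [div_le_one hX0]; exact hu.2.le
        have e5 : (u / X) * y X ^ 2 ≤ y u ^ 2 := by
          nlinarith [sq_nonneg (y X)]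
        have := mul_le_mul_of_nonneg_left e5 hr
        calc _ = 2 * (Real.sqrt L * Real.sqrt (u^2 - b^2) * (u / X * y X ^ 2)) := by ring
          _ ≤ _ := by linarith
      have e6 : 2 * (y u * v u) / (1 - u^2) = -(2 * (-(y u * v u) / (1 - u^2))) := by ring
      rw [e6]
      linarith
  have := key (left_mem_Icc.2 hX.1) (right_mem_Icc.2 hX.1) hX.1
  simp only [sub_self, Real.sqrt_zero] at this
  have e : 2 * Real.sqrt L * y X ^ 2 / (3 * X) * Real.sqrt (X^2 - b^2) ^ 3 =
    y X ^ 2 * (2 * Real.sqrt L * Real.sqrt (X^2 - b^2) ^ 3 / (3 * X)) := by ring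
  rw [e] at this
  norm_num at this
  nlinarith [sq_nonneg (y X)]

theorem mul_sq_le_uniform (h : IsLegendreSolution L b y v) (hL : 0 < L) (hb : 0 < b) (hε : 0 < ε)
    (hbε : b^2 + ε^2 ≤ 1) (hK : 1 ≤ 2 * (Real.sqrt L * b^2)) {x : ℝ} (hx : x ∈ Icc (0:ℝ) 1) :
    b * y x ^ 2 ≤ 12 / ε^6 * Real.sqrt (2 * (Real.sqrt L * b^2)) := by
  set k := 2 * (Real.sqrt L * b^2) with hk
  have hb1 : b ≤ 1 := by nlinarith [sq_nonneg ε]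
  have hε1 : ε^2 ≤ 1 := by nlinarith [sq_nonneg b]
  have hε2 : 0 < ε^2 := by positivity
  have hk0 : 0 < k := by linarith
  have hsk : 1 ≤ Real.sqrt k := by rwa [Real.one_le_sqrt]
  have hA : 4 / ε^2 ≤ 4 / ε^6 := by
    have : ε^6 ≤ ε^2 := by nlinarith [sq_nonneg (ε^2)]
    gcongr
  -- it suffices to treat `x ≤ b`
  wlog hxb : x ≤ b generalizing x
  · exact (mul_le_mul_of_nonneg_left (h.sq_antitoneOn hL hb (left_mem_Icc.2 hb1)
      ⟨(not_le.1 hxb).le, hx.2⟩ (not_le.1 hxb).le) hb.le).trans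
      (this ⟨hb.le, hb1⟩ le_rfl)
  have inner : ∀ z, 0 ≤ z → z ≤ b * (1 - 1 / k) → b * y z ^ 2 ≤ 4 / ε^2 * Real.sqrt k := by
    intro z hz hzk
    have hk1 : 0 < 1 / k := by positivity
    have hzb : z < b := by nlinarith
    have e1 := h.sqrt_mul_sq_le hL hb hε hbε ⟨hz, hzb⟩
    have hk1' : 1 / k ≤ 1 := by rw [div_le_one hk0]; exact hK
    have e2 : b^2 / k ≤ b^2 - z^2 := by
      have : z^2 ≤ (b * (1 - 1/k))^2 := by gcongr
      have e : b^2 / k = b^2 * (1/k) := by ring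
      rw [e]
      have : b^2 * (1/k)^2 ≤ b^2 * (1/k) := by
        have := mul_le_mul_of_nonneg_left hk1' (by positivity : 0 ≤ b^2 * (1/k))
        nlinarith
      nlinarith
    have e3 : b / Real.sqrt k ≤ Real.sqrt (b^2 - z^2) := by
      refine Real.le_sqrt_of_sq_le ?_
      rwa [div_pow, Real.sq_sqrt hk0.le]
    have e4 : b / Real.sqrt k * y z ^ 2 ≤ 4 / ε^2 :=
      (mul_le_mul_of_nonneg_right e3 (sq_nonneg _)).trans e1
    calc b * y z ^ 2 = (b / Real.sqrt k * y z ^ 2) * Real.sqrt k := by field_simp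
      _ ≤ _ := mul_le_mul_of_nonneg_right e4 (by positivity)
  rcases le_total x (b * (1 - 1 / k)) with hc | hc
  · refine (inner x hx.1 hc).trans ?_
    refine mul_le_mul_of_nonneg_right ?_ (by positivity)
    have : 4 / ε^6 ≤ 12 / ε^6 := by gcongr; norm_num
    linarith
  · set z := b * (1 - 1 / k) with hz
    have hk1' : 1 / k ≤ 1 := by rw [div_le_one hk0]; exact hK
    have hz0 : 0 ≤ z := mul_nonneg hb.le (by linarith)
    have e1 := inner z hz0 le_rfl
    have hM : ∀ u ∈ Icc z x, ‖v u / (1 - u^2)‖ ≤ Real.sqrt (4 / ε^2 * (L * b)) / ε^2 := by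
      intro u hu
      have hub : u ≤ b := hu.2.trans hxb
      have hu0 : 0 ≤ u := hz0.trans hu.1
      have hub2 : u^2 ≤ b^2 := by gcongr
      have h1 : ε^2 ≤ 1 - u^2 := by linarith
      have hE := h.energy_le hL (x := u) ⟨hu0, hub.trans hb1⟩
      have hE0 := h.energy_zero_le hL hb hε hbε
      have hq : 0 ≤ L * (b^2 - u^2) * y u ^ 2 :=
        mul_nonneg (mul_nonneg hL.le (by linarith)) (sq_nonneg _)
      rw [norm_div, Real.norm_eq_abs, Real.norm_eq_abs, abs_of_pos (hε2.trans_le h1)]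
      have : |v u| ≤ Real.sqrt (4 / ε^2 * (L * b)) := Real.abs_le_sqrt (by linarith)
      gcongr
    have hmv := (convex_Icc z x).norm_image_sub_le_of_norm_hasDerivWithin_le
      (f := y) (f' := fun u => v u / (1 - u^2)) (fun u hu => (h.hasDerivAt_fst u
        ⟨hz0.trans hu.1, by nlinarith [hu.2]⟩).hasDerivWithinAt) hM
      (left_mem_Icc.2 hc) (right_mem_Icc.2 hc)
    have hxz : ‖x - z‖ ≤ b / k := by
      rw [Real.norm_eq_abs, abs_of_nonneg (by linarith)]
      have : b - z = b / k := by rw [hz]; ring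
      linarith
    have hd : ‖y x - y z‖ ^ 2 ≤ 1 / (b * ε^6) := by
      have e2 : ‖y x - y z‖ ≤ Real.sqrt (4 / ε^2 * (L * b)) / ε^2 * (b / k) := by
        refine hmv.trans ?_
        gcongr
      refine (pow_le_pow_left₀ (norm_nonneg _) e2 2).trans (le_of_eq ?_)
      have hkk : k^2 = 4 * L * b^4 := by
        rw [hk, mul_pow, mul_pow, Real.sq_sqrt hL.le]; ring
      rw [mul_pow, div_pow, div_pow, Real.sq_sqrt (by positivity), hkk]
      field_simp
    rw [Real.norm_eq_abs, sq_abs] at hd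
    have hfin : y x ^ 2 ≤ 2 * y z ^ 2 + 2 * (y x - y z)^2 := by
      nlinarith [sq_nonneg (2 * y z - y x)]
    have e5 : b * (1 / (b * ε^6)) = 1 / ε^6 := by field_simp
    have e6 := mul_le_mul_of_nonneg_left hd hb.le
    rw [e5] at e6
    have e7 := mul_le_mul_of_nonneg_left hfin hb.le
    have e8 : 4 / ε^2 * Real.sqrt k ≤ 4 / ε^6 * Real.sqrt k := by gcongr
    have e9 : 1 / ε^6 ≤ 1 / ε^6 * Real.sqrt k := le_mul_of_one_le_right (by positivity) hsk
    have e10 : 12 / ε^6 * Real.sqrt k =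
          2 * (4 / ε^6 * Real.sqrt k) + 4 * (1 / ε^6 * Real.sqrt k) := by
      ring
    have e11 : 0 ≤ 1 / ε^6 * Real.sqrt k := by positivity
    linarith

/-- The bound near the turning point. -/
theorem mul_sq_le_rpow (h : IsLegendreSolution L b y v) (hL : 0 < L) (hb : 0 < b) (hε : 0 < ε)
    (hbε : b^2 + ε^2 ≤ 1) (hK : 1 ≤ 2 * (Real.sqrt L * b^2)) {x : ℝ} (hx : x ∈ Icc (0:ℝ) 1)
    (hxb : x ≠ b) (hx30 : x ≤ 30 * b) :
    b * y x ^ 2 ≤ 120 / ε^6 * (b / |b - x|) ^ (3/4 : ℝ) := by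
  have hb1 : b ≤ 1 := by nlinarith [sq_nonneg ε]
  have hε1 : ε^2 ≤ 1 := by nlinarith [sq_nonneg b]
  have hε2 : 0 < ε^2 := by positivity
  have hA : 4 / ε^2 ≤ 120 / ε^6 := by
    have : ε^6 ≤ ε^2 := by nlinarith [sq_nonneg (ε^2)]
    gcongr
    norm_num
  rcases lt_or_gt_of_ne hxb with hlt | hgt
  · have hp : 0 < b - x := by linarith
    rw [abs_of_pos hp]
    have e1 := h.sqrt_mul_sq_le hL hb hε hbε ⟨hx.1, hlt⟩
    have hs : 1 ≤ b / (b - x) := by rw [le_div_iff₀ hp]; linarith [hx.1]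
    have e2 : b / Real.sqrt (b^2 - x^2) ≤ (b / (b - x)) ^ (3/4 : ℝ) := by
      calc b / Real.sqrt (b^2 - x^2) ≤ b / Real.sqrt (b * (b - x)) := by
            have : b * (b - x) ≤ b^2 - x^2 := by nlinarith [hx.1]
            have : 0 < b * (b - x) := by positivity
            gcongr
        _ = Real.sqrt (b / (b - x)) := by
            rw [Real.sqrt_mul hb.le, Real.sqrt_div hb.le, ← div_div, Real.div_sqrt]
        _ = (b / (b - x)) ^ (1/2 : ℝ) := Real.sqrt_eq_rpow _
        _ ≤ _ := Real.rpow_le_rpow_of_exponent_le hs (by norm_num)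
    have hr : 0 < Real.sqrt (b^2 - x^2) := Real.sqrt_pos.2 (by nlinarith [hx.1])
    calc b * y x ^ 2 = (Real.sqrt (b^2 - x^2) * y x ^ 2) * (b / Real.sqrt (b^2 - x^2)) := by
          field_simp
      _ ≤ 4 / ε^2 * (b / (b - x)) ^ (3/4 : ℝ) := by gcongr
      _ ≤ _ := by gcongr
  · have hgt' : b < x := hgt
    have hp : 0 < x - b := by linarith
    rw [abs_sub_comm, abs_of_pos hp]
    set s := b / (x - b) with hs
    have hs0 : 0 < s := by positivity
    have hx0 : 0 < x := hb.trans hgt'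
    have hxm : x ∈ Icc b 1 := ⟨hgt'.le, hx.2⟩
    have e1 := h.sq_mul_sqrt_le hL hb hxm
    have e2 := h.sq_antitoneOn hL hb (left_mem_Icc.2 hb1) hxm hgt'.le
    have e3 := h.mul_sq_le_uniform hL hb hε hbε hK (x := b) ⟨hb.le, hb1⟩
    set r := Real.sqrt (x^2 - b^2) with hr
    have hr0 : 0 < r := Real.sqrt_pos.2 (by nlinarith)
    have e4 : (b / r) ≤ s ^ (1/2 : ℝ) := by
      rw [← Real.sqrt_eq_rpow]
      calc b / r ≤ b / Real.sqrt (b * (x - b)) := by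
            have : b * (x - b) ≤ x^2 - b^2 := by nlinarith
            have : 0 < b * (x - b) := by positivity
            rw [hr]
            gcongr
        _ = Real.sqrt s := by
            rw [hs, Real.sqrt_mul hb.le, Real.sqrt_div hb.le, ← div_div, Real.div_sqrt]
    refine le_of_sq_le_sq ?_ (by positivity)
    have e5 : (s ^ (3/4 : ℝ))^2 = (s ^ (1/2 : ℝ))^3 := by
      rw [← Real.rpow_natCast, ← Real.rpow_natCast, ← Real.rpow_mul hs0.le,
        ← Real.rpow_mul hs0.le]
      norm_num
    have e6 : y x ^ 2 * (y x ^ 2 * (2 * Real.sqrt L * r ^ 3 / (3 * x))) ≤ (y b ^ 2)^2 := by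
      rw [sq (y b ^ 2)]
      exact mul_le_mul e2 e1 (by positivity) (sq_nonneg _)
    have e7 : (b * y b ^ 2)^2 ≤ (12 / ε^6)^2 * (2 * (Real.sqrt L * b^2)) := by
      have := pow_le_pow_left₀ (by positivity) e3 2
      rwa [mul_pow (12 / ε^6), Real.sq_sqrt (by positivity)] at this
    have hsL : 0 < Real.sqrt L := Real.sqrt_pos.2 hL
    calc (b * y x ^ 2)^2
        = b^2 * (y x ^ 2 * (y x ^ 2 * (2 * Real.sqrt L * r ^ 3 / (3 * x)))) *
          (3 * x / (2 * Real.sqrt L * r ^ 3)) := by field_simp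
      _ ≤ b^2 * (y b ^ 2)^2 * (3 * x / (2 * Real.sqrt L * r ^ 3)) := by gcongr
      _ = (b * y b ^ 2)^2 * (3 * x / (2 * Real.sqrt L * r ^ 3)) := by ring
      _ ≤ (12 / ε^6)^2 * (2 * (Real.sqrt L * b^2)) *
          (3 * (30 * b) / (2 * Real.sqrt L * r ^ 3)) := by gcongr
      _ = (12 / ε^6)^2 * 90 * (b / r)^3 := by field_simp; ring
      _ ≤ (12 / ε^6)^2 * 100 * (s ^ (1/2 : ℝ))^3 := by gcongr; norm_num
      _ = (120 / ε^6 * s ^ (3/4 : ℝ))^2 := by rw [mul_pow, e5]; ring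

end IsLegendreSolution

open Polynomial in
/-- The Legendre polynomial as a formal polynomial. -/
def legendrePoly (n : ℕ) : ℝ[X] :=
  C ((2:ℝ)^n * (Nat.factorial n : ℝ))⁻¹ * derivative^[n] ((X^2 - 1)^n)

namespace Polynomial

theorem iteratedDeriv_eval (p : ℝ[X]) (m : ℕ) :
    iteratedDeriv m (fun x => p.eval x) = fun x => (derivative^[m] p).eval x := by
  induction m with
  | zero => simp
  | succ m ih =>
    rw [iteratedDeriv_succ, ih]
    funext x
    rw [Polynomial.deriv, Function.iterate_succ_apply']

theorem integral_eval_derivative (p : ℝ[X]) (a c : ℝ) :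
    ∫ x in a..c, (derivative p).eval x = p.eval c - p.eval a :=
  intervalIntegral.integral_eq_sub_of_hasDerivAt (fun x _ => p.hasDerivAt x)
    ((derivative p).continuous.intervalIntegrable _ _)

theorem iterate_derivative_comp_neg_X {p : ℝ[X]} (hp : p.comp (-X) = p) (j : ℕ) :
    (derivative^[j] p).comp (-X) = C ((-1)^j) * derivative^[j] p := by
  induction j with
  | zero => simp [hp]
  | succ j ih =>
    have := congrArg derivative ih
    rw [derivative_comp, derivative_C_mul, ← Function.iterate_succ_apply' (⇑derivative) j p] at this
    simp only [derivative_neg, derivative_X] at this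
    rw [pow_succ, mul_neg_one, C_neg, neg_mul, ← this]
    ring

theorem iterate_derivative_X_sq_sub_one_pow (n j : ℕ) :
    (X^2 - 1) * derivative^[j + 2] ((X^2 - 1 : ℝ[X])^n)
      + (2 * (j + 1 - n) : ℝ[X]) * X * derivative^[j + 1] ((X^2 - 1 : ℝ[X])^n)
      + ((j + 1) * (j - 2 * n) : ℝ[X]) * derivative^[j] ((X^2 - 1 : ℝ[X])^n) = 0 := by
  induction j with
  | zero =>
    have h : (X^2 - 1) * derivative ((X^2 - 1 : ℝ[X])^n) =
        2 * (n : ℝ[X]) * X * (X^2 - 1 : ℝ[X])^n := by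
      rcases n with _ | n
      · simp
      · simp only [derivative_pow_succ, derivative_sub, derivative_X, derivative_one, map_add,
          map_natCast, map_one]
        push_cast
        ring
    have h2 := congrArg derivative h
    simp only [derivative_mul, derivative_sub, derivative_X_pow, derivative_one, derivative_X,
      derivative_natCast, derivative_ofNat] at h2
    simp only [Function.iterate_succ_apply', Function.iterate_zero, id]
    push_cast at h2 ⊢
    simp at h2
    rw [show (C 2 : ℝ[X]) = 2 from map_ofNat C 2] at h2
    linear_combination h2
  | succ j ih =>
    have e : ∀ k, derivative (derivative^[k] ((X^2 - 1 : ℝ[X])^n)) =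
        derivative^[k + 1] ((X^2 - 1 : ℝ[X])^n) :=
      fun k => (Function.iterate_succ_apply' _ _ _).symm
    have h2 := congrArg derivative ih
    simp only [derivative_mul, derivative_add, derivative_sub, derivative_X_pow, derivative_one,
      derivative_X, derivative_natCast, derivative_ofNat, e, derivative_zero, map_ofNat,
      Nat.cast_ofNat] at h2
    rw [show j + 1 + 2 = j + 2 + 1 by ring, show j + 1 + 1 = j + 2 by ring] at *
    push_cast
    linear_combination h2

theorem iterate_derivative_legendrePoly_ode (n m : ℕ) :
    (1 - X^2) * derivative^[m + 2] (legendrePoly n)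
      - (2 * (m + 1) : ℝ[X]) * X * derivative^[m + 1] (legendrePoly n)
      + ((n - m) * (n + m + 1) : ℝ[X]) * derivative^[m] (legendrePoly n) = 0 := by
  have h := iterate_derivative_X_sq_sub_one_pow n (m + n)
  unfold legendrePoly
  simp only [iterate_derivative_C_mul, ← Function.iterate_add_apply]
  rw [show m + 2 + n = m + n + 2 by ring, show m + 1 + n = m + n + 1 by ring]
  push_cast at h
  linear_combination (- C ((2:ℝ)^n * (Nat.factorial n : ℝ))⁻¹) * h

theorem eval_neg_iterate_derivative_legendrePoly (n m : ℕ) (x : ℝ) :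
    (derivative^[m] (legendrePoly n)).eval (-x) =
      (-1)^(n + m) * (derivative^[m] (legendrePoly n)).eval x := by
  have hp : ((X^2 - 1 : ℝ[X])^n).comp (-X) = (X^2 - 1)^n := by simp
  have h := congrArg (eval x) (iterate_derivative_comp_neg_X hp (m + n))
  rw [eval_comp, eval_mul, eval_C, eval_neg, eval_X] at h
  unfold legendrePoly
  rw [iterate_derivative_C_mul, ← Function.iterate_add_apply, eval_mul, eval_mul, h, add_comm n m]
  simp only [eval_C]
  ring

theorem iterate_derivative_legendrePoly_self (n : ℕ) :
    derivative^[n] (legendrePoly n) =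
      C (((2:ℝ)^n * (Nat.factorial n : ℝ))⁻¹ * (Nat.factorial (2 * n) : ℝ)) := by
  have hmon : (X^2 - 1 : ℝ[X]).Monic := by
    simpa using monic_X_pow_sub_C (1:ℝ) two_ne_zero
  have hdeg : ((X^2 - 1 : ℝ[X])^n).natDegree = 2 * n := by
    rw [hmon.natDegree_pow]
    have : (X^2 - 1 : ℝ[X]).natDegree = 2 := by
      simpa using natDegree_X_pow_sub_C (n := 2) (r := (1:ℝ))
    rw [this, mul_comm]
  have h0 : (derivative^[2 * n] ((X^2 - 1 : ℝ[X])^n)).natDegree ≤ 0 := by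
    have := natDegree_iterate_derivative ((X^2 - 1 : ℝ[X])^n) (2 * n)
    rwa [hdeg, Nat.sub_self] at this
  have h1 : (derivative^[2 * n] ((X^2 - 1 : ℝ[X])^n)) = C (Nat.factorial (2 * n) : ℝ) := by
    rw [eq_C_of_natDegree_le_zero h0, coeff_iterate_derivative, zero_add, Nat.descFactorial_self]
    have : ((X^2 - 1 : ℝ[X])^n).coeff (2 * n) = 1 := by
      have := (hmon.pow n).coeff_natDegree
      rwa [hdeg] at this
    rw [this]
    simp
  unfold legendrePoly
  rw [iterate_derivative_C_mul, ← Function.iterate_add_apply, ← two_mul, h1, C_mul]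

theorem integral_one_sub_sq_pow_mul_sq_succ (n m : ℕ) :
    ∫ x in (-1:ℝ)..1, (1 - x^2)^(m + 1) * ((derivative^[m + 1] (legendrePoly n)).eval x)^2 =
      ((n - m) * (n + m + 1) : ℝ) *
        ∫ x in (-1:ℝ)..1, (1 - x^2)^m * ((derivative^[m] (legendrePoly n)).eval x)^2 := by
  set W := derivative^[m] (legendrePoly n) with hW
  have hode := iterate_derivative_legendrePoly_ode n m
  rw [show m + 2 = m + 1 + 1 by ring] at hode
  simp only [Function.iterate_succ_apply', ← hW] at hode ⊢
  have hF := integral_eval_derivative ((1 - X^2)^(m + 1) * W * derivative W) (-1) 1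
  have hd : derivative ((1 - X^2)^(m + 1) * W * derivative W) =
      (1 - X^2)^(m + 1) * (derivative W)^2 - ((n - m) * (n + m + 1) : ℝ[X]) *
        ((1 - X^2)^m * W^2) := by
    simp only [derivative_mul, derivative_pow_succ, derivative_sub, derivative_one, derivative_X]
    simp only [map_add, map_natCast, map_one]
    linear_combination ((1 - X^2)^m * W) * hode
  rw [hd] at hF
  simp only [eval_sub, eval_mul, eval_pow, eval_one, eval_X, eval_add, eval_natCast] at hF
  rw [intervalIntegral.integral_sub, intervalIntegral.integral_const_mul] at hF
  · simp at hF
    linarith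
  · exact (by fun_prop : Continuous _).intervalIntegrable _ _
  · exact (by fun_prop : Continuous _).intervalIntegrable _ _

theorem integral_one_sub_sq_pow_succ (n : ℕ) :
    (2 * (n:ℝ) + 3) * ∫ x in (-1:ℝ)..1, (1 - x^2)^(n + 1) =
      (2 * (n:ℝ) + 2) * ∫ x in (-1:ℝ)..1, (1 - x^2)^n := by
  have hF := integral_eval_derivative (X * (1 - X^2)^(n + 1)) (-1) 1
  have hd : derivative (X * (1 - X^2)^(n + 1) : ℝ[X]) =
      (2 * (n:ℝ[X]) + 3) * (1 - X^2)^(n + 1) - (2 * (n:ℝ[X]) + 2) * (1 - X^2)^n := by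
    simp only [derivative_mul, derivative_pow_succ, derivative_sub, derivative_one, derivative_X]
    simp only [map_add, map_natCast, map_one]
    ring
  rw [hd] at hF
  simp only [eval_sub, eval_mul, eval_pow, eval_one, eval_X, eval_add, eval_natCast,
    eval_ofNat] at hF
  rw [intervalIntegral.integral_sub, intervalIntegral.integral_const_mul,
    intervalIntegral.integral_const_mul] at hF
  · simp at hF
    linarith
  · exact (by fun_prop : Continuous _).intervalIntegrable _ _
  · exact (by fun_prop : Continuous _).intervalIntegrable _ _

theorem integral_one_sub_sq_pow (n : ℕ) :
    ∫ x in (-1:ℝ)..1, (1 - x^2)^n =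
      2 * (2^n * (Nat.factorial n : ℝ))^2 / (Nat.factorial (2 * n + 1) : ℝ) := by
  induction n with
  | zero => norm_num
  | succ n ih =>
    have h := integral_one_sub_sq_pow_succ n
    rw [ih] at h
    have e : (2 * n + 3 : ℝ) ≠ 0 := by positivity
    rw [show 2 * (n + 1) + 1 = 2 * n + 1 + 1 + 1 by ring]
    refine mul_left_cancel₀ e (h.trans ?_)
    simp only [Nat.factorial_succ (2 * n + 1 + 1), Nat.factorial_succ (2 * n + 1),
      Nat.factorial_succ n]
    push_cast
    field_simp
    ring

theorem integral_one_sub_sq_pow_mul_sq {n m : ℕ} (hm : m ≤ n) :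
    ∫ x in (-1:ℝ)..1, (1 - x^2)^m * ((derivative^[m] (legendrePoly n)).eval x)^2 =
      2 / (2 * n + 1) * ((Nat.factorial (n + m) : ℝ) / (Nat.factorial (n - m) : ℝ)) := by
  induction hm using Nat.decreasingInduction with
  | self =>
    rw [iterate_derivative_legendrePoly_self]
    simp only [eval_C]
    rw [intervalIntegral.integral_mul_const, integral_one_sub_sq_pow, Nat.factorial_succ,
      ← two_mul]
    simp
    field_simp
  | of_succ m hm ih =>
    rw [integral_one_sub_sq_pow_mul_sq_succ] at ih
    have hnm : (0:ℝ) < n - m := by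
      have : (m:ℝ) < n := by exact_mod_cast hm
      linarith
    have e : ((n - m) * (n + m + 1) : ℝ) ≠ 0 := by positivity
    refine mul_left_cancel₀ e (ih.trans ?_)
    obtain ⟨k, rfl⟩ : ∃ k, n = m + 1 + k := ⟨n - (m + 1), by omega⟩
    rw [show m + 1 + k - (m + 1) = k by omega, show m + 1 + k - m = k + 1 by omega,
      show m + 1 + k + (m + 1) = m + 1 + k + m + 1 by ring, Nat.factorial_succ (m + 1 + k + m),
      Nat.factorial_succ k]
    push_cast
    field_simp
    ring

end Polynomial

theorem legendreP_eq_s16 (n : ℕ) : legendreP n = fun x => (legendrePoly n).eval x := by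
  funext x
  have h := congrFun (Polynomial.iteratedDeriv_eval ((Polynomial.X^2 - 1)^n) n) x
  simp only [Polynomial.eval_pow, Polynomial.eval_sub, Polynomial.eval_X,
    Polynomial.eval_one] at h
  rw [legendreP, h, legendrePoly, Polynomial.eval_mul, Polynomial.eval_C]

/-- The squared normalizing factor of the spherical harmonics. -/
def normSq (n m : ℕ) : ℝ :=
  (2 * (n:ℝ) + 1) / (4 * Real.pi) *
    ((Nat.factorial (n - m) : ℝ) / (Nat.factorial (n + m) : ℝ))

theorem normSq_nonneg (n m : ℕ) : 0 ≤ normSq n m := by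
  unfold normSq; positivity

theorem tY_sq_s16 {n : ℕ} {m : ℤ} (hm : m.natAbs ≤ n) (x : ℝ) :
    tY n m x ^ 2 = (Real.sqrt (normSq n m.natAbs) * Real.sqrt (1 - x^2) ^ m.natAbs *
      (Polynomial.derivative^[m.natAbs] (legendrePoly n)).eval x) ^ 2 := by
  have hA : assocP n m.natAbs x ^ 2 = (Real.sqrt (1 - x^2) ^ m.natAbs *
      (Polynomial.derivative^[m.natAbs] (legendrePoly n)).eval x) ^ 2 := by
    rw [assocP, legendreP_eq_s16, Polynomial.iteratedDeriv_eval, mul_assoc, mul_pow, ← pow_mul,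
      mul_comm m.natAbs 2, pow_mul]
    simp
  rw [mul_assoc, mul_pow, Real.sq_sqrt (normSq_nonneg _ _), ← hA, tY, mul_pow,
    Real.sq_sqrt (by positivity), assocPZ, normSq]
  rcases le_or_gt 0 m with h0 | h0
  · rw [if_pos h0, show ((n:ℤ) - m).toNat = n - m.natAbs by omega,
      show ((n:ℤ) + m).toNat = n + m.natAbs by omega, show m.toNat = m.natAbs by omega]
  · rw [if_neg (not_le.2 h0), show ((n:ℤ) - m).toNat = n + m.natAbs by omega,
      show ((n:ℤ) + m).toNat = n - m.natAbs by omega, mul_pow, mul_pow, ← pow_mul,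
      mul_comm m.natAbs 2, pow_mul]
    simp
    field_simp

theorem tY_neg_sq {n : ℕ} {m : ℤ} (hm : m.natAbs ≤ n) (x : ℝ) :
    tY n m (-x) ^ 2 = tY n m x ^ 2 := by
  rw [tY_sq_s16 hm, tY_sq_s16 hm, neg_sq, Polynomial.eval_neg_iterate_derivative_legendrePoly, mul_pow,
    mul_pow]
  rcases neg_one_pow_eq_or ℝ (n + m.natAbs) with h | h <;> rw [h] <;> ring

theorem exists_isLegendreSolution {n M : ℕ} (hM : 1 ≤ M) (hMn : M ≤ n) {L b : ℝ}
    (hL : L = n * (n + 1)) (hb : L * b^2 = L - M^2) :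
    ∃ v, IsLegendreSolution L b (fun x => Real.sqrt (normSq n M) * Real.sqrt (1 - x^2) ^ M *
      (Polynomial.derivative^[M] (legendrePoly n)).eval x) v := by
  set W := Polynomial.derivative^[M] (legendrePoly n) with hW
  have hode := Polynomial.iterate_derivative_legendrePoly_ode n M
  rw [show M + 2 = M + 1 + 1 by ring] at hode
  simp only [Function.iterate_succ_apply', ← hW] at hode
  have hode' : ∀ x : ℝ, (1 - x^2) * (Polynomial.derivative (Polynomial.derivative W)).eval x =
      2 * (M + 1) * x * (Polynomial.derivative W).eval x - (n - M) * (n + M + 1) * W.eval x := by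
    intro x
    have := congrArg (Polynomial.eval x) hode
    simp at this
    linarith
  have hs : ∀ x ∈ Ico (0:ℝ) 1, HasDerivAt (fun x => Real.sqrt (1 - x^2) ^ M)
      (-(M * x) * Real.sqrt (1 - x^2) ^ M / (1 - x^2)) x := by
    intro x hx
    have h1 : 0 < 1 - x^2 := by nlinarith [hx.1, hx.2]
    have d2 : HasDerivAt (fun x : ℝ => x^2) (2 * x) x := by simpa using hasDerivAt_pow 2 x
    refine (((d2.const_sub 1).sqrt h1.ne').pow M).congr_deriv ?_
    obtain ⟨j, rfl⟩ : ∃ j, M = j + 1 := ⟨M - 1, by omega⟩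
    have hr : 0 < Real.sqrt (1 - x^2) := Real.sqrt_pos.2 h1
    have hrr : Real.sqrt (1 - x^2) ^ 2 = 1 - x^2 := Real.sq_sqrt h1.le
    generalize Real.sqrt (1 - x^2) = r at *
    rw [← hrr]
    simp
    field_simp
    ring
  have hM0 : M ≠ 0 := by omega
  refine ⟨fun x => Real.sqrt (normSq n M) * Real.sqrt (1 - x^2) ^ M *
    (-(M * x) * W.eval x + (1 - x^2) * (Polynomial.derivative W).eval x), ?_, ?_, ?_, ?_, ?_, ?_,
    ?_, ?_⟩
  · fun_prop
  · fun_prop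
  · intro x hx
    have h1 : 0 < 1 - x^2 := by nlinarith [hx.1, hx.2]
    refine (((hs x hx).const_mul (Real.sqrt (normSq n M))).mul (W.hasDerivAt x)).congr_deriv ?_
    field_simp
  · intro x hx
    have h1 : 0 < 1 - x^2 := by nlinarith [hx.1, hx.2]
    have d2 : HasDerivAt (fun x : ℝ => x^2) (2 * x) x := by simpa using hasDerivAt_pow 2 x
    refine (((hs x hx).const_mul (Real.sqrt (normSq n M))).mul
      (((((hasDerivAt_id x).const_mul (M:ℝ)).neg).mul (W.hasDerivAt x)).add
        ((d2.const_sub 1).mul ((Polynomial.derivative W).hasDerivAt x)))).congr_deriv ?_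
    have ho := hode' x
    have hLx : L * (b^2 - x^2) = L - M^2 - L * x^2 := by rw [mul_sub, hb]
    rw [hLx, hL]
    simp only [Pi.neg_apply, id]
    generalize Real.sqrt (1 - x^2) ^ M = s
    simp
    field_simp
    linear_combination Real.sqrt (normSq n M) * s * (1 - x^2) * ho
  · simp [hM0]
  · simp [hM0]
  · have e0 := Polynomial.eval_neg_iterate_derivative_legendrePoly n M 0
    have e1 := Polynomial.eval_neg_iterate_derivative_legendrePoly n (M + 1) 0
    rw [Function.iterate_succ_apply', ← add_assoc, pow_succ] at e1
    rw [← hW] at e0 e1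
    rw [neg_zero] at e0 e1
    have hz : W.eval 0 * (Polynomial.derivative W).eval 0 = 0 := by
      rcases neg_one_pow_eq_or ℝ (n + M) with h | h <;> rw [h] at e0 e1
      · have : (Polynomial.derivative W).eval 0 = 0 := by linarith
        rw [this, mul_zero]
      · have : W.eval 0 = 0 := by linarith
        rw [this, zero_mul]
    simp
    rcases mul_eq_zero.1 hz with h | h
    · exact Or.inl (Or.inr h)
    · exact Or.inr (Or.inr h)
  · have hc : Continuous fun x => (Real.sqrt (normSq n M) * Real.sqrt (1 - x^2) ^ M *
        W.eval x)^2 := by fun_prop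
    have h1 : ∫ x in (0:ℝ)..1, (Real.sqrt (normSq n M) * Real.sqrt (1 - x^2) ^ M * W.eval x)^2 ≤
        ∫ x in (-1:ℝ)..1, (Real.sqrt (normSq n M) * Real.sqrt (1 - x^2) ^ M * W.eval x)^2 :=
      intervalIntegral.integral_mono_interval (by norm_num) zero_le_one le_rfl
        (Filter.Eventually.of_forall fun x => sq_nonneg _) (hc.intervalIntegrable _ _)
    have h2 : ∫ x in (-1:ℝ)..1, (Real.sqrt (normSq n M) * Real.sqrt (1 - x^2) ^ M * W.eval x)^2 =
        normSq n M * ∫ x in (-1:ℝ)..1, (1 - x^2)^M * (W.eval x)^2 := by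
      rw [← intervalIntegral.integral_const_mul]
      refine intervalIntegral.integral_congr fun x hx => ?_
      rw [uIcc_of_le (by norm_num)] at hx
      have h1 : 0 ≤ 1 - x^2 := by nlinarith [hx.1, hx.2]
      rw [mul_pow, mul_pow, Real.sq_sqrt (normSq_nonneg _ _), ← pow_mul, mul_comm M 2, pow_mul,
        Real.sq_sqrt h1]
      ring
    refine h1.trans ?_
    rw [h2, hW, Polynomial.integral_one_sub_sq_pow_mul_sq hMn, normSq]
    have h3 : (2 * (n:ℝ) + 1) / (4 * Real.pi) *
        ((Nat.factorial (n - M) : ℝ) / (Nat.factorial (n + M) : ℝ)) * (2 / (2 * n + 1) *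
        ((Nat.factorial (n + M) : ℝ) / (Nat.factorial (n - M) : ℝ))) = 1 / (2 * Real.pi) := by
      field_simp
      norm_num
    rw [h3, div_le_one (by positivity)]
    linarith [Real.pi_gt_three]

theorem rpow_neg_le_sub {p y : ℝ} (hp : 0 < p) (hp1 : p ≤ 1) (hy : 1 < y) :
    y ^ (-(p + 1)) ≤ ((y - 1) ^ (-p) - y ^ (-p)) / p := by
  have hy0 : 0 < y := by linarith
  have h1 : (1 + -(1 / y)) ^ p ≤ 1 + p * -(1 / y) :=
    rpow_one_add_le_one_add_mul_self (by rw [neg_le_neg_iff, div_le_one hy0]; exact hy.le)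
      hp.le hp1
  have e : y - 1 = y * (1 + -(1 / y)) := by field_simp; ring
  have hz : 0 < 1 + -(1 / y) := by
    have : 1 / y < 1 := by rw [div_lt_one hy0]; exact hy
    linarith
  have h2 : (1 + p * (1 / y)) * (1 + -(1 / y)) ^ p ≤ 1 := by
    have : 0 ≤ 1 + p * (1 / y) := by positivity
    nlinarith [mul_le_mul_of_nonneg_left h1 this, sq_nonneg (p * (1 / y))]
  have hzp : 0 < (1 + -(1 / y)) ^ p := Real.rpow_pos_of_pos hz p
  have h3 : 1 + p * (1 / y) ≤ (1 + -(1 / y)) ^ (-p) := by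
    rw [Real.rpow_neg hz.le, ← one_div, le_div_iff₀ hzp]
    exact h2
  have hyp : 0 < y ^ (-p) := Real.rpow_pos_of_pos hy0 _
  rw [le_div_iff₀ hp, e, Real.mul_rpow hy0.le hz.le, neg_add, Real.rpow_add hy0, Real.rpow_neg_one,
    ← one_div]
  nlinarith [mul_le_mul_of_nonneg_left h3 hyp.le]

theorem sum_rpow_neg_le {p A : ℝ} (hp : 0 < p) (hp1 : p ≤ 1) (hA : 1 ≤ A) (N : ℕ) :
    ∑ k ∈ Finset.range N, ((k:ℝ) + 1 / 2 + A) ^ (-(p + 1)) ≤ 2 / p * A ^ (-p) := by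
  have h : ∀ k ∈ Finset.range N, ((k:ℝ) + 1 / 2 + A) ^ (-(p + 1)) ≤
      ((k:ℝ) + (A - 1 / 2)) ^ (-p) / p - (((k + 1 : ℕ):ℝ) + (A - 1 / 2)) ^ (-p) / p := by
    intro k _
    have h0 : (0:ℝ) ≤ k := k.cast_nonneg
    have := rpow_neg_le_sub hp hp1 (y := (k:ℝ) + 1 / 2 + A) (by linarith)
    rw [sub_div, show (k:ℝ) + 1 / 2 + A - 1 = k + (A - 1 / 2) by ring] at this
    rwa [show ((k + 1 : ℕ):ℝ) + (A - 1 / 2) = k + 1 / 2 + A by push_cast; ring]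
  refine (Finset.sum_le_sum h).trans ?_
  rw [Finset.sum_range_sub' (fun k : ℕ => ((k:ℝ) + (A - 1 / 2)) ^ (-p) / p)]
  have h1 : 0 ≤ ((N:ℝ) + (A - 1 / 2)) ^ (-p) / p := by
    have : (0:ℝ) ≤ N + (A - 1 / 2) := by have : (0:ℝ) ≤ N := N.cast_nonneg; linarith
    positivity
  have h2 : (((0 : ℕ):ℝ) + (A - 1 / 2)) ^ (-p) ≤ 2 * A ^ (-p) := by
    have h3 : (((0 : ℕ):ℝ) + (A - 1 / 2)) ^ (-p) ≤ (2⁻¹ * A) ^ (-p) :=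
      Real.rpow_le_rpow_of_nonpos (by linarith) (by push_cast; linarith) (by linarith)
    refine h3.trans ?_
    rw [Real.mul_rpow (by norm_num) (by linarith), Real.rpow_neg (by norm_num),
      ← Real.inv_rpow (by norm_num), inv_inv]
    gcongr
    calc (2:ℝ) ^ p ≤ 2 ^ (1:ℝ) := Real.rpow_le_rpow_of_exponent_le (by norm_num) hp1
      _ = 2 := Real.rpow_one 2
  calc _ ≤ (((0 : ℕ):ℝ) + (A - 1 / 2)) ^ (-p) / p := by linarith
    _ ≤ 2 * A ^ (-p) / p := by gcongr
    _ = _ := by ring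

theorem rpow_neg_three_quarters_le {t : ℝ} (ht : 0 ≤ t) :
    (t + 1) ^ (-(3 / 4) : ℝ) ≤ 4 * ((t + 1) ^ (1 / 4 : ℝ) - t ^ (1 / 4 : ℝ)) := by
  have ha : 0 < (t + 1) ^ (1 / 4 : ℝ) := by positivity
  have hc : 0 ≤ t ^ (1 / 4 : ℝ) := by positivity
  have hac : t ^ (1 / 4 : ℝ) ≤ (t + 1) ^ (1 / 4 : ℝ) :=
    Real.rpow_le_rpow ht (by linarith) (by norm_num)
  have ha4 : ((t + 1) ^ (1 / 4 : ℝ)) ^ 4 = t + 1 := by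
    rw [← Real.rpow_natCast, ← Real.rpow_mul (by linarith)]; norm_num
  have hc4 : (t ^ (1 / 4 : ℝ)) ^ 4 = t := by
    rw [← Real.rpow_natCast, ← Real.rpow_mul ht]; norm_num
  have ha3 : (t + 1) ^ (-(3 / 4) : ℝ) = (((t + 1) ^ (1 / 4 : ℝ)) ^ 3)⁻¹ := by
    rw [Real.rpow_neg (by linarith), ← Real.rpow_natCast, ← Real.rpow_mul (by linarith)]; norm_num
  rw [ha3]
  generalize (t + 1) ^ (1 / 4 : ℝ) = a at *
  generalize t ^ (1 / 4 : ℝ) = c at *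
  rw [inv_le_iff_one_le_mul₀ (by positivity)]
  have h2 : c ^ 2 ≤ a ^ 2 := by gcongr
  have h3 : c ^ 3 ≤ a ^ 3 := by gcongr
  have h4 : a ^ 2 * c ≤ a ^ 3 := by nlinarith [sq_nonneg a]
  have h5 : a * c ^ 2 ≤ a ^ 3 := by nlinarith
  nlinarith [mul_nonneg (sub_nonneg.2 hac) (show 0 ≤ 3 * a ^ 3 - a ^ 2 * c - a * c ^ 2 - c ^ 3 by
    linarith)]

/-- The odd extension of the fourth root. -/
def signedFourthRoot (t : ℝ) : ℝ := if 0 ≤ t then t ^ (1 / 4 : ℝ) else -(-t) ^ (1 / 4 : ℝ)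

theorem abs_signedFourthRoot (t : ℝ) : |signedFourthRoot t| = |t| ^ (1 / 4 : ℝ) := by
  unfold signedFourthRoot
  split_ifs with h
  · rw [abs_of_nonneg h, abs_of_nonneg (by positivity)]
  · have : 0 ≤ -t := by linarith
    rw [abs_of_neg (not_le.1 h), abs_neg, abs_of_nonneg (by positivity)]

theorem one_add_abs_rpow_le_sub (t : ℝ) :
    (1 + |t|) ^ (-(3 / 4) : ℝ) ≤ 4 * (signedFourthRoot (t + 1) - signedFourthRoot t) := by
  unfold signedFourthRoot
  rcases le_or_gt 0 t with h | h
  · rw [if_pos h, if_pos (by linarith), abs_of_nonneg h, add_comm]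
    exact rpow_neg_three_quarters_le h
  rw [if_neg (not_le.2 h), abs_of_neg h]
  rcases le_or_gt 0 (t + 1) with h1 | h1
  · rw [if_pos h1]
    have e1 : t + 1 ≤ (t + 1) ^ (1 / 4 : ℝ) := by
      simpa using Real.rpow_le_rpow_of_exponent_ge' h1 (by linarith) (by norm_num)
        (show (1 / 4 : ℝ) ≤ 1 by norm_num)
    have e2 : -t ≤ (-t) ^ (1 / 4 : ℝ) := by
      simpa using Real.rpow_le_rpow_of_exponent_ge' (by linarith : 0 ≤ -t) (by linarith)
        (by norm_num) (show (1 / 4 : ℝ) ≤ 1 by norm_num)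
    have e3 : (1 + -t) ^ (-(3 / 4) : ℝ) ≤ 1 :=
      Real.rpow_le_one_of_one_le_of_nonpos (by linarith) (by norm_num)
    linarith
  · rw [if_neg (not_le.2 h1)]
    have e1 := rpow_neg_three_quarters_le (t := -(t + 1)) (by linarith)
    rw [show -(t + 1) + 1 = -t by ring] at e1
    have e2 : (1 + -t) ^ (-(3 / 4) : ℝ) ≤ (-t) ^ (-(3 / 4) : ℝ) :=
      Real.rpow_le_rpow_of_nonpos (by linarith) (by linarith) (by norm_num)
    linarith

theorem sum_one_add_abs_rpow_le {w : ℝ} (hw : 1 / 4 ≤ w) {s : Finset ℕ}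
    (hs : ∀ k ∈ s, (k:ℝ) + 1 / 2 ≤ 2 * w) :
    ∑ k ∈ s, (1 + |(k:ℝ) + 1 / 2 - w|) ^ (-(3 / 4) : ℝ) ≤ 16 * w ^ (1 / 4 : ℝ) := by
  set K := ⌊2 * w⌋₊ + 1 with hK
  have hsub : s ⊆ Finset.range K := by
    intro k hk
    rw [Finset.mem_range, hK, Nat.lt_succ_iff]
    exact Nat.le_floor (by linarith [hs k hk])
  have hKw : (K:ℝ) ≤ 2 * w + 1 := by
    rw [hK]; push_cast; linarith [Nat.floor_le (show 0 ≤ 2 * w by linarith)]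
  have hK0 : 2 * w ≤ K := by
    rw [hK]; push_cast; exact (Nat.lt_floor_add_one _).le
  refine (Finset.sum_le_sum_of_subset_of_nonneg hsub fun k _ _ => by positivity).trans ?_
  have h : ∀ k ∈ Finset.range K, (1 + |(k:ℝ) + 1 / 2 - w|) ^ (-(3 / 4) : ℝ) ≤
      4 * signedFourthRoot (((k + 1 : ℕ):ℝ) + 1 / 2 - w) -
        4 * signedFourthRoot ((k:ℝ) + 1 / 2 - w) := by
    intro k _
    have := one_add_abs_rpow_le_sub ((k:ℝ) + 1 / 2 - w)
    rw [show (k:ℝ) + 1 / 2 - w + 1 = ((k + 1 : ℕ):ℝ) + 1 / 2 - w by push_cast; ring] at this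
    linarith
  refine (Finset.sum_le_sum h).trans ?_
  rw [Finset.sum_range_sub (fun k : ℕ => 4 * signedFourthRoot ((k:ℝ) + 1 / 2 - w))]
  have key : ∀ t : ℝ, |t| ≤ 16 * w → |signedFourthRoot t| ≤ 2 * w ^ (1 / 4 : ℝ) := by
    intro t ht
    rw [abs_signedFourthRoot]
    refine (Real.rpow_le_rpow (abs_nonneg t) ht (by norm_num)).trans_eq ?_
    rw [Real.mul_rpow (by norm_num) (by linarith), show (16:ℝ) = 2 ^ (4:ℝ) by norm_num,
      ← Real.rpow_mul (by norm_num)]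
    norm_num
  have h1 := (abs_le.1 (key ((K:ℝ) + 1 / 2 - w) (by rw [abs_le]; constructor <;> linarith))).2
  have h2 := (abs_le.1 (key (((0:ℕ):ℝ) + 1 / 2 - w)
    (by rw [abs_le]; constructor <;> push_cast <;> linarith))).1
  linarith

/-- The size of the `κ`-th normalized Hermite function at the rescaled point `w`. -/
def hermiteProfile (w κ : ℝ) : ℝ :=
  if 6 * κ ≤ w then κ ^ 2 / w ^ 2 else (κ / (1 + |κ - w|)) ^ (3 / 4 : ℝ)

theorem hermiteProfile_nonneg {w κ : ℝ} (hκ : 0 ≤ κ) : 0 ≤ hermiteProfile w κ := by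
  unfold hermiteProfile
  split_ifs <;> positivity

theorem rpow_mul_hermiteProfile_le_of_le {α w κ : ℝ} (hα : 0 ≤ α) (hα1 : α < 1 / 2)
    (hκ : 1 / 2 ≤ κ) (hκw : κ ≤ 2 * w) :
    κ ^ (2 * α - 2) * hermiteProfile w κ ≤
      36 * w ^ (2 * α - 5 / 4) * (1 + |κ - w|) ^ (-(3 / 4) : ℝ) := by
  have hκ0 : 0 < κ := by linarith
  have hw0 : 0 < w := by linarith
  have ht : 0 < 1 + |κ - w| := by positivity
  unfold hermiteProfile
  split_ifs with h
  · have e1 : κ ^ (2 * α - 2) * (κ ^ 2 / w ^ 2) = κ ^ (2 * α) * w ^ (-2 : ℝ) := by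
      rw [Real.rpow_sub hκ0, Real.rpow_neg hw0.le]
      norm_num
      field_simp
    have e2 : κ ^ (2 * α) ≤ w ^ (2 * α) :=
      Real.rpow_le_rpow hκ0.le (by linarith) (by linarith)
    have e3 : w ^ (-(3 / 4) : ℝ) ≤ 2 * (1 + |κ - w|) ^ (-(3 / 4) : ℝ) := by
      have h1 : 1 + |κ - w| ≤ 2 * w := by rw [abs_of_nonpos (by linarith)]; linarith
      have h2 : (2 * w) ^ (-(3 / 4) : ℝ) ≤ (1 + |κ - w|) ^ (-(3 / 4) : ℝ) :=
        Real.rpow_le_rpow_of_nonpos ht h1 (by norm_num)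
      rw [Real.mul_rpow (by norm_num) hw0.le] at h2
      have h3 : (2:ℝ)⁻¹ ≤ 2 ^ (-(3 / 4) : ℝ) := by
        rw [← Real.rpow_neg_one]
        exact Real.rpow_le_rpow_of_exponent_le (by norm_num) (by norm_num)
      have h4 : 0 < w ^ (-(3 / 4) : ℝ) := by positivity
      nlinarith
    calc κ ^ (2 * α - 2) * (κ ^ 2 / w ^ 2) ≤ w ^ (2 * α) * w ^ (-2 : ℝ) := by rw [e1]; gcongr
      _ = w ^ (2 * α - 5 / 4) * w ^ (-(3 / 4) : ℝ) := by
        rw [← Real.rpow_add hw0, ← Real.rpow_add hw0]; ring_nf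
      _ ≤ w ^ (2 * α - 5 / 4) * (2 * (1 + |κ - w|) ^ (-(3 / 4) : ℝ)) := by gcongr
      _ ≤ _ := by
        have : 0 ≤ w ^ (2 * α - 5 / 4) * (1 + |κ - w|) ^ (-(3 / 4) : ℝ) := by positivity
        linarith
  · have e1 : κ ^ (2 * α - 2) * (κ / (1 + |κ - w|)) ^ (3 / 4 : ℝ) =
        κ ^ (2 * α - 5 / 4) * (1 + |κ - w|) ^ (-(3 / 4) : ℝ) := by
      rw [Real.div_rpow hκ0.le ht.le, Real.rpow_neg ht.le, div_eq_mul_inv, ← mul_assoc,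
        ← Real.rpow_add hκ0]
      ring_nf
    have e2 : κ ^ (2 * α - 5 / 4) ≤ 36 * w ^ (2 * α - 5 / 4) := by
      have h1 : κ ^ (2 * α - 5 / 4) ≤ (6⁻¹ * w) ^ (2 * α - 5 / 4) :=
        Real.rpow_le_rpow_of_nonpos (by positivity) (by linarith) (by linarith)
      refine h1.trans ?_
      rw [Real.mul_rpow (by norm_num) hw0.le]
      gcongr
      calc (6⁻¹ : ℝ) ^ (2 * α - 5 / 4) ≤ 6⁻¹ ^ (-2 : ℝ) :=
          Real.rpow_le_rpow_of_exponent_ge (by norm_num) (by norm_num) (by linarith)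
        _ = 36 := by rw [Real.rpow_neg (by norm_num)]; norm_num
    rw [e1]
    gcongr

theorem rpow_mul_hermiteProfile_le_of_ge {α w κ : ℝ} (hα : 0 ≤ α) (hα1 : α < 1 / 2)
    (hw : 0 ≤ w) (hκ : 1 / 2 ≤ κ) (hκw : 2 * w < κ) :
    κ ^ (2 * α - 2) * hermiteProfile w κ ≤ 18 * (κ + max 1 w) ^ (2 * α - 2) := by
  have hκ0 : 0 < κ := by linarith
  have ht : 0 < 1 + |κ - w| := by positivity
  have hG : hermiteProfile w κ ≤ 2 := by
    unfold hermiteProfile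
    rw [if_neg (by linarith)]
    have h1 : κ / (1 + |κ - w|) ≤ 2 := by
      rw [div_le_iff₀ ht, abs_of_nonneg (by linarith)]; linarith
    calc (κ / (1 + |κ - w|)) ^ (3 / 4 : ℝ) ≤ 2 ^ (3 / 4 : ℝ) :=
        Real.rpow_le_rpow (by positivity) h1 (by norm_num)
      _ ≤ 2 ^ (1 : ℝ) := Real.rpow_le_rpow_of_exponent_le (by norm_num) (by norm_num)
      _ = 2 := Real.rpow_one 2
  have hM : κ + max 1 w ≤ 3 * κ := by
    have : max 1 w ≤ 2 * κ := max_le (by linarith) (by linarith)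
    linarith
  have hM0 : 0 < κ + max 1 w := by positivity
  have h2 : (3 * κ) ^ (2 * α - 2) ≤ (κ + max 1 w) ^ (2 * α - 2) :=
    Real.rpow_le_rpow_of_nonpos hM0 hM (by linarith)
  rw [Real.mul_rpow (by norm_num) hκ0.le] at h2
  have h3 : (9:ℝ)⁻¹ ≤ 3 ^ (2 * α - 2) := by
    calc (9:ℝ)⁻¹ = 3 ^ (-2 : ℝ) := by rw [Real.rpow_neg (by norm_num)]; norm_num
      _ ≤ _ := Real.rpow_le_rpow_of_exponent_le (by norm_num) (by linarith)
  have h4 : 0 < κ ^ (2 * α - 2) := by positivity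
  nlinarith [mul_le_mul_of_nonneg_left hG h4.le]

theorem sum_rpow_mul_hermiteProfile_le {α : ℝ} (hα : 0 ≤ α) (hα1 : α < 1 / 2) {w : ℝ}
    (hw : 0 ≤ w) (N : ℕ) :
    ∑ k ∈ Finset.range N, ((k:ℝ) + 1 / 2) ^ (2 * α - 2) * hermiteProfile w ((k:ℝ) + 1 / 2) ≤
      (2400 + 36 / (1 - 2 * α)) * max 1 w ^ (2 * α - 1) := by
  rw [← Finset.sum_filter_add_sum_filter_not _ (fun k : ℕ => (k:ℝ) + 1 / 2 ≤ 2 * w), add_mul]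
  have hk : ∀ k : ℕ, (1 / 2 : ℝ) ≤ (k:ℝ) + 1 / 2 := fun k => by
    have : (0:ℝ) ≤ k := k.cast_nonneg
    linarith
  refine add_le_add ?_ ?_
  · rcases lt_or_ge w (1 / 4) with h | h
    · rw [Finset.sum_eq_zero]
      · positivity
      · intro k hk'
        linarith [(Finset.mem_filter.1 hk').2, hk k]
    · refine (Finset.sum_le_sum fun k hk' => rpow_mul_hermiteProfile_le_of_le hα hα1 (hk k)
        (Finset.mem_filter.1 hk').2).trans ?_
      rw [← Finset.mul_sum]
      have h1 := sum_one_add_abs_rpow_le h (s := (Finset.range N).filter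
        (fun k : ℕ => (k:ℝ) + 1 / 2 ≤ 2 * w)) fun k hk' => (Finset.mem_filter.1 hk').2
      have hw0 : 0 < w := by linarith
      calc _ ≤ 36 * w ^ (2 * α - 5 / 4) * (16 * w ^ (1 / 4 : ℝ)) := by gcongr
        _ = 576 * w ^ (2 * α - 1) := by
          rw [show 2 * α - 1 = (2 * α - 5 / 4) + 1 / 4 by ring, Real.rpow_add hw0]; ring
        _ ≤ 576 * (4⁻¹ * max 1 w) ^ (2 * α - 1) := by
          refine mul_le_mul_of_nonneg_left (Real.rpow_le_rpow_of_nonpos (by positivity) ?_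
            (by linarith)) (by norm_num)
          have : max 1 w ≤ 4 * w := max_le (by linarith) (by linarith)
          linarith
        _ ≤ 576 * (4 * max 1 w ^ (2 * α - 1)) := by
          rw [Real.mul_rpow (by norm_num) (by positivity)]
          gcongr
          calc (4⁻¹ : ℝ) ^ (2 * α - 1) ≤ 4⁻¹ ^ (-1 : ℝ) :=
              Real.rpow_le_rpow_of_exponent_ge (by norm_num) (by norm_num) (by linarith)
            _ = 4 := by rw [Real.rpow_neg_one, inv_inv]
        _ ≤ _ := by
          have : 0 ≤ max 1 w ^ (2 * α - 1) := by positivity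
          linarith
  · refine (Finset.sum_le_sum fun k hk' => rpow_mul_hermiteProfile_le_of_ge hα hα1 hw (hk k)
      (not_le.1 (Finset.mem_filter.1 hk').2)).trans ?_
    refine (Finset.sum_le_sum_of_subset_of_nonneg (Finset.filter_subset _ _)
      fun k _ _ => by positivity).trans ?_
    rw [← Finset.mul_sum]
    have h1 := sum_rpow_neg_le (p := 1 - 2 * α) (by linarith) (by linarith) (le_max_left 1 w) N
    rw [show -(1 - 2 * α + 1) = 2 * α - 2 by ring, show -(1 - 2 * α) = 2 * α - 1 by ring] at h1
    calc _ ≤ 18 * (2 / (1 - 2 * α) * max 1 w ^ (2 * α - 1)) := by gcongr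
      _ = _ := by ring

/-- The map `x ↦ tan (arcsin x / 2)`. -/
def halfAngle (x : ℝ) : ℝ := x / (1 + Real.sqrt (1 - x ^ 2))

theorem halfAngle_nonneg {x : ℝ} (hx : 0 ≤ x) : 0 ≤ halfAngle x := by
  unfold halfAngle; positivity

theorem halfAngle_le {x : ℝ} (hx : 0 ≤ x) : halfAngle x ≤ x := by
  unfold halfAngle
  exact div_le_self hx (by linarith [Real.sqrt_nonneg (1 - x ^ 2)])

theorem le_two_mul_halfAngle {x : ℝ} (hx : 0 ≤ x) : x ≤ 2 * halfAngle x := by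
  unfold halfAngle
  have h1 : Real.sqrt (1 - x ^ 2) ≤ 1 := Real.sqrt_le_one.2 (by nlinarith)
  have h0 := Real.sqrt_nonneg (1 - x ^ 2)
  rw [mul_div_assoc', le_div_iff₀ (by linarith)]
  nlinarith

theorem two_mul_halfAngle {x : ℝ} (hx : x ∈ Icc (0:ℝ) 1) :
    2 * halfAngle x = x * (1 + halfAngle x ^ 2) := by
  unfold halfAngle
  have h0 := Real.sqrt_nonneg (1 - x ^ 2)
  have h2 : Real.sqrt (1 - x ^ 2) ^ 2 = 1 - x ^ 2 := Real.sq_sqrt (by nlinarith [hx.1, hx.2])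
  have h3 : 1 + Real.sqrt (1 - x ^ 2) ≠ 0 := by positivity
  field_simp
  linear_combination (-x) * h2

theorem abs_halfAngle_sub_le {ε z x : ℝ} (hε : 0 < ε) (hz : 0 ≤ z) (hzε : z ^ 2 + ε ^ 2 ≤ 1)
    (hx : x ∈ Icc (0:ℝ) 1) : |halfAngle z - halfAngle x| ≤ 4 / ε * |z - x| := by
  have hz1 : z ≤ 1 := by nlinarith
  have hu := two_mul_halfAngle ⟨hz, hz1⟩
  have hv := two_mul_halfAngle hx
  have hu0 := halfAngle_nonneg hz
  have hv0 := halfAngle_nonneg hx.1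
  have hv1 : halfAngle x ≤ 1 := (halfAngle_le hx.1).trans hx.2
  have hu1 : halfAngle z ≤ 1 := (halfAngle_le hz).trans hz1
  have huε : halfAngle z ≤ 1 - ε / 2 := by
    have hc : ε ≤ Real.sqrt (1 - z ^ 2) := Real.le_sqrt_of_sq_le (by linarith)
    have he : halfAngle z * (1 + Real.sqrt (1 - z ^ 2)) = z := by
      unfold halfAngle
      have : 1 + Real.sqrt (1 - z ^ 2) ≠ 0 := by positivity
      field_simp
    have hε1 : ε ≤ 1 := by nlinarith
    nlinarith [mul_le_mul_of_nonneg_left hc hu0]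
  generalize halfAngle z = u at *
  generalize halfAngle x = v at *
  have key : (z - x) * ((1 + u ^ 2) * (1 + v ^ 2)) = 2 * (u - v) * (1 - u * v) := by
    linear_combination (-(1 + v ^ 2)) * hu + (1 + u ^ 2) * hv
  have hk := congrArg abs key
  have h1 : 0 < (1 + u ^ 2) * (1 + v ^ 2) := by positivity
  have h2 : ε / 2 ≤ 1 - u * v := by nlinarith
  have h4 : (1 + u ^ 2) * (1 + v ^ 2) ≤ 4 := by
    calc (1 + u ^ 2) * (1 + v ^ 2) ≤ 2 * 2 :=
        mul_le_mul (by nlinarith) (by nlinarith) (by positivity) (by norm_num)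
      _ = 4 := by norm_num
  rw [abs_mul, abs_of_pos h1, abs_mul, abs_of_nonneg (by linarith : 0 ≤ 1 - u * v), abs_mul,
    abs_two] at hk
  rw [div_mul_eq_mul_div, le_div_iff₀ hε]
  nlinarith [abs_nonneg (z - x), abs_nonneg (u - v),
    mul_le_mul_of_nonneg_left h4 (abs_nonneg (z - x)),
    mul_le_mul_of_nonneg_left h2 (abs_nonneg (u - v))]

theorem one_sub_div_sq {M p S : ℝ} (hM : 0 < M) (hMp : M ≤ p) (hS : S ^ 2 = (p - M) * (p + M)) :
    1 - (S / p) ^ 2 = (M / p) ^ 2 := by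
  have hp : 0 < p := by linarith
  field_simp
  rw [hS]
  ring

theorem mul_halfAngle_div {M p S : ℝ} (hM : 0 < M) (hMp : M ≤ p)
    (hS : S ^ 2 = (p - M) * (p + M)) : S * halfAngle (S / p) = p - M := by
  have hp : 0 < p := by linarith
  rw [halfAngle, one_sub_div_sq hM hMp hS, Real.sqrt_sq (by positivity)]
  field_simp
  linear_combination hS

theorem mul_sub_le_of_sq_mul_le {s b z i c : ℝ} (hs : 1 ≤ s) (hb : 0 ≤ b) (hbz : b ≤ z)
    (hi : i ≤ s * b) (h : s ^ 2 * (z ^ 2 - b ^ 2) ≤ c) : i * (z - b) ≤ c := by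
  have h0 : 0 ≤ z - b := by linarith
  have hz : 0 ≤ z := by linarith
  have h1 : 0 ≤ s ^ 2 * (z * (z - b)) := by positivity
  have h2 : s * b ≤ s ^ 2 * b := by gcongr; nlinarith
  have h3 : i * (z - b) ≤ s ^ 2 * b * (z - b) := by gcongr; linarith
  linarith [show s ^ 2 * (z ^ 2 - b ^ 2) = s ^ 2 * b * (z - b) + s ^ 2 * (z * (z - b)) by ring]

/-- The data of one term of the cluster sum: `i² ≤ n(n+1) - M² ≤ (i+1)²`, `ε(n+1/2) ≤ M ≤ n` and
`b` is the turning point. -/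
structure IsClusterTerm (ε n M i b : ℝ) : Prop where
  eps_pos : 0 < ε
  eps_lt_one : ε < 1
  one_le_i : 1 ≤ i
  one_le : 1 ≤ M
  le : M ≤ n
  eps_le : ε * (n + 1 / 2) ≤ M
  sq_le : i ^ 2 ≤ n * (n + 1) - M ^ 2
  le_sq : n * (n + 1) - M ^ 2 ≤ (i + 1) ^ 2
  b_pos : 0 < b
  turning : n * (n + 1) * b ^ 2 = n * (n + 1) - M ^ 2

namespace IsClusterTerm

variable {ε n M i b : ℝ}

theorem sq_add_sq_le_one (h : IsClusterTerm ε n M i b) : b ^ 2 + ε ^ 2 ≤ 1 := by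
  have h1 := h.one_le
  have h2 := h.le
  have h3 := h.turning
  have h4 : (ε * (n + 1 / 2)) ^ 2 ≤ M ^ 2 := by
    have := h.eps_pos
    exact pow_le_pow_left₀ (mul_nonneg this.le (by linarith)) h.eps_le 2
  have h5 : 0 < n * (n + 1) := by nlinarith
  have h6 : ε ^ 2 * (n * (n + 1)) ≤ M ^ 2 := by nlinarith [sq_nonneg ε]
  nlinarith

theorem sqrt_mul_eq (h : IsClusterTerm ε n M i b) :
    Real.sqrt (n * (n + 1)) * b = Real.sqrt (n * (n + 1) - M ^ 2) := by
  have h0 : 0 ≤ n * (n + 1) := by nlinarith [h.one_le, h.le]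
  rw [← h.turning, Real.sqrt_mul h0, Real.sqrt_sq h.b_pos.le]

theorem le_sqrt_mul (h : IsClusterTerm ε n M i b) : i ≤ Real.sqrt (n * (n + 1)) * b := by
  rw [h.sqrt_mul_eq]
  exact Real.le_sqrt_of_sq_le h.sq_le

theorem sqrt_mul_le (h : IsClusterTerm ε n M i b) : Real.sqrt (n * (n + 1)) * b ≤ i + 1 := by
  rw [h.sqrt_mul_eq]
  exact Real.sqrt_le_iff.2 ⟨by linarith [h.one_le_i], h.le_sq⟩

theorem le_sqrt (h : IsClusterTerm ε n M i b) : n ≤ Real.sqrt (n * (n + 1)) :=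
  Real.le_sqrt_of_sq_le (by nlinarith [h.one_le, h.le])

theorem sqrt_le (h : IsClusterTerm ε n M i b) : Real.sqrt (n * (n + 1)) ≤ n + 1 / 2 :=
  Real.sqrt_le_iff.2 ⟨by linarith [h.one_le, h.le], by nlinarith⟩

theorem one_le_two_mul (h : IsClusterTerm ε n M i b) :
    1 ≤ 2 * (Real.sqrt (n * (n + 1)) * b ^ 2) := by
  have h0 := h.sqrt_le
  have h1 := h.le_sqrt
  have h2 := h.one_le
  have h3 := h.le
  have hs : Real.sqrt (n * (n + 1)) ^ 2 = n * (n + 1) := Real.sq_sqrt (by nlinarith)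
  have h4 : n ≤ Real.sqrt (n * (n + 1)) * (Real.sqrt (n * (n + 1)) * b ^ 2) := by
    have := h.turning
    rw [← mul_assoc, ← sq, hs]
    nlinarith
  have h5 : 0 < Real.sqrt (n * (n + 1)) := by linarith
  generalize Real.sqrt (n * (n + 1)) = s at *
  nlinarith

theorem sqrt_mul_sq_le (h : IsClusterTerm ε n M i b) :
    Real.sqrt (n * (n + 1)) * b ^ 2 ≤ 3 * (n - M + 1 / 2) := by
  have h0 := h.sqrt_le
  have h1 := h.le_sqrt
  have h2 := h.one_le
  have h3 := h.le
  have hs : Real.sqrt (n * (n + 1)) ^ 2 = n * (n + 1) := Real.sq_sqrt (by nlinarith)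
  have h4 : Real.sqrt (n * (n + 1)) * (Real.sqrt (n * (n + 1)) * b ^ 2) ≤
      (n - M + 1 / 2) * (n + M + 1 / 2) := by
    have := h.turning
    rw [← mul_assoc, ← sq, hs]
    nlinarith
  have h5 : 0 < Real.sqrt (n * (n + 1)) := by linarith
  generalize Real.sqrt (n * (n + 1)) = s at *
  have h6 : s * (s * b ^ 2) ≤ s * (3 * (n - M + 1 / 2)) := h4.trans (by nlinarith)
  exact le_of_mul_le_mul_left h6 h5

theorem mul_le (h : IsClusterTerm ε n M i b) : i * b ≤ 3 * (n - M + 1 / 2) := by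
  nlinarith [h.sqrt_mul_sq_le, h.le_sqrt_mul, h.b_pos]

theorem le_mul (h : IsClusterTerm ε n M i b) : n - M + 1 / 2 ≤ 5 / 2 * (i * b) := by
  have h0 := h.sqrt_le
  have h2 := h.one_le
  have h3 := h.le
  have h4 := h.sq_le
  have h6 := h.one_le_i
  have hs : Real.sqrt (n * (n + 1)) ^ 2 = n * (n + 1) := Real.sq_sqrt (by nlinarith)
  have h7 : 0 < Real.sqrt (n * (n + 1)) := by linarith [h.le_sqrt]
  have hl : Real.sqrt (n * (n + 1)) * (Real.sqrt (n * (n + 1)) * b ^ 2) = n * (n + 1) - M ^ 2 := by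
    rw [← mul_assoc, ← sq, hs, h.turning]
  have h5 : (n - M + 1 / 2) * (n + 1 / 2) ≤
      5 / 4 * (Real.sqrt (n * (n + 1)) * (Real.sqrt (n * (n + 1)) * b ^ 2)) := by
    rw [hl]
    nlinarith
  have h8 : (n - M + 1 / 2) * Real.sqrt (n * (n + 1)) ≤ 5 / 4 * (Real.sqrt (n * (n + 1)) * b ^ 2)
      * Real.sqrt (n * (n + 1)) := by nlinarith
  have h9 := le_of_mul_le_mul_right h8 h7
  have h10 : Real.sqrt (n * (n + 1)) * b ≤ 2 * i := by linarith [h.sqrt_mul_le]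
  nlinarith [h.b_pos]

theorem exists_angle (h : IsClusterTerm ε n M i b) :
    ∃ S z, i ≤ S ∧ S ≤ i + 2 ∧ 0 ≤ z ∧ z ^ 2 + ε ^ 2 ≤ 1 ∧ S * halfAngle z = n - M + 1 / 2 ∧
      i * |z - b| ≤ 1 / 4 := by
  have h2 := h.one_le
  have h3 := h.le
  have h6 := h.one_le_i
  have hε := h.eps_pos
  have hb := h.b_pos
  set p := n + 1 / 2 with hpn
  have hp : 0 < p := by linarith
  set S := Real.sqrt ((p - M) * (p + M)) with hS
  have hSS : S ^ 2 = (p - M) * (p + M) := Real.sq_sqrt (by nlinarith)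
  have hiS : i ≤ S := Real.le_sqrt_of_sq_le (by nlinarith [h.sq_le])
  have hSi : S ≤ i + 2 := Real.sqrt_le_iff.2 ⟨by linarith, by nlinarith [h.le_sq]⟩
  have hzM := one_sub_div_sq (by linarith) (by linarith) hSS
  have hκ := mul_halfAngle_div (by linarith) (by linarith) hSS
  have hzS : S = p * (S / p) := by field_simp
  have hcM : M = p * (M / p) := by field_simp
  have hc : ε ≤ M / p := (le_div_iff₀ hp).2 h.eps_le
  have hz0 : 0 ≤ S / p := by positivity
  set z := S / p with hz
  have hzε : z ^ 2 + ε ^ 2 ≤ 1 := by nlinarith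
  refine ⟨S, z, hiS, hSi, hz0, hzε, by linarith, ?_⟩
  have h7 : 0 < n * (n + 1) := by nlinarith
  have e3 : n * (n + 1) * (z ^ 2 - b ^ 2) = 1 / 4 * (M / p) ^ 2 := by
    have e4 : n = p - 1 / 2 := by linarith
    rw [mul_sub, h.turning, e4]
    linear_combination (-(p ^ 2 - 1 / 4)) * hzM + (M + p * (M / p)) * hcM
  have e2 : 0 ≤ n * (n + 1) * (z ^ 2 - b ^ 2) := by rw [e3]; positivity
  have e1 : n * (n + 1) * (z ^ 2 - b ^ 2) ≤ 1 / 4 := by rw [e3]; nlinarith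
  have hzb : b ≤ z := by
    have : 0 ≤ z ^ 2 - b ^ 2 := nonneg_of_mul_nonneg_right e2 h7
    nlinarith
  rw [abs_of_nonneg (by linarith)]
  have hs : Real.sqrt (n * (n + 1)) ^ 2 = n * (n + 1) := Real.sq_sqrt (by nlinarith)
  have h8 := h.le_sqrt_mul
  have h9 := h.le_sqrt
  rw [← hs] at e1
  exact mul_sub_le_of_sq_mul_le (by linarith) hb.le hzb h8 e1

theorem abs_sub_halfAngle_le (h : IsClusterTerm ε n M i b) {x : ℝ} (hx : x ∈ Icc (0:ℝ) 1) :
    |n - M + 1 / 2 - i * halfAngle x| ≤ 6 / ε * (i * |b - x| + 1) := by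
  have h2 := h.one_le
  have h3 := h.le
  have h6 := h.one_le_i
  have hε := h.eps_pos
  have hε1 := h.eps_lt_one
  have hb := h.b_pos
  obtain ⟨S, z, hiS, hSi, hz0, hzε, hκ, hzb⟩ := h.exists_angle
  have hu0 := halfAngle_nonneg hz0
  have hu1 : halfAngle z ≤ 1 := (halfAngle_le hz0).trans (by nlinarith)
  have hL := abs_halfAngle_sub_le hε hz0 hzε hx
  have hzx : i * |z - x| ≤ i * |b - x| + 1 / 4 := by
    have := abs_sub_le z b x
    nlinarith
  have e : n - M + 1 / 2 - i * halfAngle x =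
      (S - i) * halfAngle z + i * (halfAngle z - halfAngle x) := by rw [← hκ]; ring
  have h13 : |(S - i) * halfAngle z| ≤ 2 := by
    rw [abs_of_nonneg (mul_nonneg (by linarith) hu0)]
    nlinarith
  have h14 : |i * (halfAngle z - halfAngle x)| ≤ 4 / ε * (i * |b - x| + 1 / 4) := by
    rw [abs_mul, abs_of_nonneg (by linarith : 0 ≤ i)]
    calc i * |halfAngle z - halfAngle x| ≤ i * (4 / ε * |z - x|) := by gcongr
      _ = 4 / ε * (i * |z - x|) := by ring
      _ ≤ _ := by gcongr
  rw [e]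
  refine (abs_add_le _ _).trans ((add_le_add h13 h14).trans ?_)
  have h15 : 0 ≤ i * |b - x| := by positivity
  rw [div_mul_eq_mul_div, div_mul_eq_mul_div, ← sub_nonneg]
  have : 6 * (i * |b - x| + 1) / ε - (2 + 4 * (i * |b - x| + 1 / 4) / ε) =
    (2 * (i * |b - x|) + 5 - 2 * ε) / ε := by field_simp; ring
  rw [this]
  exact div_nonneg (by linarith) hε.le

theorem sqrt_six_mul_le {C κ t : ℝ} (hC : 1 ≤ C) (hκ : 1 / 2 ≤ κ) (ht : t < 2 * C) (ht0 : 0 ≤ t) :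
    Real.sqrt (6 * κ) ≤ 18 * C * (κ / (1 + t)) ^ (3 / 4 : ℝ) := by
  have hκ0 : 0 < κ := by linarith
  have h1 : Real.sqrt (6 * κ) ≤ 3 * κ ^ (1 / 2 : ℝ) := by
    rw [← Real.sqrt_eq_rpow, Real.sqrt_mul (by norm_num)]
    gcongr
    exact Real.sqrt_le_iff.2 ⟨by norm_num, by norm_num⟩
  have h2 : κ ^ (1 / 2 : ℝ) ≤ 2 * κ ^ (3 / 4 : ℝ) := by
    have h3 : (1 / 2 : ℝ) ≤ κ ^ (1 / 4 : ℝ) := by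
      calc (1 / 2 : ℝ) = (1 / 2) ^ (1 : ℝ) := (Real.rpow_one _).symm
        _ ≤ (1 / 2) ^ (1 / 4 : ℝ) :=
          Real.rpow_le_rpow_of_exponent_ge (by norm_num) (by norm_num) (by norm_num)
        _ ≤ _ := Real.rpow_le_rpow (by norm_num) hκ (by norm_num)
    have h4 : κ ^ (3 / 4 : ℝ) = κ ^ (1 / 2 : ℝ) * κ ^ (1 / 4 : ℝ) := by
      rw [← Real.rpow_add hκ0]; norm_num
    have h5 : 0 < κ ^ (1 / 2 : ℝ) := by positivity
    rw [h4]
    nlinarith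
  have h6 : (1 + t) ^ (3 / 4 : ℝ) ≤ 3 * C := by
    calc (1 + t) ^ (3 / 4 : ℝ) ≤ (1 + t) ^ (1 : ℝ) :=
        Real.rpow_le_rpow_of_exponent_le (by linarith) (by norm_num)
      _ ≤ 3 * C := by rw [Real.rpow_one]; linarith
  have h7 : 0 < (1 + t) ^ (3 / 4 : ℝ) := by positivity
  have h8 : 0 < κ ^ (3 / 4 : ℝ) := by positivity
  rw [Real.div_rpow hκ0.le (by linarith), mul_div_assoc', le_div_iff₀ h7]
  calc Real.sqrt (6 * κ) * (1 + t) ^ (3 / 4 : ℝ) ≤ (3 * (2 * κ ^ (3 / 4 : ℝ))) * (3 * C) := by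
        gcongr; linarith
    _ = _ := by ring

theorem sq_le_far (h : IsClusterTerm ε n M i b) {y v : ℝ → ℝ}
    (hy : IsLegendreSolution (n * (n + 1)) b y v) {x : ℝ} (hx : x ∈ Icc (0:ℝ) 1)
    (hw : 6 * (n - M + 1 / 2) ≤ i * halfAngle x) :
    b * y x ^ 2 ≤ 6 / ε ^ 2 * b ^ 2 * (i / (i * halfAngle x)) ^ 2 := by
  have h6 := h.one_le_i
  have hb := h.b_pos
  have hε := h.eps_pos
  have hκ : 0 < n - M + 1 / 2 := by linarith [h.le]
  have hv : 0 < halfAngle x := by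
    by_contra! hc
    nlinarith
  have hvx := halfAngle_le hx.1
  have hbx : 2 * b ≤ x := by
    have h1 := h.mul_le
    have h2 : i * (2 * b) ≤ i * x := by nlinarith
    exact le_of_mul_le_mul_left h2 (by linarith)
  have h3 := hy.sq_mul_le (by nlinarith [h.one_le, h.le]) hb hε h.sq_add_sq_le_one
    (x := x) ⟨by linarith, hx.2⟩
  have e : i / (i * halfAngle x) = 1 / halfAngle x := by field_simp
  rw [e, div_pow, one_pow, mul_one_div, le_div_iff₀ (by positivity)]
  have h4 : 3 / 4 * halfAngle x ^ 2 ≤ x ^ 2 - b ^ 2 := by nlinarith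
  have h5 : 3 / 4 * halfAngle x ^ 2 * y x ^ 2 ≤ 4 / ε ^ 2 * b :=
    (mul_le_mul_of_nonneg_right h4 (sq_nonneg _)).trans h3
  have h7 : b * (3 / 4 * halfAngle x ^ 2 * y x ^ 2) ≤ b * (4 / ε ^ 2 * b) := by gcongr
  have h8 : 6 / ε ^ 2 * b ^ 2 = 3 / 2 * (b * (4 / ε ^ 2 * b)) := by ring
  rw [h8]
  have h9 : 0 ≤ b * (4 / ε ^ 2 * b) := by positivity
  nlinarith

theorem mul_sq_le_near (h : IsClusterTerm ε n M i b) {y v : ℝ → ℝ}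
    (hy : IsLegendreSolution (n * (n + 1)) b y v) {x : ℝ} (hx : x ∈ Icc (0:ℝ) 1)
    (hw : i * halfAngle x < 6 * (n - M + 1 / 2)) :
    b * y x ^ 2 ≤ 10000 / ε ^ 7 *
      ((n - M + 1 / 2) / (1 + |n - M + 1 / 2 - i * halfAngle x|)) ^ (3 / 4 : ℝ) := by
  have h6 := h.one_le_i
  have hb := h.b_pos
  have hε := h.eps_pos
  have hκ : 1 / 2 ≤ n - M + 1 / 2 := by linarith [h.le]
  have hL : 0 < n * (n + 1) := by nlinarith [h.one_le, h.le]
  have hC : 1 ≤ 6 / ε := by rw [le_div_iff₀ hε]; linarith [h.eps_lt_one]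
  have hdist := h.abs_sub_halfAngle_le hx
  have hm1 := h.mul_le
  have hm2 := h.le_mul
  have hmK := h.sqrt_mul_sq_le
  set κ := n - M + 1 / 2 with hκd
  set t := |κ - i * halfAngle x| with ht
  have ht0 : 0 ≤ t := abs_nonneg _
  rcases lt_or_ge t (2 * (6 / ε)) with htc | htc
  · have h1 := hy.mul_sq_le_uniform hL hb hε h.sq_add_sq_le_one h.one_le_two_mul hx
    have h2 : Real.sqrt (2 * (Real.sqrt (n * (n + 1)) * b ^ 2)) ≤ Real.sqrt (6 * κ) :=
      Real.sqrt_le_sqrt (by linarith)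
    refine h1.trans ((mul_le_mul_of_nonneg_left h2 (by positivity)).trans ?_)
    calc 12 / ε ^ 6 * Real.sqrt (6 * κ)
      _ ≤ 12 / ε ^ 6 * (18 * (6 / ε) * (κ / (1 + t)) ^ (3 / 4 : ℝ)) := by
        gcongr
        exact sqrt_six_mul_le hC hκ htc ht0
      _ = 1296 / ε ^ 7 * (κ / (1 + t)) ^ (3 / 4 : ℝ) := by field_simp; norm_num
      _ ≤ _ := by gcongr; norm_num
  · have h1 : (1 + t) ≤ 24 / ε * (i * |b - x|) := by
      have e1 : 6 / ε * (i * |b - x| + 1) = 6 / ε * (i * |b - x|) + 6 / ε := by ring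
      have e2 : 24 / ε * (i * |b - x|) = 4 * (6 / ε * (i * |b - x|)) := by ring
      rw [e1] at hdist
      rw [e2]
      linarith
    have hi : 0 < i * |b - x| := by
      by_contra! hc
      have : 24 / ε * (i * |b - x|) ≤ 0 := mul_nonpos_of_nonneg_of_nonpos (by positivity) hc
      linarith
    have hbx : 0 < |b - x| := by
      by_contra! hc
      have : i * |b - x| ≤ 0 := mul_nonpos_of_nonneg_of_nonpos (by linarith) hc
      linarith
    have hxb : x ≠ b := by
      rintro rfl
      simp at hbx
    have hx30 : x ≤ 30 * b := by
      have := le_two_mul_halfAngle hx.1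
      have h2 : i * x ≤ i * (30 * b) := by nlinarith
      exact le_of_mul_le_mul_left h2 (by linarith)
    have h3 := hy.mul_sq_le_rpow hL hb hε h.sq_add_sq_le_one h.one_le_two_mul hx hxb hx30
    have h4 : b / |b - x| ≤ 72 / ε * (κ / (1 + t)) := by
      rw [div_le_iff₀ hbx, mul_div_assoc', div_mul_eq_mul_div, le_div_iff₀ (by positivity)]
      calc b * (1 + t) ≤ b * (24 / ε * (i * |b - x|)) := by gcongr
        _ = 24 / ε * (i * b) * |b - x| := by ring
        _ ≤ 24 / ε * (3 * κ) * |b - x| := by gcongr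
        _ = _ := by ring
    have h5 : (72 / ε) ^ (3 / 4 : ℝ) ≤ 72 / ε := by
      calc (72 / ε) ^ (3 / 4 : ℝ) ≤ (72 / ε) ^ (1 : ℝ) := by
            refine Real.rpow_le_rpow_of_exponent_le ?_ (by norm_num)
            rw [le_div_iff₀ hε]; linarith [h.eps_lt_one]
        _ = _ := Real.rpow_one _
    have hκ0 : 0 < κ := by linarith
    calc b * y x ^ 2 ≤ 120 / ε ^ 6 * (72 / ε * (κ / (1 + t))) ^ (3 / 4 : ℝ) := by
          refine h3.trans ?_
          gcongr
      _ = 120 / ε ^ 6 * ((72 / ε) ^ (3 / 4 : ℝ) * (κ / (1 + t)) ^ (3 / 4 : ℝ)) := by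
          rw [Real.mul_rpow (by positivity) (by positivity)]
      _ ≤ 120 / ε ^ 6 * (72 / ε * (κ / (1 + t)) ^ (3 / 4 : ℝ)) := by gcongr
      _ = 8640 / ε ^ 7 * (κ / (1 + t)) ^ (3 / 4 : ℝ) := by field_simp; norm_num
      _ ≤ _ := by gcongr; norm_num

theorem sq_le_hermiteProfile (h : IsClusterTerm ε n M i b) {y v : ℝ → ℝ}
    (hy : IsLegendreSolution (n * (n + 1)) b y v) {x : ℝ} (hx : x ∈ Icc (0:ℝ) 1) :
    y x ^ 2 ≤ 25000 / ε ^ 7 * (i / (n - M + 1 / 2)) *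
      hermiteProfile (i * halfAngle x) (n - M + 1 / 2) := by
  have h6 := h.one_le_i
  have hb := h.b_pos
  have hε := h.eps_pos
  have hm1 := h.mul_le
  have hm2 := h.le_mul
  have hκ : 0 < n - M + 1 / 2 := by linarith [h.le]
  have key : b * y x ^ 2 ≤ 10000 / ε ^ 7 *
      hermiteProfile (i * halfAngle x) (n - M + 1 / 2) := by
    unfold hermiteProfile
    split_ifs with hw
    · have hw0 : 0 < i * halfAngle x := by linarith
      refine (h.sq_le_far hy hx hw).trans ?_
      calc 6 / ε ^ 2 * b ^ 2 * (i / (i * halfAngle x)) ^ 2 =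
            6 / ε ^ 2 * ((i * b) ^ 2 / (i * halfAngle x) ^ 2) := by ring
        _ ≤ 6 / ε ^ 2 * ((3 * (n - M + 1 / 2)) ^ 2 / (i * halfAngle x) ^ 2) := by gcongr
        _ = 54 / ε ^ 2 * ((n - M + 1 / 2) ^ 2 / (i * halfAngle x) ^ 2) := by ring
        _ ≤ _ := by
          gcongr ?_ * _
          exact div_le_div₀ (by norm_num) (by norm_num) (by positivity)
            (pow_le_pow_of_le_one hε.le h.eps_lt_one.le (by norm_num))
    · exact h.mul_sq_le_near hy hx (not_le.1 hw)
  have hG := hermiteProfile_nonneg (w := i * halfAngle x) hκ.le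
  have h1 : 1 ≤ 5 / 2 * (i / (n - M + 1 / 2)) * b := by
    have e : 5 / 2 * (i / (n - M + 1 / 2)) * b = 5 / 2 * (i * b) / (n - M + 1 / 2) := by ring
    rw [e, le_div_iff₀ hκ]
    linarith
  calc y x ^ 2 ≤ 5 / 2 * (i / (n - M + 1 / 2)) * b * y x ^ 2 :=
        le_mul_of_one_le_left (sq_nonneg _) h1
    _ = 5 / 2 * (i / (n - M + 1 / 2)) * (b * y x ^ 2) := by ring
    _ ≤ 5 / 2 * (i / (n - M + 1 / 2)) * (10000 / ε ^ 7 *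
        hermiteProfile (i * halfAngle x) (n - M + 1 / 2)) := by gcongr
    _ = _ := by ring

theorem rpow_weight_le (h : IsClusterTerm ε n M i b) {α : ℝ} (hα : 0 ≤ α) (hα1 : α < 1 / 2) :
    (n * (n + 1) - M ^ 2) ^ α * M ^ (-(2 * α)) ≤ 3 / ε * ((n - M + 1 / 2) / i) ^ (2 * α) := by
  have h6 := h.one_le_i
  have hb := h.b_pos
  have hε := h.eps_pos
  have hM : 0 < M := by linarith [h.one_le]
  have hκ : 0 < n - M + 1 / 2 := by linarith [h.le]
  have hm1 := h.mul_le
  have h1 : n * (n + 1) - M ^ 2 ≤ (3 / ε * ((n - M + 1 / 2) / i)) ^ 2 * M ^ 2 := by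
    have h2 : ε * Real.sqrt (n * (n + 1)) ≤ M :=
      (mul_le_mul_of_nonneg_left h.sqrt_le hε.le).trans h.eps_le
    have h3 : b ≤ 3 * ((n - M + 1 / 2) / i) := by
      rw [mul_div_assoc', le_div_iff₀ (by linarith)]
      linarith
    have h4 : Real.sqrt (n * (n + 1)) * b ≤ 3 / ε * ((n - M + 1 / 2) / i) * M := by
      have : Real.sqrt (n * (n + 1)) ≤ M / ε := by rw [le_div_iff₀ hε]; linarith
      calc _ ≤ M / ε * (3 * ((n - M + 1 / 2) / i)) := by gcongr
        _ = _ := by ring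
    have h5 : n * (n + 1) - M ^ 2 = (Real.sqrt (n * (n + 1)) * b) ^ 2 := by
      rw [mul_pow, Real.sq_sqrt (by nlinarith [h.le]), h.turning]
    rw [h5, ← mul_pow]
    gcongr
  have hA : 0 < 3 / ε * ((n - M + 1 / 2) / i) := by positivity
  have hl : 0 ≤ n * (n + 1) - M ^ 2 := (sq_nonneg i).trans h.sq_le
  calc (n * (n + 1) - M ^ 2) ^ α * M ^ (-(2 * α)) ≤
        ((3 / ε * ((n - M + 1 / 2) / i)) ^ 2 * M ^ 2) ^ α * M ^ (-(2 * α)) := by gcongr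
    _ = (3 / ε * ((n - M + 1 / 2) / i)) ^ (2 * α) := by
        rw [← mul_pow, ← Real.rpow_natCast, ← Real.rpow_mul (by positivity),
          Real.mul_rpow hA.le hM.le, mul_assoc, Nat.cast_ofNat, ← Real.rpow_add hM]
        simp
    _ = (3 / ε) ^ (2 * α) * ((n - M + 1 / 2) / i) ^ (2 * α) := by
        rw [Real.mul_rpow (by positivity) (by positivity)]
    _ ≤ (3 / ε) ^ (1 : ℝ) * ((n - M + 1 / 2) / i) ^ (2 * α) := by
        gcongr
        · rw [le_div_iff₀ hε]; linarith [h.eps_lt_one]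
        · linarith
    _ = _ := by rw [Real.rpow_one]

theorem weighted_sq_le (h : IsClusterTerm ε n M i b) {y v : ℝ → ℝ}
    (hy : IsLegendreSolution (n * (n + 1)) b y v) {x : ℝ} (hx : x ∈ Icc (0:ℝ) 1)
    {α : ℝ} (hα : 0 ≤ α) (hα1 : α < 1 / 2) :
    (n * (n + 1) - M ^ 2) ^ α * M ^ (-(2 * α)) * y x ^ 2 ≤
      75000 / ε ^ 8 * ((n - M + 1 / 2) / i) ^ (2 * α - 1) *
        hermiteProfile (i * halfAngle x) (n - M + 1 / 2) := by
  have h6 := h.one_le_i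
  have hε := h.eps_pos
  have hκ : 0 < n - M + 1 / 2 := by linarith [h.le]
  have hi : 0 < i := by linarith
  calc _ ≤ 3 / ε * ((n - M + 1 / 2) / i) ^ (2 * α) * (25000 / ε ^ 7 * (i / (n - M + 1 / 2)) *
      hermiteProfile (i * halfAngle x) (n - M + 1 / 2)) :=
        mul_le_mul (h.rpow_weight_le hα hα1) (h.sq_le_hermiteProfile hy hx) (sq_nonneg _)
          (by positivity)
    _ = _ := by
      rw [Real.rpow_sub_one (by positivity)]
      field_simp
      ring

end IsClusterTerm

theorem card_le_of_abs_mem_Icc (T : Finset ℤ) {a d : ℝ} (hd : 0 ≤ d)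
    (h : ∀ m ∈ T, a ≤ |(m:ℝ)| ∧ |(m:ℝ)| ≤ a + d) : (T.card : ℝ) ≤ 2 * (d + 1) := by
  set S := Finset.Icc ⌈a⌉ ⌊a + d⌋ with hS
  have hsub : T ⊆ S ∪ S.image (fun m => -m) := by
    intro m hm
    have h1 := h m hm
    rw [Finset.mem_union, Finset.mem_image]
    rcases le_total 0 m with h0 | h0
    · left
      rw [abs_of_nonneg (by exact_mod_cast h0)] at h1
      exact Finset.mem_Icc.2 ⟨Int.ceil_le.2 h1.1, Int.le_floor.2 h1.2⟩
    · right
      rw [abs_of_nonpos (by exact_mod_cast h0)] at h1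
      refine ⟨-m, Finset.mem_Icc.2 ⟨Int.ceil_le.2 ?_, Int.le_floor.2 ?_⟩, neg_neg m⟩
      · push_cast; exact h1.1
      · push_cast; exact h1.2
  have hcard : T.card ≤ S.card + S.card :=
    (Finset.card_le_card hsub).trans ((Finset.card_union_le _ _).trans
      (Nat.add_le_add_left Finset.card_image_le _))
  have hScard : (S.card : ℝ) ≤ d + 1 := by
    rw [hS, Int.card_Icc]
    have h1 : ((⌊a + d⌋ + 1 - ⌈a⌉ : ℤ) : ℝ) ≤ d + 1 := by
      push_cast
      linarith [Int.floor_le (a + d), Int.le_ceil a]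
    rw [← Int.cast_natCast, Int.toNat_eq_max, Int.cast_max]
    exact max_le h1 (by push_cast; linarith)
  have : (T.card : ℝ) ≤ S.card + S.card := by exact_mod_cast hcard
  linarith

/-- The index set of the cluster sum. -/
def IsClusterIndex (ε : ℝ) (i : ℕ) (p : ℕ × ℤ) : Prop :=
  p.2.natAbs ≤ p.1 ∧ ε * ((p.1 : ℝ) + 1/2) ≤ |(p.2 : ℝ)| ∧
    (i:ℝ)^2 ≤ eigenL p.1 p.2 ∧ eigenL p.1 p.2 ≤ ((i:ℝ)+1)^2

namespace IsClusterIndex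

variable {ε : ℝ} {i : ℕ} {p : ℕ × ℤ}

theorem one_le_natAbs (h : IsClusterIndex ε i p) (hε : 0 < ε) : 1 ≤ p.2.natAbs := by
  by_contra! hc
  have h0 : p.2 = 0 := by omega
  have h1 := h.2.1
  rw [h0] at h1
  have : 0 < ε * ((p.1 : ℝ) + 1 / 2) := by positivity
  simp at h1
  linarith

theorem eigenL_eq (n : ℕ) (m : ℤ) : eigenL n m = n * (n + 1) - (m.natAbs : ℝ) ^ 2 := by
  rw [eigenL, Nat.cast_natAbs, Int.cast_abs, sq_abs]

theorem isClusterTerm (h : IsClusterIndex ε i p) (hε : 0 < ε) (hε1 : ε < 1) (hi : 1 ≤ i) :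
    ∃ b, IsClusterTerm ε p.1 p.2.natAbs i b := by
  have hM := h.one_le_natAbs hε
  obtain ⟨h1, h2, h3, h4⟩ := h
  rw [eigenL_eq] at h3 h4
  have hi' : (1:ℝ) ≤ i := by exact_mod_cast hi
  have hM' : (1:ℝ) ≤ p.2.natAbs := by exact_mod_cast hM
  have h1' : (p.2.natAbs : ℝ) ≤ p.1 := by exact_mod_cast h1
  have hn : (0:ℝ) < p.1 * (p.1 + 1) := by nlinarith
  have hl : (0:ℝ) < p.1 * (p.1 + 1) - (p.2.natAbs : ℝ) ^ 2 := lt_of_lt_of_le (by positivity) h3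
  refine ⟨Real.sqrt ((p.1 * (p.1 + 1) - (p.2.natAbs : ℝ) ^ 2) / (p.1 * (p.1 + 1))), hε, hε1, hi',
    hM', h1', ?_, h3, h4, by positivity, ?_⟩
  · rwa [Nat.cast_natAbs, Int.cast_abs]
  · rw [Real.sq_sqrt (by positivity), mul_div_cancel₀ _ hn.ne']

theorem weighted_tY_sq_le (h : IsClusterIndex ε i p) (hε : 0 < ε) (hε1 : ε < 1) (hi : 1 ≤ i)
    {α : ℝ} (hα : 0 ≤ α) (hα1 : α < 1 / 2) {x : ℝ} (hx : x ∈ Icc (0:ℝ) 1) :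
    eigenL p.1 p.2 ^ α * |(p.2 : ℝ)| ^ (-(2 * α)) * tY p.1 p.2 x ^ 2 ≤
      75000 / ε ^ 8 * ((((p.1 - p.2.natAbs : ℕ) : ℝ) + 1 / 2) / i) ^ (2 * α - 1) *
        hermiteProfile (i * halfAngle x) (((p.1 - p.2.natAbs : ℕ) : ℝ) + 1 / 2) := by
  obtain ⟨b, hb⟩ := h.isClusterTerm hε hε1 hi
  obtain ⟨v, hv⟩ := exists_isLegendreSolution (h.one_le_natAbs hε) h.1 rfl hb.turning
  have := hb.weighted_sq_le hv hx hα hα1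
  rw [tY_sq_s16 h.1, eigenL_eq, Nat.cast_sub h.1]
  rwa [Nat.cast_natAbs, Int.cast_abs] at *

theorem sub_natAbs_lt (h : IsClusterIndex ε i p) : p.1 - p.2.natAbs < i + 2 := by
  obtain ⟨h1, -, -, h4⟩ := h
  rw [eigenL_eq] at h4
  obtain ⟨k, hk⟩ := Nat.exists_eq_add_of_le h1
  rw [hk, Nat.add_sub_cancel_left]
  rw [hk] at h4
  push_cast at h4
  by_contra! hc
  have hc' : (i:ℝ) + 2 ≤ k := by exact_mod_cast hc
  have h0 : (0:ℝ) ≤ p.2.natAbs := Nat.cast_nonneg _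
  have hk0 : (0:ℝ) ≤ k := Nat.cast_nonneg _
  have hi0 : (0:ℝ) ≤ i := Nat.cast_nonneg _
  nlinarith [mul_nonneg h0 hk0]

theorem card_fiber_le {s : Finset (ℕ × ℤ)} (hs : ∀ p ∈ s, IsClusterIndex ε i p) (hi : 1 ≤ i)
    {k : ℕ} (hk : k < i + 2) :
    ((s.filter fun p => p.1 - p.2.natAbs = k).card : ℝ) ≤ 8 * (((k:ℝ) + 1 / 2) / i)⁻¹ := by
  set T := s.filter fun p => p.1 - p.2.natAbs = k with hT
  have hinj : InjOn (fun p : ℕ × ℤ => p.2) (T : Set (ℕ × ℤ)) := by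
    rintro ⟨n, m⟩ hp ⟨n', m'⟩ hp' (rfl : m = m')
    rw [Finset.mem_coe, hT, Finset.mem_filter] at hp hp'
    have h1 := (hs _ hp.1).1
    have h2 := (hs _ hp'.1).1
    have h3 := hp.2
    have h4 := hp'.2
    simp only at h1 h2 h3 h4
    rw [Prod.mk.injEq]
    exact ⟨by omega, rfl⟩
  have hi' : (1:ℝ) ≤ i := by exact_mod_cast hi
  have hk' : (k:ℝ) ≤ i + 1 := by exact_mod_cast Nat.lt_succ_iff.1 hk
  rw [← Finset.card_image_of_injOn hinj]
  refine (card_le_of_abs_mem_Icc _ (a := ((i:ℝ) ^ 2 - k * (k + 1)) / (2 * k + 1))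
    (d := (2 * (i:ℝ) + 1) / (2 * k + 1)) (by positivity) ?_).trans ?_
  · intro m hm
    obtain ⟨p, hp, rfl⟩ := Finset.mem_image.1 hm
    rw [hT, Finset.mem_filter] at hp
    obtain ⟨h1, -, h3, h4⟩ := hs p hp.1
    have hn : p.1 = p.2.natAbs + k := by omega
    rw [eigenL_eq, hn] at h3 h4
    push_cast [Nat.cast_natAbs] at h3 h4
    rw [← add_div, div_le_iff₀ (by positivity), le_div_iff₀ (by positivity)]
    constructor <;> nlinarith
  · rw [inv_div, mul_div_assoc', ← sub_nonneg]
    have e : 8 * (i:ℝ) / (k + 1 / 2) - 2 * ((2 * i + 1) / (2 * k + 1) + 1) =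
        (12 * i - 2 * (2 * k + 1) - 2) / (2 * k + 1) := by
      field_simp
      ring
    rw [e]
    exact div_nonneg (by linarith) (by positivity)

theorem sum_weighted_tY_sq_le {s : Finset (ℕ × ℤ)} (hs : ∀ p ∈ s, IsClusterIndex ε i p)
    (hε : 0 < ε) (hε1 : ε < 1) (hi : 1 ≤ i) {α : ℝ} (hα : 0 ≤ α) (hα1 : α < 1 / 2) {x : ℝ}
    (hx : x ∈ Icc (0:ℝ) 1) :
    ∑ p ∈ s, eigenL p.1 p.2 ^ α * |(p.2 : ℝ)| ^ (-(2 * α)) * tY p.1 p.2 x ^ 2 ≤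
      600000 / ε ^ 8 * (2400 + 36 / (1 - 2 * α)) * ((i:ℝ)⁻¹ ^ (2 * α - 2) *
        max 1 (i * halfAngle x) ^ (2 * α - 1)) := by
  have hi0 : (0:ℝ) < i := by exact_mod_cast hi
  rw [← Finset.sum_fiberwise_of_maps_to (t := Finset.range (i + 2))
    (g := fun p : ℕ × ℤ => p.1 - p.2.natAbs)
    (fun p hp => Finset.mem_range.2 (hs p hp).sub_natAbs_lt)]
  have hfib : ∀ k ∈ Finset.range (i + 2),
      ∑ p ∈ s with p.1 - p.2.natAbs = k,
        eigenL p.1 p.2 ^ α * |(p.2 : ℝ)| ^ (-(2 * α)) * tY p.1 p.2 x ^ 2 ≤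
      600000 / ε ^ 8 * (i:ℝ)⁻¹ ^ (2 * α - 2) * (((k:ℝ) + 1 / 2) ^ (2 * α - 2) *
        hermiteProfile (i * halfAngle x) ((k:ℝ) + 1 / 2)) := by
    intro k hk
    have hG := hermiteProfile_nonneg (w := i * halfAngle x) (κ := (k:ℝ) + 1 / 2) (by positivity)
    have hterm : ∀ p ∈ s.filter (fun p => p.1 - p.2.natAbs = k),
        eigenL p.1 p.2 ^ α * |(p.2 : ℝ)| ^ (-(2 * α)) * tY p.1 p.2 x ^ 2 ≤
        75000 / ε ^ 8 * (((k:ℝ) + 1 / 2) / i) ^ (2 * α - 1) *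
          hermiteProfile (i * halfAngle x) ((k:ℝ) + 1 / 2) := by
      intro p hp
      rw [Finset.mem_filter] at hp
      have := (hs p hp.1).weighted_tY_sq_le hε hε1 hi hα hα1 hx
      rwa [hp.2] at this
    refine (Finset.sum_le_card_nsmul _ _ _ hterm).trans ?_
    rw [nsmul_eq_mul]
    calc _ ≤ 8 * (((k:ℝ) + 1 / 2) / i)⁻¹ * (75000 / ε ^ 8 * (((k:ℝ) + 1 / 2) / i) ^ (2 * α - 1) *
          hermiteProfile (i * halfAngle x) ((k:ℝ) + 1 / 2)) := by
          gcongr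
          exact card_fiber_le hs hi (Finset.mem_range.1 hk)
      _ = 600000 / ε ^ 8 * (((k:ℝ) + 1 / 2) / i) ^ (2 * α - 1 - 1) *
          hermiteProfile (i * halfAngle x) ((k:ℝ) + 1 / 2) := by
          rw [Real.rpow_sub_one (by positivity) (2 * α - 1)]
          ring
      _ = _ := by
          rw [div_eq_mul_inv ((k:ℝ) + 1 / 2), Real.mul_rpow (by positivity) (by positivity),
            show 2 * α - 1 - 1 = 2 * α - 2 by ring]
          ring
  refine (Finset.sum_le_sum hfib).trans ?_
  rw [← Finset.mul_sum]
  calc _ ≤ 600000 / ε ^ 8 * (i:ℝ)⁻¹ ^ (2 * α - 2) * ((2400 + 36 / (1 - 2 * α)) *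
        max 1 (i * halfAngle x) ^ (2 * α - 1)) := by
        gcongr
        exact sum_rpow_mul_hermiteProfile_le hα hα1
          (mul_nonneg hi0.le (halfAngle_nonneg hx.1)) _
    _ = _ := by ring

theorem cluster_weight_mul_le {x α : ℝ} (hi : 1 ≤ i) (hα1 : α < 1 / 2) (hα : 0 ≤ α)
    (hx : 0 ≤ x) :
    1 / (i:ℝ) * max (1 / (i:ℝ)) x ^ (1 - 2 * α) * ((i:ℝ)⁻¹ ^ (2 * α - 2) *
      max 1 (i * halfAngle x) ^ (2 * α - 1)) ≤ 2 := by
  have hi0 : (0:ℝ) < i := by exact_mod_cast hi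
  set M := max 1 (i * halfAngle x) with hM
  have hM0 : 0 < M := lt_of_lt_of_le one_pos (le_max_left _ _)
  have h1 : max (1 / (i:ℝ)) x ≤ 2 * M * (i:ℝ)⁻¹ := by
    rw [← div_eq_mul_inv, le_div_iff₀ hi0]
    have h2 : 1 ≤ M := le_max_left _ _
    have h3 : i * halfAngle x ≤ M := le_max_right _ _
    have h4 := le_two_mul_halfAngle hx
    rcases max_cases (1 / (i:ℝ)) x with h | h <;> rw [h.1]
    · rw [div_mul_cancel₀ _ hi0.ne']; linarith
    · nlinarith
  calc _ ≤ 1 / (i:ℝ) * (2 * M * (i:ℝ)⁻¹) ^ (1 - 2 * α) * ((i:ℝ)⁻¹ ^ (2 * α - 2) *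
        M ^ (2 * α - 1)) := by
        have : 0 ≤ 1 - 2 * α := by linarith
        gcongr
    _ = 2 ^ (1 - 2 * α) * (M ^ (1 - 2 * α) * M ^ (2 * α - 1)) *
        ((i:ℝ)⁻¹ * (i:ℝ)⁻¹ ^ (1 - 2 * α) * (i:ℝ)⁻¹ ^ (2 * α - 2)) := by
        rw [Real.mul_rpow (by positivity) (by positivity), Real.mul_rpow (by norm_num) hM0.le]
        ring
    _ = 2 ^ (1 - 2 * α) := by
        rw [← Real.rpow_add hM0, ← Real.rpow_one_add' (by positivity) (by linarith),
          ← Real.rpow_add (by positivity)]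
        ring_nf
        simp
    _ ≤ 2 ^ (1:ℝ) := Real.rpow_le_rpow_of_exponent_le (by norm_num) (by linarith)
    _ = 2 := Real.rpow_one 2

end IsClusterIndex

/-- spectral cluster estimate in the Hermite regime `|m| ≥ ε(ℓ+1/2)`:
`(1/i) max{1/i,|x|}^{1−2α} ∑ λ_{ℓ,m}^α |m|^{−2α} |Ỹ_{ℓ,m}(x)|² ≤ C`, the sum being over
`|m| ≤ ℓ`, `|m| ≥ ε(ℓ+1/2)`, `λ_{ℓ,m} ∈ [i²,(i+1)²]`. -/
theorem statement16 (ε : ℝ) (hε : ε ∈ Set.Ioo (0:ℝ) 1) (α : ℝ)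
    (hα : α ∈ Set.Ico (0:ℝ) (1/2)) :
    ∃ C : ℝ, 0 < C ∧
      ∀ i : ℕ, 1 ≤ i → ∀ x : ℝ, x ∈ Set.Icc (-1 : ℝ) 1 →
        ENNReal.ofReal ((1/(i:ℝ)) * max (1/(i:ℝ)) |x| ^ (1 - 2*α)) *
          ∑' p : {p : ℕ × ℤ // p.2.natAbs ≤ p.1 ∧ ε * ((p.1 : ℝ) + 1/2) ≤ |(p.2 : ℝ)| ∧
              (i:ℝ)^2 ≤ eigenL p.1 p.2 ∧ eigenL p.1 p.2 ≤ ((i:ℝ)+1)^2},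
            ENNReal.ofReal
              (eigenL p.1.1 p.1.2 ^ α * |(p.1.2 : ℝ)| ^ (-(2*α)) * (tY p.1.1 p.1.2 x)^2) ≤
          ENNReal.ofReal C := by
  have hε0 := hε.1
  have hα0 := hα.1
  have hα1 : 0 < 1 - 2 * α := by linarith [hα.2]
  set A := 600000 / ε ^ 8 * (2400 + 36 / (1 - 2 * α)) with hA
  have hA0 : 0 < A := by positivity
  refine ⟨2 * A, by positivity, fun i hi x hx => ?_⟩
  rw [ENNReal.tsum_eq_iSup_sum, ENNReal.mul_iSup]
  refine iSup_le fun s => ?_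
  have hxabs : |x| ∈ Icc (0:ℝ) 1 := ⟨abs_nonneg x, abs_le.2 hx⟩
  have hnonneg : ∀ p : ℕ × ℤ, IsClusterIndex ε i p →
      0 ≤ eigenL p.1 p.2 ^ α * |(p.2 : ℝ)| ^ (-(2 * α)) * tY p.1 p.2 x ^ 2 := fun p hp => by
    have : 0 ≤ eigenL p.1 p.2 := (sq_nonneg _).trans hp.2.2.1
    positivity
  rw [← ENNReal.ofReal_sum_of_nonneg fun p _ => hnonneg p.1 p.2,
    ← ENNReal.ofReal_mul (by positivity)]
  refine ENNReal.ofReal_le_ofReal ?_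
  have hsum : ∑ p ∈ s, eigenL p.1.1 p.1.2 ^ α * |(p.1.2 : ℝ)| ^ (-(2 * α)) *
      tY p.1.1 p.1.2 x ^ 2 = ∑ p ∈ s.map (Function.Embedding.subtype _),
        eigenL p.1 p.2 ^ α * |(p.2 : ℝ)| ^ (-(2 * α)) * tY p.1 p.2 |x| ^ 2 := by
    rw [Finset.sum_map]
    refine Finset.sum_congr rfl fun p _ => ?_
    rcases abs_choice x with h | h <;> rw [h]
    · rfl
    · rw [Function.Embedding.subtype_apply, tY_neg_sq p.2.1]
  have hbound := IsClusterIndex.sum_weighted_tY_sq_le (s := s.map (Function.Embedding.subtype _))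
    (fun p hp => by
      obtain ⟨q, -, rfl⟩ := Finset.mem_map.1 hp
      exact q.2) hε0 hε.2 hi hα0 hα.2 hxabs
  rw [hsum]
  calc _ ≤ 1 / (i:ℝ) * max (1 / (i:ℝ)) |x| ^ (1 - 2 * α) * (A * ((i:ℝ)⁻¹ ^ (2 * α - 2) *
        max 1 (i * halfAngle |x|) ^ (2 * α - 1))) := by gcongr
    _ = A * (1 / (i:ℝ) * max (1 / (i:ℝ)) |x| ^ (1 - 2 * α) * ((i:ℝ)⁻¹ ^ (2 * α - 2) *
        max 1 (i * halfAngle |x|) ^ (2 * α - 1))) := by ring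
    _ ≤ A * 2 := by
        gcongr
        exact IsClusterIndex.cluster_weight_mul_le hi hα.2 hα0 hxabs.1
    _ = 2 * A := by ring
end
end
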